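/- Let u^{ε,R} ∈ C^∞(Ω̄_R^ε) be the k-convex solution of the approximating problem with α ≥ α₀. Then |D²u^{ε,R}| ≤ C·C_ε·ε^{−1} on ∂B_ε(x₀) and |D²u^{ε,R}| ≤ C on ∂E_R(0), where C is a positive constant depending only on n, k, λ_max(A), λ_min(A), R₀ and α, independent of ε and R, and C_ε = C(n/k − 2)ε^{−1} if k < n/2, C_ε = Cε^{−1}|log ε|^{−1} if k = n/2, C_ε = C(2 − n/k)ε^{1−n/k} if k > n/2. -/

import Mathlib

open scoped Classical Topology
open Real Filter MeasureTheory

noncomputable section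

/-- Euclidean space ℝⁿ. -/
abbrev Euc (n : ℕ) : Type := EuclideanSpace ℝ (Fin n)

/-- The standard basis vector `e i`. -/
def ebasis (n : ℕ) (i : Fin n) : Euc n := EuclideanSpace.single i 1

/-- The Hessian matrix `D²u(x)`. -/
def hessMat (n : ℕ) (u : Euc n → ℝ) (x : Euc n) : Matrix (Fin n) (Fin n) ℝ :=
  Matrix.of fun i j => iteratedFDeriv ℝ 2 u x ![ebasis n i, ebasis n j]

/-- The Laplacian `Δu(x)` (trace of the Hessian). -/
def lapl (n : ℕ) (u : Euc n → ℝ) (x : Euc n) : ℝ := ∑ i, hessMat n u x i i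

/-- The `k`-th elementary symmetric function of the eigenvalues of an `n × n` matrix,
expressed through the coefficients of the characteristic polynomial. -/
def matSk (n k : ℕ) (M : Matrix (Fin n) (Fin n) ℝ) : ℝ :=
  (-1 : ℝ) ^ k * (Matrix.charpoly M).coeff (n - k)

/-- `S_k(D²u)(x)`. -/
def SkHess (n k : ℕ) (u : Euc n → ℝ) (x : Euc n) : ℝ := matSk n k (hessMat n u x)

/-- `u` is `k`-convex on `U`: the eigenvalues of the Hessian lie in the Gårding cone `Γ_k`. -/
def KConvexOn (n k : ℕ) (u : Euc n → ℝ) (U : Set (Euc n)) : Prop :=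
  ∀ x ∈ U, ∀ j : ℕ, 1 ≤ j → j ≤ k → 0 < matSk n j (hessMat n u x)

/-- Membership in the class `𝒜_k`: symmetric positive definite with `S_k(λ(A)) = 1`. -/
def MemA (n k : ℕ) (A : Matrix (Fin n) (Fin n) ℝ) : Prop :=
  A.IsSymm ∧ A.PosDef ∧ matSk n k A = 1

/-- The quadratic form `½ xᵀ A x`. -/
def quadA (n : ℕ) (A : Matrix (Fin n) (Fin n) ℝ) (x : Euc n) : ℝ :=
  (1 / 2) * ∑ i, ∑ j, x i * A i j * x j

/-- The linear form `b ⋅ x`. -/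
def linB (n : ℕ) (b x : Euc n) : ℝ := ∑ i, b i * x i

/-- `λ_max(A) < c`, expressed through the quadratic form (for symmetric `A`). -/
def lambdaMaxLT (n : ℕ) (A : Matrix (Fin n) (Fin n) ℝ) (c : ℝ) : Prop :=
  ∀ x : Euc n, x ≠ 0 → ∑ i, ∑ j, x i * A i j * x j < c * ‖x‖ ^ 2

/-- `u` is smooth on an open neighbourhood of the (closed) set `S`;
this is our rendering of `u ∈ C^∞(S)` for a closed set `S`. -/
def SmoothOnNhd (n : ℕ) (u : Euc n → ℝ) (S : Set (Euc n)) : Prop :=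
  ∃ U : Set (Euc n), IsOpen U ∧ S ⊆ U ∧ ContDiffOn ℝ (⊤ : ℕ∞) u U

/-- A smooth bounded strictly convex domain in ℝⁿ. -/
def SmoothStrictConvexDomain (n : ℕ) (Ω : Set (Euc n)) : Prop :=
  IsOpen Ω ∧ Bornology.IsBounded Ω ∧ Ω.Nonempty ∧ Convex ℝ Ω ∧ StrictConvex ℝ Ω ∧
    ∃ f : Euc n → ℝ, ContDiff ℝ (⊤ : ℕ∞) f ∧ Ω = {x | f x < 0} ∧
      ∀ x ∈ frontier Ω, fderiv ℝ f x ≠ 0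

/-- Extension of `u` by the constant value `v` inside `Ω`. -/
def extBy (n : ℕ) (Ω : Set (Euc n)) (v : ℝ) (u : Euc n → ℝ) : Euc n → ℝ :=
  fun x => if x ∈ Ω then v else u x

/-- `u` (vanishing on `∂Ω`) is quasiconvex: all sublevel sets of its zero-extension are convex. -/
def QuasiconvexSol (n : ℕ) (Ω : Set (Euc n)) (u : Euc n → ℝ) : Prop :=
  ∀ t : ℝ, Convex ℝ {x : Euc n | extBy n Ω 0 u x ≤ t}

/-- The `k`-th elementary symmetric polynomial of a vector `a ∈ ℝⁿ`. -/
def esymmVec (n k : ℕ) (a : Fin n → ℝ) : ℝ :=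
  ∑ s ∈ Finset.powersetCard k (Finset.univ : Finset (Fin n)), ∏ i ∈ s, a i

/-- `h_k(a) = max_i S_{k-1}(a)|_{a_i = 0} · a_i`. -/
def hkfun (n k : ℕ) (a : Fin n → ℝ) : ℝ :=
  ⨆ i : Fin n, esymmVec n (k - 1) (Function.update a i 0) * a i

/-- The exponent `-k / (2 h_k(a))`. -/
def genExp (n k : ℕ) (a : Fin n → ℝ) : ℝ := -(k : ℝ) / (2 * hkfun n k a)

/-- The integrand `(1 + α t^{-k/(2h_k(a))})^{1/k}`. -/
def genInt (n k : ℕ) (a : Fin n → ℝ) (α t : ℝ) : ℝ :=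
  (1 + α * t ^ genExp n k a) ^ ((1 : ℝ) / (k : ℝ))

/-- The generalized symmetric function `ū`. -/
def ubar (n k : ℕ) (a : Fin n → ℝ) (R₀ α : ℝ) (x : Euc n) : ℝ :=
  ∫ t in R₀..(quadA n (Matrix.diagonal a) x), genInt n k a α t

/-- `μ(α) = ∫_{R₀}^∞ ((1 + α t^{-k/(2h_k(a))})^{1/k} - 1) dt - R₀`. -/
def muA (n k : ℕ) (a : Fin n → ℝ) (R₀ α : ℝ) : ℝ :=
  (∫ t in Set.Ioi R₀, (genInt n k a α t - 1)) - R₀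

/-- The ellipsoid `E_R(xb) = {x : ½ (x - xb)ᵀ A (x - xb) < R}`. -/
def ESet (n : ℕ) (A : Matrix (Fin n) (Fin n) ℝ) (xb : Euc n) (R : ℝ) : Set (Euc n) :=
  {x : Euc n | quadA n A (x - xb) < R}

/-- The non-concentric convex ring `Ω_R^ε = E_R(0) ∖ B̄_ε(x₀)`. -/
def OmegaRe (n : ℕ) (a : Fin n → ℝ) (x₀ : Euc n) (ε R : ℝ) : Set (Euc n) :=
  ESet n (Matrix.diagonal a) 0 R \ closure (Metric.ball x₀ ε)

/-- `u` is a `k`-convex solution of the approximating problem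
`S_k(D²u) = 1` in `Ω_R^ε`, `u = 0` on `∂B_ε(x₀)`, `u = ū` on `∂E_R(0)`. -/
def ApproxSol (n k : ℕ) (a : Fin n → ℝ) (x₀ : Euc n) (ε R R₀ α : ℝ)
    (u : Euc n → ℝ) : Prop :=
  SmoothOnNhd n u (closure (OmegaRe n a x₀ ε R)) ∧
  KConvexOn n k u (OmegaRe n a x₀ ε R) ∧
  (∀ x ∈ OmegaRe n a x₀ ε R, SkHess n k u x = 1) ∧
  (∀ x ∈ Metric.sphere x₀ ε, u x = 0) ∧
  (∀ x : Euc n, quadA n (Matrix.diagonal a) x = R → u x = ubar n k a R₀ α x)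

/-- The constant `C_ε` of the boundary gradient estimate. -/
def Ceps (n k : ℕ) (C ε : ℝ) : ℝ :=
  if 2 * k < n then C * ((n : ℝ) / (k : ℝ) - 2) * ε⁻¹
  else if 2 * k = n then C * ε⁻¹ * |Real.log ε|⁻¹
  else C * (2 - (n : ℝ) / (k : ℝ)) * ε ^ (1 - (n : ℝ) / (k : ℝ))

/-- `u` is a `k`-convex solution of the exterior Dirichlet problem
`S_k(D²u) = 1` in `ℝⁿ ∖ B̄_ε(x₀)`, `u = 0` on `∂B_ε(x₀)`, with quadratic asymptotics
`½ xᵀAx + c` at infinity (`A = diag a`). -/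
def ExtBallSol (n k : ℕ) (a : Fin n → ℝ) (x₀ : Euc n) (ε c : ℝ) (u : Euc n → ℝ) : Prop :=
  SmoothOnNhd n u (Metric.ball x₀ ε)ᶜ ∧
  KConvexOn n k u (closure (Metric.ball x₀ ε))ᶜ ∧
  (∀ x ∈ (closure (Metric.ball x₀ ε))ᶜ, SkHess n k u x = 1) ∧
  (∀ x ∈ Metric.sphere x₀ ε, u x = 0) ∧
  Tendsto (fun x : Euc n => u x - (quadA n (Matrix.diagonal a) x + c))
    (cocompact (Euc n)) (𝓝 0)

/-- `u` is a `k`-convex solution of the exterior Dirichlet problem on `ℝⁿ ∖ Ω₀` with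
asymptotics `½ xᵀAx + b·x + c` at infinity. -/
def ExtDomSol (n k : ℕ) (Ω₀ : Set (Euc n)) (A : Matrix (Fin n) (Fin n) ℝ) (b : Euc n)
    (c : ℝ) (u : Euc n → ℝ) : Prop :=
  SmoothOnNhd n u Ω₀ᶜ ∧
  KConvexOn n k u (closure Ω₀)ᶜ ∧
  (∀ x ∈ (closure Ω₀)ᶜ, SkHess n k u x = 1) ∧
  (∀ x ∈ frontier Ω₀, u x = 0) ∧
  Tendsto (fun x : Euc n => u x - (quadA n A x + linB n b x + c))
    (cocompact (Euc n)) (𝓝 0)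

/-- `u` is a solution of the exterior Dirichlet problem for the Laplace equation
`Δu = 1` on `ℝⁿ ∖ Ω₀` with asymptotics `½ xᵀAx + b·x + c` at infinity. -/
def ExtDomSolLap (n : ℕ) (Ω₀ : Set (Euc n)) (A : Matrix (Fin n) (Fin n) ℝ) (b : Euc n)
    (c : ℝ) (u : Euc n → ℝ) : Prop :=
  SmoothOnNhd n u Ω₀ᶜ ∧
  (∀ x ∈ (closure Ω₀)ᶜ, lapl n u x = 1) ∧
  (∀ x ∈ frontier Ω₀, u x = 0) ∧
  Tendsto (fun x : Euc n => u x - (quadA n A x + linB n b x + c))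
    (cocompact (Euc n)) (𝓝 0)

/-- `u` solves the exterior problem `Δu = 0` in `ℝⁿ ∖ Ω̄`, `u = 1` on `∂Ω`,
`u → 0` at infinity. -/
def HarmExtSol (n : ℕ) (Ω : Set (Euc n)) (u : Euc n → ℝ) : Prop :=
  SmoothOnNhd n u Ωᶜ ∧
  (∀ x ∈ (closure Ω)ᶜ, lapl n u x = 0) ∧
  (∀ x ∈ frontier Ω, u x = 1) ∧
  Tendsto u (cocompact (Euc n)) (𝓝 0)

end


section Part1
open Polynomial in
/-- Derivatives of real-rooted polynomials are real-rooted. -/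
lemma splits_deriv (p : ℝ[X]) (hp : p.Splits) : (derivative p).Splits := by
  by_cases h0 : p.natDegree = 0
  · have : derivative p = 0 := by
      rw [Polynomial.eq_C_of_natDegree_eq_zero h0]; simp
    rw [this]; exact Splits.zero
  · rw [splits_iff_card_roots] at hp ⊢
    have h1 := card_roots_le_derivative p
    have h2 := card_roots' (derivative p)
    have h3 := natDegree_derivative_lt h0
    omega

open Polynomial in
lemma splits_iter_deriv (p : ℝ[X]) (hp : p.Splits) (m : ℕ) : (derivative^[m] p).Splits := by
  induction m with
  | zero => simpa
  | succ m ih => rw [Function.iterate_succ_apply']; exact splits_deriv _ ih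

open Polynomial in
lemma splits_rev (p : ℝ[X]) (hp : p.Splits) : p.reverse.Splits := by
  rw [hp.eq_prod_roots, reverse_mul_of_domain]
  refine Splits.mul (by simp) ?_
  generalize p.roots = m
  induction m using Multiset.induction_on with
  | empty =>
    rw [Multiset.map_zero, Multiset.prod_zero, ← C_1, reverse_C]; exact Splits.C _
  | cons a m ih =>
    rw [Multiset.map_cons, Multiset.prod_cons, reverse_mul_of_domain]
    refine Splits.mul (Splits.of_natDegree_le_one ?_) ih
    exact (reverse_natDegree_le _).trans (by simp)

open Polynomial in
lemma quad_disc (p : ℝ[X]) (hp : p.Splits) (hd : p.natDegree ≤ 2) :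
    4 * p.coeff 0 * p.coeff 2 ≤ p.coeff 1 ^ 2 := by
  by_cases h2 : p.coeff 2 = 0
  · rw [h2]; nlinarith [sq_nonneg (p.coeff 1)]
  have hdeg : p.natDegree = 2 := le_antisymm hd (le_natDegree_of_ne_zero h2)
  obtain ⟨x, hx⟩ := hp.exists_eval_eq_zero (by
    intro h; rw [degree_eq_natDegree (by rintro rfl; simp at h2), hdeg] at h; norm_cast at h)
  rw [eval_eq_sum_range, hdeg] at hx
  simp [Finset.sum_range_succ] at hx
  have : p.coeff 1 ^ 2 - 4 * p.coeff 0 * p.coeff 2 = (2 * p.coeff 2 * x + p.coeff 1)^2 := by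
    linear_combination (-4 * p.coeff 2) * hx
  nlinarith [sq_nonneg (2 * p.coeff 2 * x + p.coeff 1)]

/-- elementary symmetric sums over a finset -/
noncomputable def es {ι : Type*} (s : Finset ι) (l : ι → ℝ) (j : ℕ) : ℝ :=
  ∑ t ∈ s.powersetCard j, ∏ i ∈ t, l i

lemma es_zero {ι : Type*} (s : Finset ι) (l : ι → ℝ) : es s l 0 = 1 := by simp [es]

lemma es_big {ι : Type*} (s : Finset ι) (l : ι → ℝ) (j : ℕ) (h : s.card < j) : es s l j = 0 := by
  simp [es, Finset.powersetCard_eq_empty.2 h]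

lemma es_insert {ι : Type*} [DecidableEq ι] (s : Finset ι) (l : ι → ℝ) (i : ι) (hi : i ∉ s) (j : ℕ) :
    es (insert i s) l (j+1) = es s l (j+1) + l i * es s l j := by
  unfold es
  rw [Finset.powersetCard_succ_insert hi, Finset.sum_union]
  · congr 1
    rw [Finset.sum_image, Finset.mul_sum]
    · refine Finset.sum_congr rfl fun t ht => ?_
      rw [Finset.prod_insert]
      intro h; exact hi ((Finset.mem_powersetCard.1 ht).1 h)
    · intro t ht t' ht' h
      have h1 : i ∉ t := fun h => hi ((Finset.mem_powersetCard.1 ht).1 h)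
      have h2 : i ∉ t' := fun h => hi ((Finset.mem_powersetCard.1 ht').1 h)
      have := congrArg (fun z => Finset.erase z i) h
      simpa [Finset.erase_insert h1, Finset.erase_insert h2] using this
  · rw [Finset.disjoint_left]
    intro t ht ht'
    obtain ⟨t', _, rfl⟩ := Finset.mem_image.1 ht'
    exact hi ((Finset.mem_powersetCard.1 ht).1 (Finset.mem_insert_self _ _))

lemma es_erase {ι : Type*} [DecidableEq ι] (s : Finset ι) (l : ι → ℝ) (i : ι) (hi : i ∈ s) (j : ℕ) :
    es s l (j+1) = es (s.erase i) l (j+1) + l i * es (s.erase i) l j := by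
  conv_lhs => rw [← Finset.insert_erase hi]
  exact es_insert _ _ _ (Finset.notMem_erase _ _) _

lemma es_pos {ι : Type*} (s : Finset ι) (l : ι → ℝ) (hl : ∀ i ∈ s, 0 < l i) (j : ℕ)
    (hj : j ≤ s.card) : 0 < es s l j := by
  unfold es
  refine Finset.sum_pos (fun t ht => Finset.prod_pos fun i hi =>
    hl i ((Finset.mem_powersetCard.1 ht).1 hi)) (Finset.powersetCard_nonempty.2 hj)

open Polynomial in
lemma es_coeff {ι : Type*} (s : Finset ι) (l : ι → ℝ) (j : ℕ) (h : j ≤ s.card) :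
    (∏ i ∈ s, (X + C (l i))).coeff j = es s l (s.card - j) :=
  Finset.prod_X_add_C_coeff s l h

open Polynomial in
/-- Newton's inequality for real numbers. -/
lemma newton {ι : Type*} (s : Finset ι) (l : ι → ℝ) (j : ℕ) (hj : 1 ≤ j) (hjs : j + 1 ≤ s.card) :
    ((s.card : ℝ) - j + 1) * (j + 1) * (es s l (j-1) * es s l (j+1)) ≤
      ((s.card : ℝ) - j) * j * es s l j ^ 2 := by
  obtain ⟨i, rfl⟩ : ∃ i, j = i + 1 := ⟨j - 1, by omega⟩
  obtain ⟨r, hr⟩ : ∃ r, s.card = i + 2 + r := ⟨s.card - (i + 2), by omega⟩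
  set p : ℝ[X] := ∏ i ∈ s, (X + C (l i)) with hp
  have hps : p.Splits := Splits.prod fun i _ => Splits.X_add_C _
  have hpm : p.natDegree = i + 2 + r := by
    rw [hp, natDegree_prod_of_monic _ _ fun i _ => monic_X_add_C _]; simp [hr]
  have hpmon : p.Monic := monic_prod_of_monic _ _ fun i _ => monic_X_add_C _
  set q := derivative^[r] p with hq
  have hqs : q.Splits := splits_iter_deriv p hps r
  have hqd : q.natDegree = i + 2 := by
    apply le_antisymm
    · have := natDegree_iterate_derivative p r; rw [hpm, ← hq] at this; omega
    · apply le_natDegree_of_ne_zero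
      rw [hq, coeff_iterate_derivative]
      have : p.coeff (i + 2 + r) = 1 := by rw [← hpm]; exact hpmon.coeff_natDegree
      rw [this]
      simp [Nat.descFactorial_eq_zero_iff_lt]
  have hrs := splits_iter_deriv _ (splits_rev q hqs) i
  have hrd : (derivative^[i] q.reverse).natDegree ≤ 2 := by
    have := natDegree_iterate_derivative q.reverse i
    have h2 := reverse_natDegree_le q
    omega
  have key := quad_disc _ hrs hrd
  have hc : ∀ m, m ≤ 2 → (derivative^[i] q.reverse).coeff m =
     ((m + i).descFactorial i : ℝ) * (((2 - m + r).descFactorial r : ℝ) * es s l (i + m)) := by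
    intro m hm
    rw [coeff_iterate_derivative, coeff_reverse, hqd, revAt_le (by omega), hq,
      coeff_iterate_derivative, show i + 2 - (m + i) + r = 2 - m + r by omega, hp,
      es_coeff _ _ _ (by omega), show s.card - (2 - m + r) = i + m by omega]
    simp
  rw [hc 0 (by omega), hc 1 (by omega), hc 2 (by omega)] at key
  have d0 : ((0 + i).descFactorial i : ℝ) = (Nat.factorial i : ℝ) := by simp [Nat.descFactorial_self]
  have fac : ∀ m j : ℕ, ((m + j).descFactorial j : ℝ) * (Nat.factorial m : ℝ) = (Nat.factorial (m+j) : ℝ) := by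
    intro m j
    have := Nat.factorial_mul_descFactorial (n := m + j) (k := j) (by omega)
    rw [Nat.add_sub_cancel] at this
    rw [mul_comm]; exact_mod_cast this
  have a0 := fac 0 i
  have a1 := fac 1 i
  have a2 := fac 2 i
  have b0 := fac 0 r
  have b1 := fac 1 r
  have b2 := fac 2 r
  rw [add_comm 0 i, add_zero] at a0
  rw [add_comm 1 i] at a1
  rw [add_comm 2 i] at a2
  rw [add_comm 0 r, add_zero] at b0
  rw [add_comm 1 r] at b1
  rw [add_comm 2 r] at b2
  simp only [add_comm _ i, add_comm _ r, Nat.factorial, Nat.sub_self, add_zero, Nat.sub_zero, Nat.reduceSub] at *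
  have hi0 : (0:ℝ) < (Nat.factorial i : ℝ) := by exact_mod_cast Nat.factorial_pos i
  have hr0 : (0:ℝ) < (Nat.factorial r : ℝ) := by exact_mod_cast Nat.factorial_pos r
  push_cast at *
  simp only [mul_one] at *
  have ea2 : ((i+2).descFactorial i : ℝ) = (i+2)*((i+1)* (Nat.factorial i : ℝ))/2 := by linarith
  have eb2 : ((r+2).descFactorial r : ℝ) = (r+2)*((r+1)* (Nat.factorial r : ℝ))/2 := by linarith
  rw [d0, ea2, eb2, b0, a1, b1] at key
  rw [hr]
  push_cast
  set x := (Nat.factorial i : ℝ)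
  set y := (Nat.factorial r : ℝ)
  have hpos : 0 < x^2 * y^2 * (i+1) * (r+1) := by positivity
  refine le_of_mul_le_mul_left ?_ hpos
  have e : es s l (i + 1 + 1) = es s l (i+2) := rfl
  rw [e]
  nlinarith [key]

lemma newton' {ι : Type*} (s : Finset ι) (l : ι → ℝ) (j : ℕ) (hj : 1 ≤ j) (hjs : j ≤ s.card) :
    ((s.card : ℝ) - j + 1) * (j + 1) * (es s l (j-1) * es s l (j+1)) ≤
      ((s.card : ℝ) - j) * j * es s l j ^ 2 := by
  rcases Nat.lt_or_ge j s.card with h | h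
  · exact newton s l j hj h
  · have : s.card = j := le_antisymm h hjs
    rw [es_big s l (j+1) (by omega), this]; simp

lemma newton_weak {ι : Type*} (s : Finset ι) (l : ι → ℝ) (j : ℕ) :
    es s l j * es s l (j+2) ≤ es s l (j+1) ^ 2 := by
  rcases Nat.lt_or_ge s.card (j+2) with h | h
  · rw [es_big s l (j+2) h]; nlinarith [sq_nonneg (es s l (j+1))]
  · have := newton s l (j+1) (by omega) h
    simp only [Nat.add_sub_cancel] at this
    push_cast at this
    have h1 : (0:ℝ) ≤ (s.card:ℝ) - (j+1) := by
      have : ((j+2 : ℕ):ℝ) ≤ s.card := by exact_mod_cast h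
      push_cast at this; linarith
    by_contra! hc
    have h0 : 0 < es s l j * es s l (j+2) := lt_of_le_of_lt (sq_nonneg _) hc
    have h3 : ((s.card:ℝ) - (j+1)) * (j+1) * es s l (j+1) ^ 2 ≤ ((s.card:ℝ) - (j+1)) * (j+1) * (es s l j * es s l (j+2)) := by
      gcongr
    have h4 : ((s.card:ℝ) - (j+1)) * (j+1) < ((s.card:ℝ) - (j+1) + 1) * (j+1+1) := by
      nlinarith [(Nat.cast_nonneg j : (0:ℝ) ≤ j)]
    have e : es s l (j + 1 + 1) = es s l (j+2) := rfl
    rw [e] at this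
    nlinarith [mul_lt_mul_of_pos_right h4 h0]

lemma gar_pos {ι : Type*} [DecidableEq ι] (s : Finset ι) (l : ι → ℝ) (k : ℕ)
    (h : ∀ j, 1 ≤ j → j ≤ k → 0 < es s l j) (i : ι) (hi : i ∈ s) :
    ∀ j, j < k → 0 < es (s.erase i) l j := by
  intro j
  induction j with
  | zero => intro _; rw [es_zero]; norm_num
  | succ j ih =>
    intro hj
    have hp := ih (by omega)
    by_contra! hc
    have h1 := h (j+1) (by omega) (by omega)
    have h2 := h (j+2) (by omega) (by omega)
    rw [es_erase s l i hi] at h1 h2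
    have hN := newton_weak (s.erase i) l j
    have e : es (s.erase i) l (j + 1 + 1) = es (s.erase i) l (j+2) := rfl
    rw [e] at h2
    nlinarith

open Polynomial in
lemma es_sum_erase {ι : Type*} [DecidableEq ι] (s : Finset ι) (l : ι → ℝ) (j : ℕ) :
    ∑ i ∈ s, es (s.erase i) l j = ((s.card : ℝ) - j) * es s l j := by
  rcases Nat.lt_or_ge j s.card with h | h
  · have h1 : (derivative (∏ i ∈ s, (X + C (l i)))).coeff (s.card - 1 - j) =
        ((s.card:ℝ) - j) * es s l j := by
      rw [coeff_derivative, show s.card - 1 - j + 1 = s.card - j by omega, es_coeff _ _ _ (by omega),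
        show s.card - (s.card - j) = j by omega]
      have : ((s.card - 1 - j : ℕ) : ℝ) + 1 = (s.card:ℝ) - j := by
        rw [Nat.sub_sub, Nat.cast_sub (by omega)]; push_cast; ring
      rw [this]; ring
    rw [← h1, derivative_prod_finset, finset_sum_coeff]
    refine Finset.sum_congr rfl fun i hi => ?_
    have hcard := Finset.card_erase_of_mem hi
    simp only [derivative_add, derivative_X, derivative_C, add_zero, mul_one]
    rw [es_coeff _ _ _ (by omega)]
    congr 1; omega
  · have h1 : ∀ i ∈ s, es (s.erase i) l j = 0 := fun i hi => es_big _ _ _ (by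
      rw [Finset.card_erase_of_mem hi]; have := Finset.card_pos.2 ⟨i, hi⟩; omega)
    rw [Finset.sum_eq_zero h1]
    rcases h.eq_or_lt with h | h
    · rw [h]; simp
    · rw [es_big s l j h]; simp

lemma es_sum_mul {ι : Type*} [DecidableEq ι] (s : Finset ι) (l : ι → ℝ) (j : ℕ) :
    ∑ i ∈ s, l i * es (s.erase i) l j = (j + 1) * es s l (j+1) := by
  have h1 : ∑ i ∈ s, l i * es (s.erase i) l j = ∑ i ∈ s, (es s l (j+1) - es (s.erase i) l (j+1)) :=
    Finset.sum_congr rfl fun i hi => by rw [es_erase s l i hi j]; ring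
  rw [h1, Finset.sum_sub_distrib, es_sum_erase]
  simp; ring

lemma gar_max {ι : Type*} [DecidableEq ι] (s : Finset ι) (l : ι → ℝ) (k : ℕ) (hk : 1 ≤ k)
    (hks : k ≤ s.card)
    (h : ∀ j, 1 ≤ j → j ≤ k → 0 < es s l j) (i : ι) (hi : i ∈ s) :
    (s.card : ℝ) * es (s.erase i) l (k-1) ≤ k * ∑ i ∈ s, es (s.erase i) l (k-1) := by
  rw [es_sum_erase]
  obtain ⟨m, rfl⟩ : ∃ m, k = m + 1 := ⟨k - 1, by omega⟩
  simp only [Nat.add_sub_cancel]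
  rcases m with _ | m
  · simp [es_zero]
  have hp := gar_pos s l _ h i hi
  have h1 := hp (m+1) (by omega)
  have h2 := hp m (by omega)
  have h3 := h (m+2) (by omega) (by omega)
  rw [es_erase s l i hi] at h3 ⊢
  have hc := Finset.card_erase_of_mem hi
  have hN := newton' (s.erase i) l (m+1) (by omega) (by omega)
  have hcr : ((s.erase i).card : ℝ) = s.card - 1 := by
    rw [hc, Nat.cast_sub (by omega)]; simp
  rw [hcr] at hN
  simp only [Nat.add_sub_cancel] at hN
  push_cast at *
  set N : ℝ := (s.card : ℝ) with hNdef
  set E0 := es (s.erase i) l m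
  set E1 := es (s.erase i) l (m+1)
  have e : es (s.erase i) l (m + 1 + 1) = es (s.erase i) l (m+2) := rfl
  rw [e] at hN h3
  set E2 := es (s.erase i) l (m+2)
  have hNm : (0:ℝ) ≤ N - (m+1) - 1 := by
    have : ((m+1+1:ℕ):ℝ) ≤ s.card := by exact_mod_cast hks
    push_cast at this; simp only [N]; linarith
  refine le_of_mul_le_mul_left ?_ h1
  have hmul : 0 < (N - (m+1)) * (m+1+1) := by
    have : (0:ℝ) < N - (m+1) := by linarith
    positivity
  have h5 : (N - (m+1)) * (m+1+1) * (E0 * (E2 + l i * E1)) ≥ 0 := by positivity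
  nlinarith

lemma gar_low {ι : Type*} (s : Finset ι) (l : ι → ℝ) (k : ℕ) (hk : 1 ≤ k)
    (h : ∀ j, 1 ≤ j → j ≤ k → 0 < es s l j) (h1 : es s l k = 1) : 1 ≤ es s l (k-1) := by
  have key : ∀ j, j + 1 ≤ k → es s l (j+1) ^ j ≤ es s l j ^ (j+1) := by
    intro j
    induction j with
    | zero => intro _; simp [es_zero]
    | succ j ih =>
      intro hj
      have hE1 := h (j+1) (by omega) (by omega)
      have hE2 := h (j+2) (by omega) (by omega)
      have hE0 : 0 < es s l j := by
        rcases Nat.eq_zero_or_pos j with h0 | h0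
        · rw [h0, es_zero]; norm_num
        · exact h j h0 (by omega)
      have hN := newton_weak s l j
      have h2 := ih (by omega)
      have h3 : (es s l j * es s l (j+2)) ^ (j+1) ≤ (es s l (j+1) ^ 2) ^ (j+1) := by gcongr
      rw [mul_pow, ← pow_mul] at h3
      have h4 : es s l (j+1) ^ j * es s l (j+2) ^ (j+1) ≤ es s l (j+1) ^ j * es s l (j+1) ^ (j+1+1) := by
        calc _ ≤ es s l j ^ (j+1) * es s l (j+2) ^ (j+1) := by gcongr
          _ ≤ _ := h3
          _ = _ := by rw [← pow_add]; congr 1; ring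
      exact le_of_mul_le_mul_left h4 (by positivity)
  obtain ⟨m, rfl⟩ : ∃ m, k = m + 1 := ⟨k - 1, by omega⟩
  have h2 := key m le_rfl
  rw [h1, one_pow] at h2
  simp only [Nat.add_sub_cancel]
  by_contra! hc
  have h0 : 0 ≤ es s l m := by
    rcases Nat.eq_zero_or_pos m with h0 | h0
    · rw [h0, es_zero]; norm_num
    · exact (h m h0 (by omega)).le
  have := pow_lt_one₀ h0 hc (show m + 1 ≠ 0 by omega)
  linarith

/-- monotonicity in `j` of `S_{j-1}(a)|_{a_i=0}/S_j(a)` -/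
lemma es_ratio {ι : Type*} [DecidableEq ι] (s : Finset ι) (l : ι → ℝ) (hl : ∀ i ∈ s, 0 < l i)
    (i : ι) (hi : i ∈ s) (j k : ℕ) (hjk : j ≤ k) (hk : k + 1 ≤ s.card) :
    es (s.erase i) l j * es s l (k+1) ≤ es (s.erase i) l k * es s l (j+1) := by
  induction k, hjk using Nat.le_induction with
  | base => rfl
  | succ m hm ih =>
    have h1 := ih (by omega)
    have hc := Finset.card_erase_of_mem hi
    have p : ∀ m, m + 1 ≤ s.card → 0 < es (s.erase i) l m := fun m hm =>
      es_pos _ _ (fun i hi => hl i (Finset.mem_of_mem_erase hi)) _ (by omega)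
    have q : ∀ m, m ≤ s.card → 0 < es s l m := fun m hm => es_pos _ _ hl _ hm
    have hN := newton_weak (s.erase i) l m
    have e1 := es_erase s l i hi m
    have e2 := es_erase s l i hi (m+1)
    have e : es (s.erase i) l (m + 1 + 1) = es (s.erase i) l (m+2) := rfl
    rw [e] at e2
    have h2 : es (s.erase i) l m * es s l (m+1+1) ≤ es (s.erase i) l (m+1) * es s l (m+1) := by
      rw [e1, e2]; nlinarith
    have p1 := p m (by omega)
    have p2 := p j (by omega)
    have p3 := p (m+1) (by omega)
    have q1 := q (m+1) (by omega)
    have q2 := q (m+1+1) (by omega)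
    refine le_of_mul_le_mul_left ?_ (mul_pos p1 q1)
    have := mul_le_mul h1 h2 (by positivity) (by have := q (j+1) (by omega); positivity)
    nlinarith

end Part1

section Part2

lemma det_add_vmv_field {m : Type*} [Fintype m] [DecidableEq m] {K : Type*} [Field K]
    (B : Matrix m m K) (hB : B.det ≠ 0) (v w : m → K) :
    (B + Matrix.vecMulVec v w).det = B.det + w ⬝ᵥ (B.adjugate.mulVec v) := by
  have h := Matrix.det_add_replicateCol_mul_replicateRow (ι := Unit) (A := B)
    (isUnit_iff_ne_zero.2 hB) v w
  rw [← Matrix.vecMulVec_eq] at h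
  rw [h, Matrix.det_unique (n := Unit), Matrix.add_apply, Matrix.one_apply_eq, mul_add, mul_one]
  congr 1
  rw [Matrix.inv_def, Ring.inverse_eq_inv']
  simp only [Matrix.mul_smul, Matrix.smul_mul, Matrix.smul_apply, smul_eq_mul]
  rw [← mul_assoc, mul_inv_cancel₀ hB, one_mul, Matrix.dotProduct_mulVec]
  simp [Matrix.mul_apply, dotProduct, Matrix.vecMul]

lemma det_add_vmv {m : Type*} [Fintype m] [DecidableEq m] {R : Type*} [CommRing R] [IsDomain R]
    (B : Matrix m m R) (hB : B.det ≠ 0) (v w : m → R) :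
    (B + Matrix.vecMulVec v w).det = B.det + w ⬝ᵥ (B.adjugate.mulVec v) := by
  set f := algebraMap R (FractionRing R) with hf
  have inj : Function.Injective f := IsFractionRing.injective R (FractionRing R)
  apply inj
  have h := det_add_vmv_field (f.mapMatrix B) (by
    rw [← RingHom.map_det]; exact fun h => hB (inj (by rw [h, map_zero]))) (f ∘ v) (f ∘ w)
  have e : f.mapMatrix (B + Matrix.vecMulVec v w) = f.mapMatrix B + Matrix.vecMulVec (f ∘ v) (f ∘ w) := by
    ext i j; simp [Matrix.vecMulVec]
  rw [RingHom.map_det, e, h, map_add, RingHom.map_det, ← RingHom.map_adjugate]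
  congr 1
  simp [dotProduct, Matrix.mulVec]

noncomputable def Fk (n k : ℕ) (M : Matrix (Fin n) (Fin n) ℝ) : Matrix (Fin n) (Fin n) ℝ :=
  Matrix.of fun i j => (-1 : ℝ) ^ (k-1) * ((Matrix.charmatrix M).adjugate i j).coeff (n - k)

open Polynomial in
lemma matSk_rank1 (n k : ℕ) (hk : 1 ≤ k) (M : Matrix (Fin n) (Fin n) ℝ) (v w : Fin n → ℝ) :
    matSk n k (M + Matrix.vecMulVec v w) = matSk n k M + w ⬝ᵥ (Fk n k M).mulVec v := by
  have e : Matrix.charmatrix (M + Matrix.vecMulVec v w) = Matrix.charmatrix M +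
      Matrix.vecMulVec (fun i => - (C (v i) : ℝ[X])) (fun i => C (w i)) := by
    ext1 i j
    by_cases h : i = j
    · subst h; simp [Matrix.charmatrix_apply_eq, Matrix.vecMulVec]; ring
    · simp [Matrix.charmatrix_apply_ne _ _ _ h, Matrix.vecMulVec]; ring
  unfold matSk Matrix.charpoly
  rw [e, det_add_vmv]
  · rw [coeff_add, mul_add]
    congr 1
    obtain ⟨m, rfl⟩ : ∃ m, k = m + 1 := ⟨k - 1, by omega⟩
    simp only [dotProduct, Matrix.mulVec, Fk, Matrix.of_apply, finsetSum_coeff, coeff_C_mul,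
      mul_neg, coeff_neg, coeff_mul_C, Finset.mul_sum, Nat.add_sub_cancel, pow_succ]
    refine Finset.sum_congr rfl fun i _ => Finset.sum_congr rfl fun j _ => ?_
    ring
  · exact (Matrix.charpoly_monic M).ne_zero

open Polynomial in
lemma matSk_diagonal (n k : ℕ) (hk : k ≤ n) (l : Fin n → ℝ) :
    matSk n k (Matrix.diagonal l) = es Finset.univ l k := by
  have h := es_coeff Finset.univ (fun i => - l i) (n - k) (by simp)
  have e : Matrix.charpoly (Matrix.diagonal l) = ∏ i, (X + C (- l i)) := by
    rw [Matrix.charpoly_diagonal]; simp [sub_eq_add_neg]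
  unfold matSk
  rw [e, h]
  simp only [Finset.card_univ, Fintype.card_fin, show n - (n - k) = k by omega, es, Finset.mul_sum]
  refine Finset.sum_congr rfl fun t ht => ?_
  rw [Finset.prod_neg, (Finset.mem_powersetCard.1 ht).2, ← mul_assoc, ← mul_pow]
  simp

open Polynomial in
lemma Fk_diagonal (n k : ℕ) (hk : 1 ≤ k) (hkn : k ≤ n) (l : Fin n → ℝ) :
    Fk n k (Matrix.diagonal l) = Matrix.diagonal (fun i => es (Finset.univ.erase i) l (k-1)) := by
  have e : Matrix.charmatrix (Matrix.diagonal l) = Matrix.diagonal (fun i => (X + C (- l i) : ℝ[X])) := by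
    ext1 i j
    by_cases h : i = j
    · subst h; simp [Matrix.charmatrix_apply_eq]; ring
    · simp [Matrix.charmatrix_apply_ne _ _ _ h, h]
  ext i j
  unfold Fk
  rw [e, Matrix.adjugate_diagonal, Matrix.of_apply]
  by_cases h : i = j
  · subst h
    rw [Matrix.diagonal_apply_eq, Matrix.diagonal_apply_eq, es_coeff _ _ _ (by
      rw [Finset.card_erase_of_mem (Finset.mem_univ i)]; simp; omega)]
    have hc : (Finset.univ.erase i).card - (n - k) = k - 1 := by
      rw [Finset.card_erase_of_mem (Finset.mem_univ i)]; simp; omega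
    rw [hc]
    simp only [es, Finset.mul_sum]
    refine Finset.sum_congr rfl fun t ht => ?_
    rw [Finset.prod_neg, (Finset.mem_powersetCard.1 ht).2, ← mul_assoc, ← mul_pow]
    simp
  · rw [Matrix.diagonal_apply_ne _ h, Matrix.diagonal_apply_ne _ h]; simp

lemma matSk_conj (n k : ℕ) (U M : Matrix (Fin n) (Fin n) ℝ) (hU : U.transpose * U = 1) :
    matSk n k (U * M * U.transpose) = matSk n k M := by
  unfold matSk
  rw [Matrix.charpoly_mul_comm, ← mul_assoc, hU, one_mul]

lemma vmv_conj (n : ℕ) (U : Matrix (Fin n) (Fin n) ℝ) (v w : Fin n → ℝ) :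
    U * Matrix.vecMulVec v w * U.transpose = Matrix.vecMulVec (U.mulVec v) (U.mulVec w) := by
  rw [Matrix.mul_vecMulVec, Matrix.vecMulVec_mul, Matrix.vecMul_transpose]

lemma Fk_conj (n k : ℕ) (hk : 1 ≤ k) (U M : Matrix (Fin n) (Fin n) ℝ) (hU : U.transpose * U = 1) :
    Fk n k (U * M * U.transpose) = U * Fk n k M * U.transpose := by
  have hU' : U * U.transpose = 1 := mul_eq_one_comm.1 hU
  have key : ∀ v w : Fin n → ℝ, (U.mulVec w) ⬝ᵥ (Fk n k (U * M * U.transpose)).mulVec (U.mulVec v)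
      = w ⬝ᵥ (Fk n k M).mulVec v := by
    intro v w
    have h1 := matSk_rank1 n k hk (U * M * U.transpose) (U.mulVec v) (U.mulVec w)
    have h2 := matSk_rank1 n k hk M v w
    rw [← vmv_conj, ← add_mul, ← mul_add, matSk_conj _ _ _ _ hU, matSk_conj _ _ _ _ hU, h2] at h1
    linarith
  have h3 : U.transpose * Fk n k (U * M * U.transpose) * U = Fk n k M := by
    ext i j
    have := key (Pi.single j 1) (Pi.single i 1)
    rw [← Matrix.vecMul_transpose, Matrix.mulVec_mulVec, ← Matrix.dotProduct_mulVec,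
      Matrix.mulVec_mulVec, ← mul_assoc] at this
    simpa using this
  rw [← h3]
  generalize Fk n k (U * M * U.transpose) = X
  calc X = (U * U.transpose) * X * (U * U.transpose) := by rw [hU']; simp
    _ = _ := by simp only [mul_assoc]

lemma spec (n : ℕ) (H : Matrix (Fin n) (Fin n) ℝ) (hH : H.IsSymm) :
    ∃ (U : Matrix (Fin n) (Fin n) ℝ) (l : Fin n → ℝ), U.transpose * U = 1 ∧ U * U.transpose = 1 ∧
      H = U * Matrix.diagonal l * U.transpose := by
  have hh : H.IsHermitian := by
    rw [Matrix.IsHermitian, Matrix.conjTranspose_eq_transpose_of_trivial]; exact hH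
  have h0 : (hh.eigenvectorUnitary : Matrix (Fin n) (Fin n) ℝ).transpose *
      (hh.eigenvectorUnitary : Matrix (Fin n) (Fin n) ℝ) = 1 := by
    have := Unitary.coe_star_mul_self hh.eigenvectorUnitary
    rwa [Matrix.star_eq_conjTranspose, Matrix.conjTranspose_eq_transpose_of_trivial] at this
  refine ⟨hh.eigenvectorUnitary, hh.eigenvalues, h0, mul_eq_one_comm.1 h0, ?_⟩
  · have := hh.spectral_theorem
    rw [Unitary.conjStarAlgAut_apply, Matrix.star_eq_conjTranspose,
      Matrix.conjTranspose_eq_transpose_of_trivial] at this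
    exact this

end Part2

section Part3

/-- The Garding cone condition. -/
def Gam (n k : ℕ) (H : Matrix (Fin n) (Fin n) ℝ) : Prop := ∀ j, 1 ≤ j → j ≤ k → 0 < matSk n j H

lemma Gam.mono {n k j : ℕ} {H : Matrix (Fin n) (Fin n) ℝ} (h : Gam n k H) (hj : j ≤ k) : Gam n j H :=
  fun i h1 h2 => h i h1 (h2.trans hj)

lemma Gam_es {n k : ℕ} (hkn : k ≤ n) {U : Matrix (Fin n) (Fin n) ℝ} {l : Fin n → ℝ}
    (hU : U.transpose * U = 1)
    (h : Gam n k (U * Matrix.diagonal l * U.transpose)) :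
    ∀ j, 1 ≤ j → j ≤ k → 0 < es Finset.univ l j := by
  intro j h1 h2
  have := h j h1 h2
  rwa [matSk_conj _ _ _ _ hU, matSk_diagonal _ _ (h2.trans hkn)] at this

lemma qf_conj (n : ℕ) (U : Matrix (Fin n) (Fin n) ℝ) (d v : Fin n → ℝ) :
    v ⬝ᵥ (U * Matrix.diagonal d * U.transpose).mulVec v = ∑ i, d i * (U.transpose.mulVec v) i ^ 2 := by
  rw [← Matrix.mulVec_mulVec, ← Matrix.mulVec_mulVec, Matrix.dotProduct_mulVec,
    ← Matrix.mulVec_transpose]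
  simp only [dotProduct, Matrix.mulVec_diagonal]
  exact Finset.sum_congr rfl fun i _ => by ring

lemma nrm_conj (n : ℕ) (U : Matrix (Fin n) (Fin n) ℝ) (hU : U * U.transpose = 1) (v : Fin n → ℝ) :
    ∑ i, (U.transpose.mulVec v) i ^ 2 = v ⬝ᵥ v := by
  have := qf_conj n U 1 v
  simp only [Pi.one_apply, one_mul] at this
  rw [← this, show Matrix.diagonal (1 : Fin n → ℝ) = 1 from Matrix.diagonal_one, mul_one, hU, Matrix.one_mulVec]

lemma Fk_form {n k : ℕ} (hk : 1 ≤ k) (hkn : k ≤ n) (H : Matrix (Fin n) (Fin n) ℝ) (hH : H.IsSymm) :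
    ∃ (U : Matrix (Fin n) (Fin n) ℝ) (l : Fin n → ℝ), U.transpose * U = 1 ∧ U * U.transpose = 1 ∧
      H = U * Matrix.diagonal l * U.transpose ∧
      Fk n k H = U * Matrix.diagonal (fun i => es (Finset.univ.erase i) l (k-1)) * U.transpose ∧
      (Gam n k H → ∀ j, 1 ≤ j → j ≤ k → 0 < es Finset.univ l j) ∧
      (∀ j, j ≤ n → matSk n j H = es Finset.univ l j) := by
  obtain ⟨U, l, h1, h2, rfl⟩ := spec n H hH
  refine ⟨U, l, h1, h2, rfl, ?_, Gam_es hkn h1, ?_⟩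
  · rw [Fk_conj _ _ hk _ _ h1, Fk_diagonal _ _ hk hkn]
  · intro j hj
    rw [matSk_conj _ _ _ _ h1, matSk_diagonal _ _ hj]

lemma Fk_symm {n k : ℕ} (hk : 1 ≤ k) (hkn : k ≤ n) (H : Matrix (Fin n) (Fin n) ℝ) (hH : H.IsSymm) :
    (Fk n k H).IsSymm := by
  obtain ⟨U, l, h1, h2, h3, h4, h5, h6⟩ := Fk_form hk hkn H hH
  rw [h4, Matrix.IsSymm]
  simp [Matrix.transpose_mul, mul_assoc]

lemma Fk_pos {n k : ℕ} (hk : 1 ≤ k) (hkn : k ≤ n) (H : Matrix (Fin n) (Fin n) ℝ) (hH : H.IsSymm)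
    (hG : Gam n k H) (v : Fin n → ℝ) (hv : v ≠ 0) : 0 < v ⬝ᵥ (Fk n k H).mulVec v := by
  obtain ⟨U, l, h1, h2, h3, h4, h5, h6⟩ := Fk_form hk hkn H hH
  have hp := fun i => gar_pos Finset.univ l k (h5 hG) i (Finset.mem_univ i) (k-1) (by omega)
  rw [h4, qf_conj]
  have hne : U.transpose.mulVec v ≠ 0 := by
    intro h
    apply hv
    have : U.mulVec (U.transpose.mulVec v) = 0 := by rw [h, Matrix.mulVec_zero]
    rwa [Matrix.mulVec_mulVec, h2, Matrix.one_mulVec] at this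
  obtain ⟨i, hi⟩ := Function.ne_iff.1 hne
  refine Finset.sum_pos' (fun j _ => mul_nonneg (hp j).le (sq_nonneg _)) ⟨i, Finset.mem_univ i, ?_⟩
  exact mul_pos (hp i) (by rw [Pi.zero_apply] at hi; positivity)

lemma Fk_nonneg {n k : ℕ} (hk : 1 ≤ k) (hkn : k ≤ n) (H : Matrix (Fin n) (Fin n) ℝ) (hH : H.IsSymm)
    (hG : Gam n k H) (v : Fin n → ℝ) : 0 ≤ v ⬝ᵥ (Fk n k H).mulVec v := by
  by_cases hv : v = 0
  · simp [hv]
  · exact (Fk_pos hk hkn H hH hG v hv).le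

lemma trace_conj (n : ℕ) (U M : Matrix (Fin n) (Fin n) ℝ) (hU : U.transpose * U = 1) :
    (U * M * U.transpose).trace = M.trace := by
  rw [Matrix.trace_mul_comm, ← mul_assoc, hU, one_mul]

lemma Fk_trace_mul {n k : ℕ} (hk : 1 ≤ k) (hkn : k ≤ n) (H : Matrix (Fin n) (Fin n) ℝ) (hH : H.IsSymm) :
    (Fk n k H * H).trace = k * matSk n k H := by
  obtain ⟨U, l, h1, h2, h3, h4, h5, h6⟩ := Fk_form hk hkn H hH
  rw [h4, h6 k hkn]
  conv_lhs => rw [h3]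
  have : ∀ D E : Matrix (Fin n) (Fin n) ℝ, (U * D * U.transpose) * (U * E * U.transpose) =
      U * (D * E) * U.transpose := fun D E => by
    calc _ = U * D * (U.transpose * U) * E * U.transpose := by simp only [mul_assoc]
      _ = _ := by rw [h1]; simp only [mul_assoc, mul_one, one_mul]
  rw [this, trace_conj _ _ _ h1, Matrix.diagonal_mul_diagonal, Matrix.trace_diagonal]
  obtain ⟨m, rfl⟩ : ∃ m, k = m + 1 := ⟨k - 1, by omega⟩
  have := es_sum_mul Finset.univ l m
  simp only [Nat.add_sub_cancel]
  push_cast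
  rw [← this]
  exact Finset.sum_congr rfl fun i _ => by ring

lemma Fk_comm {n k : ℕ} (hk : 1 ≤ k) (hkn : k ≤ n) (H : Matrix (Fin n) (Fin n) ℝ) (hH : H.IsSymm) :
    Fk n k H * H = H * Fk n k H := by
  obtain ⟨U, l, h1, h2, h3, h4, h5, h6⟩ := Fk_form hk hkn H hH
  rw [h4]
  conv_lhs => rw [h3]
  conv_rhs => rw [h3]
  have : ∀ D E : Matrix (Fin n) (Fin n) ℝ, (U * D * U.transpose) * (U * E * U.transpose) =
      U * (D * E) * U.transpose := fun D E => by
    calc _ = U * D * (U.transpose * U) * E * U.transpose := by simp only [mul_assoc]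
      _ = _ := by rw [h1]; simp only [mul_assoc, mul_one, one_mul]
  rw [this, this, Matrix.diagonal_mul_diagonal, Matrix.diagonal_mul_diagonal]
  simp only [mul_comm]

lemma Fk_trace_eq {n k : ℕ} (hk : 1 ≤ k) (hkn : k ≤ n) (H : Matrix (Fin n) (Fin n) ℝ) (hH : H.IsSymm) :
    (Fk n k H).trace = ((n:ℝ) - k + 1) * matSk n (k-1) H := by
  obtain ⟨U, l, h1, h2, h3, h4, h5, h6⟩ := Fk_form hk hkn H hH
  rw [h4, trace_conj _ _ _ h1, h6 _ (by omega), Matrix.trace_diagonal, es_sum_erase]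
  rw [Nat.cast_sub hk]; simp; left; ring

lemma Fk_trace_ge {n k : ℕ} (hk : 1 ≤ k) (hkn : k ≤ n) (H : Matrix (Fin n) (Fin n) ℝ) (hH : H.IsSymm)
    (hG : Gam n k H) (h1 : matSk n k H = 1) : 1 ≤ (Fk n k H).trace := by
  obtain ⟨U, l, h1', h2, h3, h4, h5, h6⟩ := Fk_form hk hkn H hH
  have h7 := gar_low Finset.univ l k hk (h5 hG) (by rw [← h6 k hkn, h1])
  rw [Fk_trace_eq hk hkn H hH, h6 _ (by omega)]
  have : (k:ℝ) ≤ n := by exact_mod_cast hkn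
  nlinarith

lemma Fk_upper {n k : ℕ} (hk : 1 ≤ k) (hkn : k ≤ n) (H : Matrix (Fin n) (Fin n) ℝ) (hH : H.IsSymm)
    (hG : Gam n k H) (v : Fin n → ℝ) :
    (n:ℝ) * (v ⬝ᵥ (Fk n k H).mulVec v) ≤ k * (v ⬝ᵥ v) * (Fk n k H).trace := by
  obtain ⟨U, l, h1, h2, h3, h4, h5, h6⟩ := Fk_form hk hkn H hH
  rw [h4, qf_conj, trace_conj _ _ _ h1, Matrix.trace_diagonal, ← nrm_conj n U h2 v]
  have key : ∀ i, (n:ℝ) * es (Finset.univ.erase i) l (k-1) ≤ k * ∑ i, es (Finset.univ.erase i) l (k-1) := by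
    intro i
    have := gar_max Finset.univ l k hk (by simpa using hkn) (h5 hG) i (Finset.mem_univ i)
    simpa only [Finset.card_univ, Fintype.card_fin] using this
  generalize ∑ i, es (Finset.univ.erase i) l (k-1) = T at key ⊢
  rw [Finset.mul_sum, Finset.mul_sum, Finset.sum_mul]
  refine Finset.sum_le_sum fun i _ => ?_
  nlinarith [sq_nonneg ((U.transpose.mulVec v) i), key i]

/-- sum of rank ones decomposition of a PSD matrix -/
lemma psd_decomp (n : ℕ) (P : Matrix (Fin n) (Fin n) ℝ) (hP : P.IsSymm)
    (h : ∀ v, 0 ≤ v ⬝ᵥ P.mulVec v) : ∃ w : Fin n → (Fin n → ℝ),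
      P = ∑ i, Matrix.vecMulVec (w i) (w i) := by
  obtain ⟨U, l, h1, h2, h3⟩ := spec n P hP
  have hl : ∀ i, 0 ≤ l i := by
    intro i
    have := h (U.mulVec (Pi.single i 1))
    rw [h3, qf_conj, Matrix.mulVec_mulVec, h1, Matrix.one_mulVec] at this
    simpa [Pi.single_apply] using this
  refine ⟨fun i => U.mulVec (Pi.single i (Real.sqrt (l i))), ?_⟩
  simp_rw [← vmv_conj, ← Finset.sum_mul, ← Finset.mul_sum]
  rw [h3]
  congr 2
  ext i j
  rw [Matrix.sum_apply]
  by_cases hij : i = j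
  · subst hij
    simp [Matrix.vecMulVec, Pi.single_apply, Real.mul_self_sqrt (hl i)]
  · simp [Matrix.vecMulVec, Pi.single_apply, hij]

lemma tr_vmv (n : ℕ) (F : Matrix (Fin n) (Fin n) ℝ) (v w : Fin n → ℝ) :
    (F * Matrix.vecMulVec v w).trace = w ⬝ᵥ F.mulVec v := by
  rw [Matrix.mul_vecMulVec, Matrix.trace_vecMulVec, dotProduct_comm]

lemma tr_psd_nonneg {n : ℕ} (F P : Matrix (Fin n) (Fin n) ℝ) (hF : ∀ v, 0 ≤ v ⬝ᵥ F.mulVec v)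
    (hP : P.IsSymm) (h : ∀ v, 0 ≤ v ⬝ᵥ P.mulVec v) : 0 ≤ (F * P).trace := by
  obtain ⟨w, rfl⟩ := psd_decomp n P hP h
  rw [Finset.mul_sum, Matrix.trace_sum]
  exact Finset.sum_nonneg fun i _ => by rw [tr_vmv]; exact hF _

lemma vmv_symm {n : ℕ} (v : Fin n → ℝ) : (Matrix.vecMulVec v v).IsSymm := by
  rw [Matrix.IsSymm, Matrix.transpose_vecMulVec]

lemma mono_rank1 {n k : ℕ} (hkn : k ≤ n) (V : Matrix (Fin n) (Fin n) ℝ) (hV : V.IsSymm)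
    (hG : Gam n k V) (v : Fin n → ℝ) :
    Gam n k (V + Matrix.vecMulVec v v) ∧ (∀ j, 1 ≤ j → j ≤ k → matSk n j V ≤ matSk n j (V + Matrix.vecMulVec v v)) := by
  have : ∀ j, 1 ≤ j → j ≤ k → matSk n j V ≤ matSk n j (V + Matrix.vecMulVec v v) := by
    intro j h1 h2
    rw [matSk_rank1 _ _ h1]
    linarith [Fk_nonneg h1 (h2.trans hkn) V hV (hG.mono h2) v]
  exact ⟨fun j h1 h2 => (hG j h1 h2).trans_le (this j h1 h2), this⟩

lemma mono_psd {n k : ℕ} (hkn : k ≤ n) (V P : Matrix (Fin n) (Fin n) ℝ) (hV : V.IsSymm)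
    (hG : Gam n k V) (hP : P.IsSymm) (h : ∀ v, 0 ≤ v ⬝ᵥ P.mulVec v) :
    Gam n k (V + P) ∧ (∀ j, 1 ≤ j → j ≤ k → matSk n j V ≤ matSk n j (V + P)) := by
  obtain ⟨w, rfl⟩ := psd_decomp n P hP h
  have : ∀ s : Finset (Fin n), (V + ∑ i ∈ s, Matrix.vecMulVec (w i) (w i)).IsSymm ∧
      Gam n k (V + ∑ i ∈ s, Matrix.vecMulVec (w i) (w i)) ∧
      (∀ j, 1 ≤ j → j ≤ k → matSk n j V ≤ matSk n j (V + ∑ i ∈ s, Matrix.vecMulVec (w i) (w i))) := by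
    intro s
    induction s using Finset.induction_on with
    | empty => simpa using ⟨hV, hG⟩
    | insert i s hi ih =>
      obtain ⟨a1, a2, a3⟩ := ih
      rw [Finset.sum_insert hi, add_comm (Matrix.vecMulVec _ _), ← add_assoc]
      obtain ⟨b1, b2⟩ := mono_rank1 hkn _ a1 a2 (w i)
      exact ⟨a1.add (vmv_symm _), b1, fun j h1 h2 => (a3 j h1 h2).trans (b2 j h1 h2)⟩
  exact (this Finset.univ).2

/-- strict comparison -/
lemma sk_cmp {n k : ℕ} (hn : 0 < n) (hk : 1 ≤ k) (hkn : k ≤ n) (V W : Matrix (Fin n) (Fin n) ℝ) (hV : V.IsSymm)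
    (hW : W.IsSymm) (hG : Gam n k V) (δ : ℝ) (hδ : 0 < δ)
    (h : ∀ v : Fin n → ℝ, v ⬝ᵥ V.mulVec v + δ * (v ⬝ᵥ v) ≤ v ⬝ᵥ W.mulVec v) :
    matSk n k V < matSk n k W := by
  set e : Fin n → ℝ := Pi.single ⟨0, hn⟩ (Real.sqrt δ) with he
  have he0 : e ≠ 0 := by
    rw [he, Ne, Pi.single_eq_zero_iff]; exact (Real.sqrt_pos.2 hδ).ne'
  have h1 : matSk n k V < matSk n k (V + Matrix.vecMulVec e e) := by
    rw [matSk_rank1 _ _ hk]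
    linarith [Fk_pos hk hkn V hV hG e he0]
  have h2 := mono_psd hkn (V + Matrix.vecMulVec e e) (W - (V + Matrix.vecMulVec e e))
    (hV.add (vmv_symm _)) (mono_rank1 hkn V hV hG e).1 (hW.sub (hV.add (vmv_symm _))) (by
      intro v
      have := h v
      rw [Matrix.sub_mulVec, Matrix.add_mulVec, dotProduct_sub, dotProduct_add]
      have h3 : v ⬝ᵥ (Matrix.vecMulVec e e).mulVec v = δ * v ⟨0, hn⟩ ^ 2 := by
        rw [Matrix.vecMulVec_mulVec]
        simp [he, dotProduct_smul]
        have := Real.mul_self_sqrt hδ.le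
        linear_combination v ⟨0, hn⟩ ^ 2 * this
      have h4 : v ⟨0, hn⟩ ^ 2 ≤ v ⬝ᵥ v := by
        rw [dotProduct, sq]
        exact Finset.single_le_sum (f := fun i => v i * v i) (fun i _ => mul_self_nonneg _) (Finset.mem_univ _)
      rw [h3]; nlinarith)
  have h3 := h2.2 k hk le_rfl
  rw [add_sub_cancel] at h3
  linarith

end Part3

section Part4

lemma mvp_contDiff {σ : Type*} [Fintype σ] (p : MvPolynomial σ ℝ) :
    ContDiff ℝ (⊤ : ℕ∞) (fun x : σ → ℝ => MvPolynomial.eval x p) := by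
  induction p using MvPolynomial.induction_on with
  | C a => simpa using contDiff_const
  | add p q hp hq => simpa using hp.add hq
  | mul_X p i hp => simpa using hp.mul (contDiff_apply ℝ ℝ i)

noncomputable def skPoly (n k : ℕ) : MvPolynomial (Fin n × Fin n) ℝ :=
  (-1 : MvPolynomial (Fin n × Fin n) ℝ) ^ k * (Matrix.charpoly.univ ℝ (Fin n)).coeff (n - k)

lemma skPoly_eval (n k : ℕ) (M : Matrix (Fin n) (Fin n) ℝ) :
    MvPolynomial.eval (fun p => M p.1 p.2) (skPoly n k) = matSk n k M := by
  have := Matrix.charpoly.univ_coeff_eval₂Hom (n := Fin n) (RingHom.id ℝ) (fun p => M p.1 p.2) (n - k)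
  unfold skPoly matSk
  rw [map_mul, map_pow, map_neg, map_one]
  congr 1

lemma matSk_hasDerivAt {n k : ℕ} (hk : 1 ≤ k) (H : ℝ → Matrix (Fin n) (Fin n) ℝ)
    (H' : Matrix (Fin n) (Fin n) ℝ) (t : ℝ) (h : ∀ i j, HasDerivAt (fun s => H s i j) (H' i j) t) :
    HasDerivAt (fun s => matSk n k (H s)) ((Fk n k (H t) * H').trace) t := by
  set g := fun x : Fin n × Fin n → ℝ => MvPolynomial.eval x (skPoly n k) with hg
  have hd : Differentiable ℝ g := (mvp_contDiff (skPoly n k)).differentiable (by simp)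
  set m0 : Fin n × Fin n → ℝ := fun p => H t p.1 p.2 with hm0
  have hs : ∀ p : Fin n × Fin n, fderiv ℝ g m0 (Pi.single p 1) = Fk n k (H t) p.2 p.1 := by
    intro p
    have h1 : HasDerivAt (fun s : ℝ => m0 + s • (Pi.single p 1 : Fin n × Fin n → ℝ)) (Pi.single p 1) 0 := by
      simpa using ((hasDerivAt_id (0:ℝ)).smul_const (Pi.single p (1:ℝ) : Fin n × Fin n → ℝ)).const_add m0
    have h2 : HasDerivAt (fun s : ℝ => g (m0 + s • (Pi.single p 1 : Fin n × Fin n → ℝ)))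
        (fderiv ℝ g m0 (Pi.single p 1)) 0 := by
      have := (hd (m0 + (0:ℝ) • (Pi.single p 1 : Fin n × Fin n → ℝ))).hasFDerivAt.comp_hasDerivAt (0:ℝ) h1
      rw [zero_smul, add_zero] at this
      exact this
    have h3 : (fun s : ℝ => g (m0 + s • (Pi.single p 1 : Fin n × Fin n → ℝ))) =
        fun s => matSk n k (H t) + s * Fk n k (H t) p.2 p.1 := by
      funext s
      have e : m0 + s • (Pi.single p 1 : Fin n × Fin n → ℝ) =
          fun q => (H t + Matrix.vecMulVec (Pi.single p.1 s) (Pi.single p.2 1)) q.1 q.2 := by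
        ext ⟨i, j⟩
        obtain ⟨p1, p2⟩ := p
        simp only [hm0, Pi.add_apply, Pi.smul_apply, Matrix.add_apply, Matrix.vecMulVec_apply,
          Pi.single_apply, Prod.mk.injEq, smul_eq_mul]
        split_ifs <;> simp_all
      rw [hg]
      simp only
      rw [e, skPoly_eval, matSk_rank1 _ _ hk]
      simp [mul_comm]
    rw [h3] at h2
    have h4 : HasDerivAt (fun s : ℝ => matSk n k (H t) + s * Fk n k (H t) p.2 p.1) (Fk n k (H t) p.2 p.1) 0 := by
      simpa using ((hasDerivAt_id (0:ℝ)).mul_const (Fk n k (H t) p.2 p.1)).const_add (matSk n k (H t))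
    exact h2.unique h4
  have h5 : HasDerivAt (fun s => (fun p : Fin n × Fin n => H s p.1 p.2)) (fun p => H' p.1 p.2) t :=
    hasDerivAt_pi.2 fun p => h p.1 p.2
  have h6 := (hd m0).hasFDerivAt.comp_hasDerivAt t h5
  have h7 : (g ∘ fun s => (fun p : Fin n × Fin n => H s p.1 p.2)) = fun s => matSk n k (H s) := by
    funext s; exact skPoly_eval n k (H s)
  rw [h7] at h6
  have h8 : (fun p : Fin n × Fin n => H' p.1 p.2) = ∑ p, H' p.1 p.2 • (Pi.single p 1 : Fin n × Fin n → ℝ) := by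
    ext q; simp [Finset.sum_apply, Pi.single_apply]
  have h9 : (Fk n k (H t) * H').trace = fderiv ℝ g m0 (fun p : Fin n × Fin n => H' p.1 p.2) := by
    rw [h8, map_sum]
    simp only [map_smul, hs, smul_eq_mul]
    rw [Fintype.sum_prod_type, Finset.sum_comm]
    simp only [Matrix.trace, Matrix.diag, Matrix.mul_apply]
    exact Finset.sum_congr rfl fun i _ => Finset.sum_congr rfl fun j _ => mul_comm _ _
  rw [h9]
  exact h6

lemma matSk_bdd (n k : ℕ) (m : ℝ) : ∃ C : ℝ, ∀ M : Matrix (Fin n) (Fin n) ℝ, (∀ i j, |M i j| ≤ m) →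
    |matSk n k M| ≤ C := by
  have hc := (mvp_contDiff (skPoly n k)).continuous
  obtain ⟨C, hC⟩ := (isCompact_closedBall (0 : Fin n × Fin n → ℝ) |m|).exists_bound_of_continuousOn
    hc.continuousOn
  refine ⟨C, fun M hM => ?_⟩
  have := hC (fun p => M p.1 p.2) (by
    rw [mem_closedBall_zero_iff, pi_norm_le_iff_of_nonneg (abs_nonneg _)]
    exact fun p => (hM _ _).trans (le_abs_self m))
  rwa [skPoly_eval] at this

lemma es_smul {ι : Type*} (s : Finset ι) (l : ι → ℝ) (c : ℝ) (k : ℕ) :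
    es s (fun i => c * l i) k = c ^ k * es s l k := by
  simp only [es, Finset.mul_sum]
  refine Finset.sum_congr rfl fun t ht => ?_
  rw [Finset.prod_mul_distrib, Finset.prod_const, (Finset.mem_powersetCard.1 ht).2]

lemma matSk_smul {n k : ℕ} (hkn : k ≤ n) (c : ℝ) (H : Matrix (Fin n) (Fin n) ℝ) (hH : H.IsSymm) :
    matSk n k (c • H) = c ^ k * matSk n k H := by
  obtain ⟨U, l, h1, h2, rfl⟩ := spec n H hH
  have : c • (U * Matrix.diagonal l * U.transpose) = U * Matrix.diagonal (fun i => c * l i) * U.transpose := by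
    have : Matrix.diagonal (fun i => c * l i) = c • Matrix.diagonal l := by
      rw [← Matrix.diagonal_smul]; rfl
    rw [this]; simp
  rw [this, matSk_conj _ _ _ _ h1, matSk_conj _ _ _ _ h1, matSk_diagonal _ _ hkn, matSk_diagonal _ _ hkn, es_smul]

lemma Fk_shift1 {n k : ℕ} (hk : 1 ≤ k) (M : Matrix (Fin n) (Fin n) ℝ) (v w : Fin n → ℝ) :
    v ⬝ᵥ (Fk n k (M + Matrix.vecMulVec v w)).mulVec v = v ⬝ᵥ (Fk n k M).mulVec v := by
  have h1 := matSk_rank1 n k hk (M + Matrix.vecMulVec v w) v v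
  have h2 := matSk_rank1 n k hk M v w
  have h3 := matSk_rank1 n k hk M v (w + v)
  rw [Matrix.vecMulVec_add, ← add_assoc, add_dotProduct] at h3
  linarith

lemma Fk_shift2 {n k : ℕ} (hk : 1 ≤ k) (M : Matrix (Fin n) (Fin n) ℝ) (v w : Fin n → ℝ) :
    v ⬝ᵥ (Fk n k (M + Matrix.vecMulVec w v)).mulVec v = v ⬝ᵥ (Fk n k M).mulVec v := by
  have h1 := matSk_rank1 n k hk (M + Matrix.vecMulVec w v) v v
  have h2 := matSk_rank1 n k hk M w v
  have h3 := matSk_rank1 n k hk M (w + v) v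
  rw [Matrix.add_vecMulVec, ← add_assoc, Matrix.mulVec_add, dotProduct_add] at h3
  linarith

lemma abs_le_of_nrm {n : ℕ} (v : Fin n → ℝ) (N : ℝ) (hN : 0 ≤ N) (h : v ⬝ᵥ v ≤ N ^ 2) (i : Fin n) : |v i| ≤ N := by
  apply abs_le_of_sq_le_sq _ hN
  refine le_trans ?_ h
  rw [dotProduct, sq]
  exact Finset.single_le_sum (f := fun i => v i * v i) (fun i _ => mul_self_nonneg _) (Finset.mem_univ _)

lemma double_normal {n k : ℕ} (hk : 1 ≤ k) (hkn : k ≤ n) (a : Fin n → ℝ) (ha : ∀ i, 0 < a i) (m σ₀ : ℝ) :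
    ∃ C : ℝ, 0 < C ∧ ∀ (ν : Fin n → ℝ) (H : Matrix (Fin n) (Fin n) ℝ), ν ⬝ᵥ ν = 1 → H.IsSymm →
      (∀ ξ η : Fin n → ℝ, ξ ⬝ᵥ ν = 0 → η ⬝ᵥ ν = 0 →
        ξ ⬝ᵥ H.mulVec η = ξ ⬝ᵥ (Matrix.diagonal a).mulVec η) →
      (∀ ξ : Fin n → ℝ, ξ ⬝ᵥ ν = 0 → ξ ⬝ᵥ ξ = 1 → |ξ ⬝ᵥ H.mulVec ν| ≤ m) →
      |matSk n k H| ≤ σ₀ → ∀ i j, |H i j| ≤ C := by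
  obtain ⟨c, hc0, hc⟩ : ∃ c : ℝ, 0 < c ∧ ∀ i : Fin n, c ≤ es (Finset.univ.erase i) a (k-1) := by
    have hp : ∀ i : Fin n, 0 < es (Finset.univ.erase i) a (k-1) := fun i =>
      es_pos _ _ (fun j _ => ha j) _ (by rw [Finset.card_erase_of_mem (Finset.mem_univ i)]; simp; omega)
    have : Nonempty (Fin n) := ⟨⟨0, by omega⟩⟩
    obtain ⟨i, hi⟩ := Finite.exists_min (fun i : Fin n => es (Finset.univ.erase i) a (k-1))
    exact ⟨_, hp i, hi⟩
  set Λ := ∑ i, a i with hΛ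
  have hΛi : ∀ i, a i ≤ Λ := fun i => Finset.single_le_sum (fun j _ => (ha j).le) (Finset.mem_univ i)
  have hΛ0 : 0 ≤ Λ := Finset.sum_nonneg fun j _ => (ha j).le
  set N := |m| + Λ with hN
  have hN0 : 0 ≤ N := by positivity
  obtain ⟨C1, hC1⟩ := matSk_bdd n k (Λ + 2 * N)
  refine ⟨Λ + 2 * N + |σ₀ + C1| / c + 1, by positivity, ?_⟩
  intro ν H hν hH ht hmix hS
  set D := H - Matrix.diagonal a with hD
  have hDs : D.IsSymm := hH.sub (Matrix.isSymm_diagonal a)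
  set p := D.mulVec ν with hp
  set t := ν ⬝ᵥ p with htd
  set q := p - t • ν with hq
  have hqν : q ⬝ᵥ ν = 0 := by
    rw [hq, sub_dotProduct, smul_dotProduct, hν, htd, dotProduct_comm]; simp
  have hν1 : ∀ i, |ν i| ≤ 1 := fun i => abs_le_of_nrm ν 1 zero_le_one (by rw [hν]; norm_num) i
  have hDij : D = Matrix.vecMulVec ν q + Matrix.vecMulVec q ν + Matrix.vecMulVec (t • ν) ν := by
    ext i j
    have hperp : ∀ i, (Pi.single i 1 - ν i • ν : Fin n → ℝ) ⬝ᵥ ν = 0 := by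
      intro i; rw [sub_dotProduct, smul_dotProduct, hν]; simp
    have h1 := ht _ _ (hperp i) (hperp j)
    have h2 : (Pi.single i 1 - ν i • ν : Fin n → ℝ) ⬝ᵥ D.mulVec (Pi.single j 1 - ν j • ν) = 0 := by
      rw [hD, Matrix.sub_mulVec, dotProduct_sub, h1, sub_self]
    have hsym : ν ⬝ᵥ D.mulVec (Pi.single j 1) = p j := by
      rw [Matrix.dotProduct_mulVec, ← Matrix.mulVec_transpose, hDs.eq]; simp [hp]
    rw [Matrix.mulVec_sub, Matrix.mulVec_smul, sub_dotProduct, dotProduct_sub, dotProduct_sub,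
      smul_dotProduct, smul_dotProduct, dotProduct_smul, dotProduct_smul, hsym, ← hp, ← htd] at h2
    simp only [single_dotProduct, one_mul, Matrix.mulVec_single_one, Matrix.col_apply, smul_eq_mul] at h2
    simp only [Matrix.add_apply, Matrix.vecMulVec_apply, hq, Pi.sub_apply, Pi.smul_apply, smul_eq_mul]
    linarith
  have hqN : q ⬝ᵥ q ≤ N ^ 2 := by
    by_contra hcon
    push Not at hcon
    set r := Real.sqrt (q ⬝ᵥ q) with hr
    have hqq : 0 < q ⬝ᵥ q := lt_of_le_of_lt (sq_nonneg N) hcon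
    have hr0 : 0 < r := Real.sqrt_pos.2 hqq
    have hr2 : r * r = q ⬝ᵥ q := Real.mul_self_sqrt hqq.le
    set ξ := r⁻¹ • q with hξ
    have hξν : ξ ⬝ᵥ ν = 0 := by rw [hξ, smul_dotProduct, hqν]; simp
    have hξξ : ξ ⬝ᵥ ξ = 1 := by
      rw [hξ, smul_dotProduct, dotProduct_smul, ← hr2]; simp; field_simp
    have h1 := hmix ξ hξν hξξ
    have h2 : ξ ⬝ᵥ D.mulVec ν = r := by
      rw [← hp, show p = q + t • ν by rw [hq]; abel, dotProduct_add, dotProduct_smul, hξν, hξ, smul_dotProduct,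
        ← hr2]; simp; field_simp
    have h3 : |ξ ⬝ᵥ (Matrix.diagonal a).mulVec ν| ≤ Λ := by
      simp only [dotProduct, Matrix.mulVec_diagonal]
      refine (Finset.abs_sum_le_sum_abs _ _).trans (Finset.sum_le_sum fun i _ => ?_)
      rw [abs_mul, abs_mul, abs_of_pos (ha i)]
      have := abs_le_of_nrm ξ 1 zero_le_one (by rw [hξξ]; norm_num) i
      have h4 := hν1 i
      calc |ξ i| * (a i * |ν i|) ≤ 1 * (a i * 1) := by
            have := (ha i).le
            gcongr
        _ = a i := by ring
    rw [hD, Matrix.sub_mulVec, dotProduct_sub] at h2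
    have h5 : r ≤ N := by
      have := abs_le.1 h1; have := abs_le.1 h3; have := le_abs_self m
      rw [hN]; linarith
    nlinarith
  have hqi := abs_le_of_nrm q N hN0 hqN
  set M₀ := Matrix.diagonal a + Matrix.vecMulVec ν q + Matrix.vecMulVec q ν with hM₀
  have hHM : H = M₀ + Matrix.vecMulVec (t • ν) ν := by
    have : H = Matrix.diagonal a + D := by rw [hD]; abel
    rw [this, hDij, hM₀]; abel
  have hdiag : ∀ i j, |Matrix.diagonal a i j| ≤ Λ := by
    intro i j
    rw [Matrix.diagonal_apply]
    split_ifs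
    · rw [abs_of_pos (ha i)]; exact hΛi i
    · simpa using hΛ0
  have hprod : ∀ x y : ℝ, |x| ≤ 1 → |y| ≤ N → |x * y| ≤ N := by
    intro x y h1 h2
    rw [abs_mul]
    calc _ ≤ 1 * N := by gcongr
      _ = N := one_mul _
  have hM₀b : ∀ i j, |M₀ i j| ≤ Λ + 2 * N := by
    intro i j
    have h1 := abs_le.1 (hdiag i j)
    have h2 := abs_le.1 (hprod _ _ (hν1 i) (hqi j))
    have h3 := abs_le.1 (hprod _ _ (hν1 j) (hqi i))
    rw [hM₀, Matrix.add_apply, Matrix.add_apply, Matrix.vecMulVec_apply, Matrix.vecMulVec_apply, abs_le]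
    constructor <;> nlinarith
  have hS0 := hC1 M₀ hM₀b
  have hform : matSk n k H = matSk n k M₀ + t * (ν ⬝ᵥ (Fk n k (Matrix.diagonal a)).mulVec ν) := by
    rw [hHM, matSk_rank1 _ _ hk, Matrix.mulVec_smul, dotProduct_smul, hM₀, Fk_shift2 hk, Fk_shift1 hk, smul_eq_mul]
  have hlow : c ≤ ν ⬝ᵥ (Fk n k (Matrix.diagonal a)).mulVec ν := by
    rw [Fk_diagonal _ _ hk hkn]
    simp only [dotProduct, Matrix.mulVec_diagonal]
    calc c = c * (ν ⬝ᵥ ν) := by rw [hν, mul_one]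
      _ = ∑ i, c * (ν i * ν i) := by rw [dotProduct, Finset.mul_sum]
      _ ≤ _ := Finset.sum_le_sum fun i _ => by nlinarith [hc i, mul_self_nonneg (ν i)]
  have htb : |t| ≤ |σ₀ + C1| / c := by
    rw [le_div_iff₀ hc0]
    have h1 : t * (ν ⬝ᵥ (Fk n k (Matrix.diagonal a)).mulVec ν) = matSk n k H - matSk n k M₀ := by rw [hform]; ring
    calc |t| * c ≤ |t| * (ν ⬝ᵥ (Fk n k (Matrix.diagonal a)).mulVec ν) := by gcongr
      _ = |t * (ν ⬝ᵥ (Fk n k (Matrix.diagonal a)).mulVec ν)| := by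
        rw [abs_mul, abs_of_nonneg (hc0.le.trans hlow)]
      _ ≤ |matSk n k H| + |matSk n k M₀| := by rw [h1]; exact abs_sub _ _
      _ ≤ σ₀ + C1 := by linarith
      _ ≤ _ := le_abs_self _
  intro i j
  have h1 := abs_le.1 (hM₀b i j)
  have h2 : |t * ν i * ν j| ≤ |t| := by
    rw [abs_mul, abs_mul]
    calc |t| * |ν i| * |ν j| ≤ |t| * 1 * 1 := by gcongr <;> exact hν1 _
      _ = |t| := by ring
  have h3 := abs_le.1 h2
  rw [hHM, Matrix.add_apply, Matrix.vecMulVec_apply, Pi.smul_apply, smul_eq_mul, abs_le]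
  constructor <;> linarith

end Part4

section Part5

lemma euc_sum {n : ℕ} (v : Euc n) : v = ∑ i, v i • ebasis n i := by
  ext j
  simp [ebasis, Pi.single_apply]

lemma hess_apply {n : ℕ} (u : Euc n → ℝ) (x : Euc n) (i j : Fin n) :
    hessMat n u x i j = fderiv ℝ (fderiv ℝ u) x (ebasis n i) (ebasis n j) := by
  simp [hessMat, iteratedFDeriv_two_apply]

lemma hess_qf {n : ℕ} (u : Euc n → ℝ) (x v w : Euc n) :
    (fun i => v i) ⬝ᵥ (hessMat n u x).mulVec (fun i => w i) = fderiv ℝ (fderiv ℝ u) x v w := by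
  conv_rhs => rw [euc_sum v, euc_sum w]
  simp only [map_sum, map_smul, FunLike.coe_sum, Finset.sum_apply, ContinuousLinearMap.coe_smul',
    Pi.smul_apply, smul_eq_mul, dotProduct, Matrix.mulVec, hess_apply, Finset.mul_sum]
  rw [Finset.sum_comm]
  exact Finset.sum_congr rfl fun i _ => Finset.sum_congr rfl fun j _ => by ring

lemma hess_symm {n : ℕ} (u : Euc n → ℝ) (x : Euc n) (hu : ContDiffAt ℝ 2 u x) :
    (hessMat n u x).IsSymm := by
  ext i j
  rw [Matrix.transpose_apply, hess_apply, hess_apply]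
  exact (hu.isSymmSndFDerivAt (by simp)).eq _ _

lemma hess_eq {n : ℕ} {f : Euc n → ℝ} {x : Euc n} (hf : ContDiffAt ℝ 2 f x) {i j : Fin n}
    {G : Euc n → ℝ} {G' : Euc n →L[ℝ] ℝ} (hG : ∀ᶠ y in 𝓝 x, fderiv ℝ f y (ebasis n j) = G y)
    (hG' : HasFDerivAt G G' x) : hessMat n f x i j = G' (ebasis n i) := by
  have hd : DifferentiableAt ℝ (fderiv ℝ f) x :=
    (hf.fderiv_right (m := 1) (by norm_num)).differentiableAt (by norm_num)
  have h1 := hd.hasFDerivAt.clm_apply (hasFDerivAt_const (ebasis n j) x)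
  have h2 : HasFDerivAt (fun y => fderiv ℝ f y (ebasis n j)) G' x := hG'.congr_of_eventuallyEq hG
  have h3 := h1.unique h2
  rw [hess_apply, ← h3]
  simp

lemma hess_add {n : ℕ} {f g : Euc n → ℝ} {x : Euc n} (hf : ContDiffAt ℝ 2 f x) (hg : ContDiffAt ℝ 2 g x) :
    hessMat n (fun y => f y + g y) x = hessMat n f x + hessMat n g x := by
  ext i j
  have := iteratedFDeriv_add_apply (i := 2) hf hg
  simp only [hessMat, Matrix.of_apply, Matrix.add_apply]
  rw [show (fun y => f y + g y) = f + g from rfl, this]; rfl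

lemma hess_smul {n : ℕ} {f : Euc n → ℝ} {x : Euc n} (c : ℝ) (hf : ContDiffAt ℝ 2 f x) :
    hessMat n (fun y => c * f y) x = c • hessMat n f x := by
  ext i j
  have := iteratedFDeriv_const_smul_apply (i := 2) (a := c) hf
  simp only [hessMat, Matrix.of_apply, Matrix.smul_apply]
  rw [show (fun y => c * f y) = c • f from rfl, this]; rfl

lemma hess_sub {n : ℕ} {f g : Euc n → ℝ} {x : Euc n} (hf : ContDiffAt ℝ 2 f x) (hg : ContDiffAt ℝ 2 g x) :
    hessMat n (fun y => f y - g y) x = hessMat n f x - hessMat n g x := by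
  have e : (fun y => f y - g y) = fun y => f y + (-1) * g y := by funext y; ring
  rw [e, hess_add hf (contDiffAt_const.mul hg), hess_smul _ hg]; simp [sub_eq_add_neg]

lemma hess_const {n : ℕ} (c : ℝ) (x : Euc n) : hessMat n (fun _ => c) x = 0 := by
  ext i j; rw [hess_apply]; simp

lemma hess_zero_of_linear {n : ℕ} (c : ℝ) (l : Euc n →L[ℝ] ℝ) (x : Euc n) :
    hessMat n (fun y => l y + c) x = 0 := by
  ext i j
  have : fderiv ℝ (fun y => l y + c) = fun _ => l := by
    funext y; rw [fderiv_add_const]; exact l.fderiv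
  rw [hess_apply, this]; simp

lemma L_killing {n k : ℕ} (hk : 1 ≤ k) (hkn : k ≤ n) (u : Euc n → ℝ) (x : Euc n)
    (hu : ContDiffAt ℝ (⊤ : ℕ∞) u x) (hS : ∀ᶠ y in 𝓝 x, SkHess n k u y = 1) (b : Euc n)
    (T : Euc n →L[ℝ] Euc n) (c : ℝ)
    (hT : ∀ i j, (T (ebasis n j)) i + (T (ebasis n i)) j = if i = j then 2 * c else 0) :
    (Fk n k (hessMat n u x) * hessMat n (fun y => fderiv ℝ u y (b + T y)) x).trace = 2 * c * k := by
  have hu3 : ContDiffAt ℝ 3 u x := hu.of_le (WithTop.coe_le_coe.2 le_top : ((3 : ℕ∞) : WithTop ℕ∞) ≤ _)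
  have hu2 : ContDiffAt ℝ 2 u x := hu.of_le (WithTop.coe_le_coe.2 le_top : ((2 : ℕ∞) : WithTop ℕ∞) ≤ _)
  have hg2 : ContDiffAt ℝ 2 (fderiv ℝ u) x := hu3.fderiv_right (by norm_num)
  have hh : ContDiffAt ℝ 1 (fderiv ℝ (fderiv ℝ u)) x := hg2.fderiv_right (by norm_num)
  have hev : ∀ᶠ y in 𝓝 x, ContDiffAt ℝ 3 u y := hu3.eventually (by simp)
  have hV : ∀ y, HasFDerivAt (fun y => b + T y) T y := fun y => T.hasFDerivAt.const_add b
  set f := fun y => fderiv ℝ u y (b + T y) with hf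
  have hfc : ContDiffAt ℝ 2 f x := hg2.clm_apply (contDiffAt_const.add T.contDiff.contDiffAt)
  set D3 := fderiv ℝ (fderiv ℝ (fderiv ℝ u)) x with hD3
  have hhd : HasFDerivAt (fderiv ℝ (fderiv ℝ u)) D3 x := (hh.differentiableAt (by norm_num)).hasFDerivAt
  have hgd : HasFDerivAt (fderiv ℝ u) (fderiv ℝ (fderiv ℝ u) x) x :=
    (hg2.differentiableAt (by norm_num)).hasFDerivAt
  -- the Hessian of `f`
  have hhess : ∀ i j, hessMat n f x i j = D3 (ebasis n i) (ebasis n j) (b + T x) +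
      fderiv ℝ (fderiv ℝ u) x (ebasis n j) (T (ebasis n i)) +
      fderiv ℝ (fderiv ℝ u) x (ebasis n i) (T (ebasis n j)) := by
    intro i j
    have h1 : ∀ᶠ y in 𝓝 x, fderiv ℝ f y (ebasis n j) =
        fderiv ℝ u y (T (ebasis n j)) + fderiv ℝ (fderiv ℝ u) y (ebasis n j) (b + T y) := by
      filter_upwards [hev] with y hy
      have hyd : HasFDerivAt (fderiv ℝ u) (fderiv ℝ (fderiv ℝ u) y) y :=
        ((hy.fderiv_right (m := 2) (by norm_num)).differentiableAt (by norm_num)).hasFDerivAt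
      rw [(hyd.clm_apply (hV y)).fderiv]
      simp
    have h2 := (hgd.clm_apply (hasFDerivAt_const (T (ebasis n j)) x)).add
      ((hhd.clm_apply (hasFDerivAt_const (ebasis n j) x)).clm_apply (hV x))
    rw [hess_eq hfc h1 h2]
    simp
    ring
  -- symmetry of third derivatives
  have s1 : ∀ v w z, D3 v w z = D3 w v z := by
    intro v w z
    rw [(hg2.isSymmSndFDerivAt (by simp)).eq v w]
  have s2 : ∀ v w z, D3 v w z = D3 v z w := by
    intro v w z
    have h1 := (hhd.clm_apply (hasFDerivAt_const w x)).clm_apply (hasFDerivAt_const z x)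
    have h2 := (hhd.clm_apply (hasFDerivAt_const z x)).clm_apply (hasFDerivAt_const w x)
    have h3 : (fun y => fderiv ℝ (fderiv ℝ u) y w z) =ᶠ[𝓝 x] (fun y => fderiv ℝ (fderiv ℝ u) y z w) := by
      filter_upwards [hev] with y hy
      exact ((hy.of_le (by norm_num : (2 : WithTop ℕ∞) ≤ 3)).isSymmSndFDerivAt (by simp)).eq w z
    have h4 := congrArg (fun l => l v) (h1.unique (h2.congr_of_eventuallyEq h3))
    simpa using h4
  -- derivative of S_k in direction b + T x
  set V := b + T x with hVd
  have hline : HasDerivAt (fun t : ℝ => x + t • V) V 0 := by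
    simpa using ((hasDerivAt_id (0:ℝ)).smul_const V).const_add x
  have hpath : ∀ i j, HasDerivAt (fun t : ℝ => hessMat n u (x + t • V) i j)
      ((Matrix.of fun i j => D3 V (ebasis n i) (ebasis n j)) i j) 0 := by
    intro i j
    have h1 := (hhd.clm_apply (hasFDerivAt_const (ebasis n i) x)).clm_apply (hasFDerivAt_const (ebasis n j) x)
    have h0 : x = x + (0:ℝ) • V := by simp
    rw [h0] at h1
    have h2 := h1.comp_hasDerivAt (0:ℝ) hline
    simp only [hess_apply, Matrix.of_apply]
    have e : D3 V (ebasis n i) (ebasis n j) = ((fderiv ℝ (fderiv ℝ u) x (ebasis n i)) ∘SL (0 : Euc n →L[ℝ] Euc n) +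
      ((fderiv ℝ (fderiv ℝ u) x) ∘SL (0 : Euc n →L[ℝ] Euc n) + D3.flip (ebasis n i)).flip (ebasis n j)) V := by simp
    rw [e]
    rw [← h0] at h2
    exact h2
  have hder := matSk_hasDerivAt hk (fun t : ℝ => hessMat n u (x + t • V)) _ 0 hpath
  have hconst : HasDerivAt (fun t : ℝ => matSk n k (hessMat n u (x + t • V))) 0 0 := by
    have : (fun t : ℝ => matSk n k (hessMat n u (x + t • V))) =ᶠ[𝓝 0] fun _ => (1:ℝ) := by
      have ht : Tendsto (fun t : ℝ => x + t • V) (𝓝 0) (𝓝 x) := by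
        have := hline.continuousAt.tendsto
        simpa using this
      exact ht.eventually hS
    exact (hasDerivAt_const (0:ℝ) (1:ℝ)).congr_of_eventuallyEq this
  have hzero := hder.unique hconst
  rw [zero_smul, add_zero] at hzero
  set H := hessMat n u x with hH
  have hHs : H.IsSymm := hess_symm u x hu2
  set N : Matrix (Fin n) (Fin n) ℝ := Matrix.of fun i j => (T (ebasis n j)) i with hN
  have hNN : N + N.transpose = (2 * c) • (1 : Matrix (Fin n) (Fin n) ℝ) := by
    ext i j
    simp only [hN, Matrix.add_apply, Matrix.of_apply, Matrix.transpose_apply, Matrix.smul_apply, smul_eq_mul,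
      Matrix.one_apply]
    rw [hT]; split_ifs <;> simp
  have hHN : ∀ i j, fderiv ℝ (fderiv ℝ u) x (ebasis n i) (T (ebasis n j)) = (H * N) i j := by
    intro i j
    conv_lhs => rw [euc_sum (T (ebasis n j))]
    simp only [map_sum, map_smul, smul_eq_mul, Matrix.mul_apply, hN, Matrix.of_apply, hH, hess_apply]
    exact Finset.sum_congr rfl fun _ _ => mul_comm _ _
  have hmat : hessMat n f x = (Matrix.of fun i j => D3 V (ebasis n i) (ebasis n j)) +
      (H * N).transpose + H * N := by
    ext i j
    rw [hhess, hHN, hHN, Matrix.add_apply, Matrix.add_apply, Matrix.transpose_apply, Matrix.of_apply]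
    rw [s2 _ _ V, s1 _ V]
  rw [hmat, mul_add, mul_add, Matrix.trace_add, Matrix.trace_add, hzero, Matrix.transpose_mul, hHs.eq, zero_add]
  have e1 : (Fk n k H * (N.transpose * H)).trace = (Fk n k H * H * N.transpose).trace := by
    rw [Matrix.trace_mul_comm, mul_assoc, ← Fk_comm hk hkn H hHs, Matrix.trace_mul_comm]
  rw [e1, ← mul_assoc, ← Matrix.trace_add, ← mul_add, add_comm, hNN]
  rw [Matrix.mul_smul, mul_one, Matrix.trace_smul, Fk_trace_mul hk hkn H hHs]
  have := hS.self_of_nhds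
  rw [SkHess] at this
  rw [← hH] at this
  rw [this]; simp

end Part5

section Part6

noncomputable def Qf {n : ℕ} (a : Fin n → ℝ) (c x : Euc n) : ℝ := (1/2) * ∑ i, a i * (x i - c i) ^ 2

lemma quadA_eq {n : ℕ} (a : Fin n → ℝ) (x : Euc n) : quadA n (Matrix.diagonal a) x = Qf a 0 x := by
  unfold quadA Qf
  congr 1
  refine Finset.sum_congr rfl fun i _ => ?_
  rw [Finset.sum_eq_single i]
  · simp; ring
  · intro j _ hj; simp [Matrix.diagonal_apply_ne _ hj.symm]
  · simp

noncomputable def Qd {n : ℕ} (a : Fin n → ℝ) (c x : Euc n) : Euc n →L[ℝ] ℝ :=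
  ∑ i, (a i * (x i - c i)) • (EuclideanSpace.proj i : Euc n →L[ℝ] ℝ)

lemma Qd_apply {n : ℕ} (a : Fin n → ℝ) (c x v : Euc n) : Qd a c x v = ∑ i, a i * (x i - c i) * v i := by
  simp [Qd, FunLike.coe_sum, Finset.sum_apply]

lemma Qd_basis {n : ℕ} (a : Fin n → ℝ) (c x : Euc n) (i : Fin n) :
    Qd a c x (ebasis n i) = a i * (x i - c i) := by
  rw [Qd_apply]; simp [ebasis, Pi.single_apply]

lemma coord_hasFDerivAt {n : ℕ} (i : Fin n) (c : ℝ) (x : Euc n) :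
    HasFDerivAt (fun y : Euc n => y i - c) (EuclideanSpace.proj i : Euc n →L[ℝ] ℝ) x :=
  ((EuclideanSpace.proj i : Euc n →L[ℝ] ℝ).hasFDerivAt (x := x)).sub_const c

lemma Qf_hasFDerivAt {n : ℕ} (a : Fin n → ℝ) (c x : Euc n) : HasFDerivAt (Qf a c) (Qd a c x) x := by
  have h1 : ∀ i ∈ (Finset.univ : Finset (Fin n)), HasFDerivAt (fun y : Euc n => a i * (y i - c i) ^ 2)
      ((2 * a i * (x i - c i)) • (EuclideanSpace.proj i : Euc n →L[ℝ] ℝ)) x := by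
    intro i _
    have := ((coord_hasFDerivAt i (c i) x).pow 2).const_mul (a i)
    refine this.congr_fderiv ?_
    ext v; simp; ring
  have h2 := (HasFDerivAt.fun_sum h1).const_mul (1/2 : ℝ)
  refine h2.congr_fderiv ?_
  ext v
  rw [Qd_apply]
  simp [FunLike.coe_sum, Finset.sum_apply, Finset.mul_sum]
  exact Finset.sum_congr rfl fun i _ => by ring

lemma Qf_contDiff {n : ℕ} (a : Fin n → ℝ) (c : Euc n) {m : WithTop ℕ∞} : ContDiff ℝ m (Qf a c) := by
  unfold Qf
  refine contDiff_const.mul (ContDiff.sum fun i _ => contDiff_const.mul (ContDiff.pow ?_ 2))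
  exact ((EuclideanSpace.proj i : Euc n →L[ℝ] ℝ).contDiff).sub contDiff_const

lemma comp_fderiv {n : ℕ} (a : Fin n → ℝ) (c x : Euc n) {φ : ℝ → ℝ} {d : ℝ} (h : HasDerivAt φ d (Qf a c x)) :
    HasFDerivAt (fun y => φ (Qf a c y)) (d • Qd a c x) x :=
  h.comp_hasFDerivAt x (Qf_hasFDerivAt a c x)

lemma hess_comp {n : ℕ} (a : Fin n → ℝ) (c x : Euc n) {φ φ' : ℝ → ℝ} {d : ℝ}
    (hC : ContDiffAt ℝ 2 φ (Qf a c x))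
    (h1 : ∀ᶠ t in 𝓝 (Qf a c x), HasDerivAt φ (φ' t) t) (h2 : HasDerivAt φ' d (Qf a c x)) :
    hessMat n (fun y => φ (Qf a c y)) x = φ' (Qf a c x) • Matrix.diagonal a +
      d • Matrix.vecMulVec (fun i => a i * (x i - c i)) (fun i => a i * (x i - c i)) := by
  ext i j
  have hf : ContDiffAt ℝ 2 (fun y => φ (Qf a c y)) x := hC.comp x (Qf_contDiff a c).contDiffAt
  have hev : ∀ᶠ y in 𝓝 x, fderiv ℝ (fun y => φ (Qf a c y)) y (ebasis n j) =
      φ' (Qf a c y) * (a j * (y j - c j)) := by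
    have ht : Tendsto (Qf a c) (𝓝 x) (𝓝 (Qf a c x)) := (Qf_contDiff a c (m := 0)).continuous.continuousAt
    filter_upwards [ht.eventually h1] with y hy
    rw [(comp_fderiv a c y hy).fderiv]
    simp [Qd_basis]
  have h3 := (comp_fderiv a c x h2).mul ((coord_hasFDerivAt j (c j) x).const_mul (a j))
  rw [hess_eq hf hev h3]
  simp only [FunLike.coe_add, Pi.add_apply, ContinuousLinearMap.coe_smul',
    Pi.smul_apply, Qd_basis, smul_eq_mul, Matrix.add_apply, Matrix.smul_apply, Matrix.vecMulVec_apply]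
  have : (EuclideanSpace.proj j : Euc n →L[ℝ] ℝ) (ebasis n i) = if i = j then 1 else 0 := by
    simp [ebasis, Pi.single_apply, eq_comm]
  rw [this, Matrix.diagonal_apply]
  split_ifs with hij
  · subst hij; ring
  · ring

lemma hess_Qf {n : ℕ} (a : Fin n → ℝ) (c x : Euc n) : hessMat n (Qf a c) x = Matrix.diagonal a := by
  have := hess_comp a c x (φ := fun t => t) (φ' := fun _ => 1) (d := 0) contDiffAt_id
    (Eventually.of_forall fun t => hasDerivAt_id t) (hasDerivAt_const _ _)
  simpa using this

lemma second_nec {n : ℕ} (g : Euc n → ℝ) (z : Euc n) (hg : ContDiffAt ℝ 2 g z) (hm : IsLocalMax g z) (v : Euc n) :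
    fderiv ℝ (fderiv ℝ g) z v v ≤ 0 := by
  by_contra hcon
  push Not at hcon
  have hline : ∀ t : ℝ, HasDerivAt (fun t : ℝ => z + t • v) v t := fun t => by
    simpa using ((hasDerivAt_id t).smul_const v).const_add z
  have h0 : z + (0:ℝ) • v = z := by simp
  have hcont : Tendsto (fun t : ℝ => z + t • v) (𝓝 0) (𝓝 z) := by
    have := (hline 0).continuousAt.tendsto
    rwa [h0] at this
  set φ := fun t : ℝ => g (z + t • v) with hφ
  have hd1 : ∀ᶠ t in 𝓝 (0:ℝ), deriv φ t = fderiv ℝ g (z + t • v) v := by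
    filter_upwards [hcont.eventually (hg.eventually (by simp))] with t ht
    exact ((ht.differentiableAt (by norm_num)).hasFDerivAt.comp_hasDerivAt t (hline t)).deriv
  have hgd : HasFDerivAt (fderiv ℝ g) (fderiv ℝ (fderiv ℝ g) z) z :=
    ((hg.fderiv_right (m := 1) (by norm_num)).differentiableAt (by norm_num)).hasFDerivAt
  have hd2 : deriv (deriv φ) 0 = fderiv ℝ (fderiv ℝ g) z v v := by
    rw [EventuallyEq.deriv_eq hd1]
    have h1 := hgd.clm_apply (hasFDerivAt_const v z)
    rw [← h0] at h1
    have h2 := (h1.comp_hasDerivAt (0:ℝ) (hline 0)).deriv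
    rw [h0] at h2
    refine Eq.trans h2 ?_
    simp
  have hmax : IsLocalMax φ 0 := by
    have := hcont.eventually hm
    simpa [IsLocalMax, IsMaxFilter, hφ] using this
  have hd0 : deriv φ 0 = 0 := hmax.deriv_eq_zero
  have hca : ContinuousAt φ 0 := by
    have : ContinuousAt g (z + (0:ℝ) • v) := by rw [h0]; exact hg.continuousAt
    exact ContinuousAt.comp (f := fun t : ℝ => z + t • v) this (hline 0).continuousAt
  have hmin := isLocalMin_of_deriv_deriv_pos (by rw [hd2]; exact hcon) hd0 hca
  have hc : φ =ᶠ[𝓝 0] fun _ => φ 0 := by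
    filter_upwards [hmin, hmax] with t h1 h2
    exact le_antisymm h2 h1
  have : deriv (deriv φ) 0 = 0 := by
    have h1 : deriv φ =ᶠ[𝓝 0] deriv (fun _ => φ 0) := hc.deriv
    rw [h1.deriv_eq]; simp
  rw [hd2] at this
  linarith

lemma touching {n : ℕ} (K D : Set (Euc n)) (hK : IsCompact K) (hD : IsOpen D) (hDK : D ⊆ K) (f : Euc n → ℝ)
    (hf : ContinuousOn f K) (hfD : ∀ x ∈ D, ContDiffAt ℝ 2 f x) (hb : ∀ x ∈ K, x ∉ D → f x ≤ 0)
    (h : ∀ x ∈ D, ∀ δ > 0, ¬ (∀ v : Fin n → ℝ, v ⬝ᵥ (hessMat n f x).mulVec v + δ * (v ⬝ᵥ v) ≤ 0)) :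
    ∀ x ∈ K, f x ≤ 0 := by
  by_contra hcon
  push Not at hcon
  obtain ⟨x₁, hx₁, hf₁⟩ := hcon
  set q := Qf (fun _ : Fin n => (1:ℝ)) 0 with hq
  have hqc : Continuous q := (Qf_contDiff _ _ (m := 0)).continuous
  have hq0 : ∀ x, 0 ≤ q x := fun x => by
    rw [hq, Qf]; exact mul_nonneg (by norm_num) (Finset.sum_nonneg fun i _ => by positivity)
  obtain ⟨M, hM⟩ := hK.exists_bound_of_continuousOn hqc.continuousOn
  set δ := f x₁ / (2 * (|M| + 1)) with hδ
  have hδ0 : 0 < δ := by positivity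
  set g := fun x => f x + δ * q x with hg
  obtain ⟨z, hz, hzmax⟩ := hK.exists_isMaxOn ⟨x₁, hx₁⟩ (hf.add (continuousOn_const.mul hqc.continuousOn) : ContinuousOn g K)
  have h1 : g x₁ ≤ g z := hzmax hx₁
  have h2 : δ * q z < f x₁ := by
    have h3 : q z ≤ |M| + 1 := by
      have := hM z hz; rw [Real.norm_eq_abs] at this
      linarith [le_abs_self (q z), le_abs_self M]
    calc δ * q z ≤ δ * (|M| + 1) := by gcongr
      _ = f x₁ / 2 := by rw [hδ]; field_simp
      _ < f x₁ := by linarith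
  have hfz : 0 < f z := by
    have := mul_nonneg hδ0.le (hq0 x₁)
    simp only [hg] at h1; linarith
  have hzD : z ∈ D := by
    by_contra hh
    linarith [hb z hz hh]
  have hlm : IsLocalMax g z := by
    filter_upwards [hD.mem_nhds hzD] with y hy
    exact hzmax (hDK hy)
  have hq2 : ContDiffAt ℝ 2 q z := (Qf_contDiff _ _).contDiffAt
  have hgc : ContDiffAt ℝ 2 g z := (hfD z hzD).add (contDiffAt_const.mul hq2)
  refine h z hzD δ hδ0 fun v => ?_
  have h4 := second_nec g z hgc hlm (WithLp.toLp 2 v)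
  rw [← hess_qf, hg, hess_add (hfD z hzD) (contDiffAt_const.mul hq2), hess_smul _ hq2, hq, hess_Qf,
    Matrix.add_mulVec, dotProduct_add, Matrix.smul_mulVec, dotProduct_smul] at h4
  simpa using h4

lemma mp_lin {n k : ℕ} (hk : 1 ≤ k) (hkn : k ≤ n) (K D : Set (Euc n)) (hK : IsCompact K) (hD : IsOpen D) (hDK : D ⊆ K)
    (u : Euc n → ℝ) (hu : ∀ x ∈ D, ContDiffAt ℝ 2 u x) (hG : ∀ x ∈ D, Gam n k (hessMat n u x))
    (hS : ∀ x ∈ D, SkHess n k u x = 1) (f : Euc n → ℝ)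
    (hf : ContinuousOn f K) (hfD : ∀ x ∈ D, ContDiffAt ℝ 2 f x) (hb : ∀ x ∈ K, x ∉ D → f x ≤ 0)
    (h : ∀ x ∈ D, 0 ≤ (Fk n k (hessMat n u x) * hessMat n f x).trace) :
    ∀ x ∈ K, f x ≤ 0 := by
  refine touching K D hK hD hDK f hf hfD hb fun x hx δ hδ hcon => ?_
  have hs := hess_symm u x (hu x hx)
  have hs' := hess_symm f x (hfD x hx)
  have h1 := Fk_trace_ge hk hkn _ hs (hG x hx) (hS x hx)
  have h2 := tr_psd_nonneg (Fk n k (hessMat n u x)) (-(hessMat n f x + δ • (1 : Matrix (Fin n) (Fin n) ℝ)))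
    (Fk_nonneg hk hkn _ hs (hG x hx)) ((hs'.add (Matrix.isSymm_one.smul δ)).neg) (by
      intro v
      have := hcon v
      rw [Matrix.neg_mulVec, dotProduct_neg, Matrix.add_mulVec, dotProduct_add, Matrix.smul_mulVec,
        Matrix.one_mulVec, dotProduct_smul, smul_eq_mul]
      linarith)
  rw [mul_neg, Matrix.trace_neg, mul_add, Matrix.trace_add, Matrix.mul_smul, Matrix.trace_smul, mul_one, smul_eq_mul] at h2
  nlinarith [h x hx]

lemma mp_cmp {n k : ℕ} (hk : 1 ≤ k) (hkn : k ≤ n) (K D : Set (Euc n)) (hK : IsCompact K) (hD : IsOpen D) (hDK : D ⊆ K)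
    (v w : Euc n → ℝ) (hv : ∀ x ∈ D, ContDiffAt ℝ 2 v x) (hw : ∀ x ∈ D, ContDiffAt ℝ 2 w x)
    (hvc : ContinuousOn v K) (hwc : ContinuousOn w K)
    (hG : ∀ x ∈ D, Gam n k (hessMat n v x))
    (hS : ∀ x ∈ D, SkHess n k w x ≤ SkHess n k v x) (hb : ∀ x ∈ K, x ∉ D → v x ≤ w x) :
    ∀ x ∈ K, v x ≤ w x := by
  have := touching K D hK hD hDK (fun x => v x - w x) (hvc.sub hwc) (fun x hx => (hv x hx).sub (hw x hx))
    (fun x hx hxD => by linarith [hb x hx hxD]) (fun x hx δ hδ hcon => by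
      have h1 := sk_cmp (by omega) hk hkn _ _ (hess_symm v x (hv x hx)) (hess_symm w x (hw x hx)) (hG x hx) δ hδ (by
        intro z
        have := hcon z
        rw [hess_sub (hv x hx) (hw x hx), Matrix.sub_mulVec, dotProduct_sub] at this
        linarith)
      have h2 := hS x hx
      unfold SkHess at h2
      linarith)
  intro x hx
  linarith [this x hx]

end Part6

section Part7

lemma dot_inner {n : ℕ} (v w : Euc n) : (fun i => v i) ⬝ᵥ (fun i => w i) = inner ℝ v w := by
  simp [dotProduct, PiLp.inner_apply, mul_comm]

lemma inner_sum_eq {n : ℕ} (v w : Euc n) : inner ℝ v w = ∑ i, v i * w i := by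
  simp [PiLp.inner_apply, mul_comm]

lemma nsq_eq {n : ℕ} (v : Euc n) : ‖v‖ ^ 2 = ∑ i, v i ^ 2 := by
  rw [EuclideanSpace.norm_sq_eq]; simp

lemma abs_coord_le {n : ℕ} (v : Euc n) (i : Fin n) : |v i| ≤ ‖v‖ := by
  simpa using PiLp.norm_apply_le v i

/-- multiplication by `diag a` -/
noncomputable def Am {n : ℕ} (a : Fin n → ℝ) : Euc n →L[ℝ] Euc n :=
  LinearMap.toContinuousLinearMap
    { toFun := fun x => WithLp.toLp 2 (fun i => a i * x i)
      map_add' := fun x y => by ext i; simp [mul_add]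
      map_smul' := fun c x => by ext i; simp; ring }

lemma Am_apply {n : ℕ} (a : Fin n → ℝ) (x : Euc n) (i : Fin n) : Am a x i = a i * x i := rfl

lemma Am_inner {n : ℕ} (a : Fin n → ℝ) (x y : Euc n) : inner ℝ (Am a x) y = ∑ i, a i * x i * y i := by
  simp [inner_sum_eq, Am_apply]

lemma Am_symm {n : ℕ} (a : Fin n → ℝ) (x y : Euc n) : inner ℝ (Am a x) y = inner ℝ x (Am a y) := by
  simp only [inner_sum_eq, Am_apply]
  exact Finset.sum_congr rfl fun i _ => by ring

lemma Qf_one {n : ℕ} (c x : Euc n) : Qf (fun _ => 1) c x = ‖x - c‖ ^ 2 / 2 := by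
  rw [Qf, nsq_eq]; simp; ring

lemma Qd_one {n : ℕ} (c x v : Euc n) : Qd (fun _ => 1) c x v = inner ℝ (x - c) v := by
  rw [Qd_apply, inner_sum_eq]; simp

lemma Qf_a {n : ℕ} (a : Fin n → ℝ) (x : Euc n) : Qf a 0 x = inner ℝ (Am a x) x / 2 := by
  rw [Qf, Am_inner]
  simp only [PiLp.zero_apply, sub_zero]
  rw [mul_comm, mul_one_div]
  congr 1
  exact Finset.sum_congr rfl fun i _ => by ring

lemma Qd_a {n : ℕ} (a : Fin n → ℝ) (x v : Euc n) : Qd a 0 x v = inner ℝ (Am a x) v := by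
  rw [Qd_apply, Am_inner]; simp

lemma Am_lower {n : ℕ} (a : Fin n → ℝ) (l : ℝ) (h : ∀ i, l ≤ a i) (x : Euc n) :
    l * ‖x‖ ^ 2 ≤ inner ℝ (Am a x) x := by
  rw [Am_inner, nsq_eq, Finset.mul_sum]
  exact Finset.sum_le_sum fun i _ => by nlinarith [h i, sq_nonneg (x i)]

lemma Am_upper {n : ℕ} (a : Fin n → ℝ) (l : ℝ) (h : ∀ i, a i ≤ l) (x : Euc n) :
    inner ℝ (Am a x) x ≤ l * ‖x‖ ^ 2 := by
  rw [Am_inner, nsq_eq, Finset.mul_sum]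
  exact Finset.sum_le_sum fun i _ => by nlinarith [h i, sq_nonneg (x i)]

lemma Am_norm {n : ℕ} (a : Fin n → ℝ) (l : ℝ) (h0 : ∀ i, 0 ≤ a i) (h : ∀ i, a i ≤ l) (hl : 0 ≤ l) (x : Euc n) :
    ‖Am a x‖ ≤ l * ‖x‖ := by
  refine abs_le_of_sq_le_sq' ?_ (by positivity) |>.2
  rw [mul_pow, nsq_eq, nsq_eq, Finset.mul_sum]
  refine Finset.sum_le_sum fun i _ => ?_
  rw [Am_apply, mul_pow]
  have := pow_le_pow_left₀ (h0 i) (h i) 2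
  gcongr

lemma Am_cs {n : ℕ} (a : Fin n → ℝ) (h0 : ∀ i, 0 ≤ a i) (x y : Euc n) :
    2 * inner ℝ (Am a x) y ≤ inner ℝ (Am a x) x + inner ℝ (Am a y) y := by
  rw [Am_inner, Am_inner, Am_inner, ← Finset.sum_add_distrib, Finset.mul_sum]
  exact Finset.sum_le_sum fun i _ => by nlinarith [mul_nonneg (h0 i) (sq_nonneg (x i - y i))]

lemma sq1 {n : ℕ} {f g : Euc n → ℝ} {f' g' : Euc n →L[ℝ] ℝ} {x : Euc n} (hf : HasFDerivAt f f' x)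
    (hg : HasFDerivAt g g' x) (he : f x = g x) (v : Euc n)
    (h : ∀ᶠ t in 𝓝[>] (0:ℝ), f (x + t • v) ≤ g (x + t • v)) : f' v ≤ g' v := by
  have hd := hg.sub hf
  have hline : HasDerivAt (fun t : ℝ => x + t • v) v 0 := by
    simpa using ((hasDerivAt_id (0:ℝ)).smul_const v).const_add x
  have h0 : x + (0:ℝ) • v = x := by simp
  rw [← h0] at hd
  have hc := (hd.comp_hasDerivAt (0:ℝ) hline)
  have ht := hc.hasDerivWithinAt (s := Set.Ioi 0)
  rw [hasDerivWithinAt_iff_tendsto_slope' (by simp)] at ht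
  have hnn : (0:ℝ) ≤ (g' - f') v := by
    refine ge_of_tendsto ht ?_
    filter_upwards [h, self_mem_nhdsWithin] with t h1 h2
    have h2' : (0:ℝ) < t := h2
    simp only [slope, Function.comp, Pi.sub_apply, vsub_eq_sub, smul_eq_mul, zero_smul, add_zero, sub_zero, he, sub_self]
    exact mul_nonneg (inv_nonneg.2 h2'.le) (by linarith)
  simpa using hnn

lemma lin_mult {E : Type*} [AddCommGroup E] [Module ℝ E] (l ν : E → ℝ)
    (hl : ∀ x y c, l (x + c • y) = l x + c * l y) (hν : ∀ x y c, ν (x + c • y) = ν x + c * ν y) (v0 : E) (hv0 : 0 < ν v0) (b1 b2 : ℝ)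
    (h : ∀ v, 0 < ν v → b1 * ν v ≤ l v ∧ l v ≤ b2 * ν v) :
    ∃ b, b1 ≤ b ∧ b ≤ b2 ∧ ∀ v, l v = b * ν v := by
  have hz : ∀ z, ν z = 0 → l z = 0 := by
    intro z hz
    by_contra hne
    have h1 := h (v0 + ((b2 * ν v0 - l v0 + 1) / l z) • z) (by rw [hν, hz]; linarith)
    rw [hl, hν, hz, div_mul_cancel₀ _ hne] at h1
    linarith [h1.2]
  have h1 := h v0 hv0
  refine ⟨l v0 / ν v0, by rw [le_div_iff₀ hv0]; exact h1.1, by rw [div_le_iff₀ hv0]; exact h1.2, fun v => ?_⟩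
  have h2 := hz (v + (-(ν v / ν v0)) • v0) (by rw [hν]; field_simp; ring)
  rw [hl] at h2
  field_simp at h2 ⊢
  linarith

lemma vec_hasFDerivAt {n : ℕ} (u : Euc n → ℝ) (x : Euc n) (hu : ContDiffAt ℝ 2 u x) (b : Euc n) (T : Euc n →L[ℝ] Euc n) :
    ∃ L : Euc n →L[ℝ] ℝ, HasFDerivAt (fun y => fderiv ℝ u y (b + T y)) L x ∧
      ∀ v, L v = fderiv ℝ (fderiv ℝ u) x v (b + T x) + fderiv ℝ u x (T v) := by
  have hgd : HasFDerivAt (fderiv ℝ u) (fderiv ℝ (fderiv ℝ u) x) x :=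
    ((hu.fderiv_right (m := 1) (by norm_num)).differentiableAt (by norm_num)).hasFDerivAt
  have hT : HasFDerivAt (fun y => b + T y) T x := T.hasFDerivAt.const_add b
  refine ⟨_, hgd.clm_apply hT, fun v => ?_⟩
  simp [add_comm]

lemma vec_contDiffAt {n : ℕ} (u : Euc n → ℝ) (x : Euc n) (hu : ContDiffAt ℝ (⊤ : ℕ∞) u x) (b : Euc n) (T : Euc n →L[ℝ] Euc n) :
    ContDiffAt ℝ 2 (fun y => fderiv ℝ u y (b + T y)) x := by
  have hu3 : ContDiffAt ℝ 3 u x := hu.of_le (WithTop.coe_le_coe.2 le_top : ((3 : ℕ∞) : WithTop ℕ∞) ≤ _)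
  have hg2 : ContDiffAt ℝ 2 (fderiv ℝ u) x := hu3.fderiv_right (by norm_num)
  exact hg2.clm_apply (contDiffAt_const.add T.contDiff.contDiffAt)

lemma norm_iter_le {n : ℕ} (u : Euc n → ℝ) (x : Euc n) (C : ℝ) (hC : 0 ≤ C) (h : ∀ i j, |hessMat n u x i j| ≤ C) :
    ‖iteratedFDeriv ℝ 2 u x‖ ≤ n ^ 2 * C := by
  refine ContinuousMultilinearMap.opNorm_le_bound (by positivity) fun m => ?_
  rw [iteratedFDeriv_two_apply, ← hess_qf, Fin.prod_univ_two, Real.norm_eq_abs, dotProduct]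
  calc |∑ i, m 0 i * (hessMat n u x).mulVec (fun i => m 1 i) i|
      ≤ ∑ i, |m 0 i * (hessMat n u x).mulVec (fun i => m 1 i) i| := Finset.abs_sum_le_sum_abs _ _
    _ ≤ ∑ i : Fin n, ‖m 0‖ * (n * (C * ‖m 1‖)) := by
        refine Finset.sum_le_sum fun i _ => ?_
        rw [abs_mul]
        refine mul_le_mul (abs_coord_le _ _) ?_ (abs_nonneg _) (norm_nonneg _)
        rw [Matrix.mulVec, dotProduct]
        refine (Finset.abs_sum_le_sum_abs _ _).trans ?_
        calc ∑ j, |hessMat n u x i j * m 1 j| ≤ ∑ j : Fin n, C * ‖m 1‖ := by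
              refine Finset.sum_le_sum fun j _ => ?_
              rw [abs_mul]
              exact mul_le_mul (h i j) (abs_coord_le _ _) (abs_nonneg _) hC
          _ = _ := by simp
    _ = _ := by simp; ring

lemma sk_cont {n : ℕ} (k : ℕ) (u : Euc n → ℝ) (x : Euc n) (hu : ContDiffAt ℝ 2 u x) :
    ContinuousAt (SkHess n k u) x := by
  have h1 : ContinuousAt (fderiv ℝ (fderiv ℝ u)) x := by
    have := (hu.fderiv_right (m := 1) (by norm_num)).fderiv_right (m := 0) (by norm_num)
    exact this.continuousAt
  have h2 : ContinuousAt (fun y => fun p : Fin n × Fin n => hessMat n u y p.1 p.2) x := by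
    refine continuousAt_pi.2 fun p => ?_
    simp only [hess_apply]
    exact (h1.clm_apply continuousAt_const).clm_apply continuousAt_const
  have h3 := ((mvp_contDiff (skPoly n k)).continuous.continuousAt (x := fun p : Fin n × Fin n => hessMat n u x p.1 p.2)).comp_of_eq h2 rfl
  refine h3.congr (Eventually.of_forall fun y => ?_)
  simp only [Function.comp, SkHess]
  exact skPoly_eval n k _

/-- rotation field -/
noncomputable def Mop {n : ℕ} (v w : Euc n) : Euc n →L[ℝ] Euc n :=
  (innerSL ℝ w).smulRight v - (innerSL ℝ v).smulRight w

lemma Mop_apply {n : ℕ} (v w z : Euc n) : Mop v w z = inner ℝ w z • v - inner ℝ v z • w := by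
  simp [Mop]

lemma Mop_norm {n : ℕ} (v w z : Euc n) : ‖Mop v w z‖ ≤ 2 * ‖v‖ * ‖w‖ * ‖z‖ := by
  rw [Mop_apply]
  refine (norm_sub_le _ _).trans ?_
  rw [norm_smul, norm_smul]
  have h1 := norm_inner_le_norm (𝕜 := ℝ) w z
  have h2 := norm_inner_le_norm (𝕜 := ℝ) v z
  nlinarith [norm_nonneg v, norm_nonneg w, mul_le_mul_of_nonneg_right h1 (norm_nonneg v), mul_le_mul_of_nonneg_right h2 (norm_nonneg w)]

lemma inner_ebasis {n : ℕ} (w : Euc n) (i : Fin n) : inner ℝ w (ebasis n i) = w i := by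
  simp [inner_sum_eq, ebasis, Pi.single_apply]

lemma Mop_anti {n : ℕ} (v w : Euc n) (i j : Fin n) :
    (Mop v w (ebasis n j)) i + (Mop v w (ebasis n i)) j = if i = j then 2 * (0:ℝ) else 0 := by
  rw [Mop_apply, Mop_apply]
  simp [inner_ebasis]; ring

lemma id_conf {n : ℕ} (i j : Fin n) :
    ((ContinuousLinearMap.id ℝ (Euc n)) (ebasis n j)) i + ((ContinuousLinearMap.id ℝ (Euc n)) (ebasis n i)) j = if i = j then 2 * (1:ℝ) else 0 := by
  by_cases h : i = j
  · subst h; simp [ebasis]; norm_num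
  · simp [ebasis, h, Ne.symm h]

end Part7

section Part8

structure Prof (m ε e c1 C2 ρm : ℝ) (φ φ' : ℝ → ℝ) : Prop where
  cd : ∀ t, 0 < t → ContDiffAt ℝ 2 φ t
  d1 : ∀ t, 0 < t → HasDerivAt φ (φ' t) t
  d2 : ∀ t, 0 < t → HasDerivAt φ' (-(m / t) * φ' t) t
  pos : ∀ t, 0 < t → 0 < φ' t
  z : φ (ε ^ 2 / 2) = 0
  half : c1 ≤ φ (1 / 2)
  up : ∀ t, ε ^ 2 / 2 ≤ t → t ≤ ρm → φ t ≤ C2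
  nn : ∀ t, ε ^ 2 / 2 ≤ t → 0 ≤ φ t
  dz : φ' (ε ^ 2 / 2) = e / ε
  two : c1 * (e * ε) ≤ φ (2 * ε ^ 2)
  e1 : c1 ≤ e
  e2 : e * ε ≤ C2

lemma mk_prof (m ε e κ c C ρm : ℝ) (φ : ℝ → ℝ) (hm : 0 < m) (hε : 0 < ε) (hε2 : ε < 1/2) (hκ : 0 < κ)
    (hc : 0 < c) (hρ : 1/2 ≤ ρm)
    (cd : ∀ t, 0 < t → ContDiffAt ℝ 2 φ t)
    (d1 : ∀ t, 0 < t → HasDerivAt φ (κ * (2 * t) ^ (-m)) t)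
    (z : φ (ε ^ 2 / 2) = 0) (half : c ≤ φ (1/2)) (up : ∀ t, ε ^ 2 / 2 ≤ t → t ≤ ρm → φ t ≤ C)
    (dz : κ * (ε ^ 2) ^ (-m) = e / ε) (e1 : c ≤ e) :
    Prof m ε e (min c (4 ^ (-m))) (max C (C / min c (4 ^ (-m)))) ρm φ (fun t => κ * (2 * t) ^ (-m)) := by
  have hc1 : 0 < min c (4 ^ (-m)) := lt_min hc (by positivity)
  have he : 0 < e := lt_of_lt_of_le hc e1
  have pos : ∀ t, 0 < t → 0 < κ * (2 * t) ^ (-m) := fun t ht => by positivity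
  have hmono : MonotoneOn φ (Set.Ioi 0) := by
    refine monotoneOn_of_deriv_nonneg (convex_Ioi 0) (fun t ht => (d1 t ht).continuousAt.continuousWithinAt)
      (fun t ht => (d1 t (interior_subset ht)).differentiableAt.differentiableWithinAt) fun t ht => ?_
    have ht' : 0 < t := interior_subset ht
    rw [(d1 t ht').deriv]; exact (pos t ht').le
  have hε0 : 0 < ε ^ 2 / 2 := by positivity
  have two : min c (4 ^ (-m)) * (e * ε) ≤ φ (2 * ε ^ 2) := by
    have hd : 0 < 2 * ε ^ 2 := by positivity
    have h1 := Convex.mul_sub_le_image_sub_of_le_deriv (D := Set.Icc (ε^2/2) (2 * ε^2)) (convex_Icc _ _) (f := φ)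
      (fun t ht => (d1 t (hε0.trans_le ht.1)).continuousAt.continuousWithinAt)
      (fun t ht => (d1 t (hε0.trans_le (interior_subset ht).1)).differentiableAt.differentiableWithinAt)
      (C := κ * (2 * (2 * ε ^ 2)) ^ (-m)) (fun t ht => by
        have ht' := interior_subset ht
        have ht0 := hε0.trans_le ht'.1
        rw [(d1 t ht0).deriv]
        refine mul_le_mul_of_nonneg_left ?_ hκ.le
        exact Real.rpow_le_rpow_of_nonpos (by positivity) (by linarith [ht'.2]) (by linarith))
      (ε^2/2) ⟨le_rfl, by nlinarith [hε0]⟩ (2*ε^2) ⟨by nlinarith [hε0], le_rfl⟩ (by nlinarith [hε0])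
    rw [z, sub_zero] at h1
    refine le_trans ?_ h1
    rw [show (2 * (2 * ε ^ 2)) = 4 * ε ^ 2 by ring, Real.mul_rpow (by norm_num) (by positivity)]
    rw [show κ * (4 ^ (-m) * (ε ^ 2) ^ (-m)) * (2 * ε ^ 2 - ε ^ 2 / 2) = 4 ^ (-m) * (κ * (ε ^ 2) ^ (-m)) * (3/2 * ε ^ 2) by ring, dz]
    rw [show (4:ℝ) ^ (-m) * (e / ε) * (3/2 * ε ^ 2) = 4 ^ (-m) * (3/2 * (e * ε)) by field_simp]
    have := min_le_right c ((4:ℝ) ^ (-m))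
    have h4 : (0:ℝ) < 4 ^ (-m) := by positivity
    have h5 : 0 < e * ε := by positivity
    nlinarith [mul_pos h4 h5, mul_le_mul_of_nonneg_right this h5.le]
  refine ⟨cd, d1, ?_, pos, z, (min_le_left _ _).trans half, fun t h1 h2 => (up t h1 h2).trans (le_max_left _ _), ?_, ?_, two,
    (min_le_left _ _).trans e1, ?_⟩
  · intro t ht
    have h1 : HasDerivAt (fun t : ℝ => 2 * t) 2 t := by simpa using (hasDerivAt_id t).const_mul (2:ℝ)
    have h2 := (h1.rpow_const (p := -m) (Or.inl (by positivity))).const_mul κ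
    refine h2.congr_deriv ?_
    rw [Real.rpow_sub_one (by positivity)]
    field_simp
  · intro t ht
    rw [← z]
    exact hmono hε0 (hε0.trans_le ht) ht
  · show κ * (2 * (ε ^ 2 / 2)) ^ (-m) = e / ε
    rw [← dz]; congr 2; ring
  · refine le_trans ?_ (le_max_right _ _)
    rw [le_div_iff₀ hc1]
    have := up (2 * ε ^ 2) (by nlinarith [hε0]) (by nlinarith)
    nlinarith

lemma prof_exists (n k : ℕ) (hn : 3 ≤ n) (hk : 1 ≤ k) (hkn : k ≤ n) (ρm : ℝ) (hρ : 1/2 ≤ ρm) :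
    ∃ c1 > 0, ∃ C2 > 0, ∀ ε : ℝ, 0 < ε → ε < 1/2 →
      ∃ φ φ' : ℝ → ℝ, Prof ((n:ℝ) / (2 * k)) ε (Ceps n k 1 ε) c1 C2 ρm φ φ' := by
  have hk0 : (0:ℝ) < k := by exact_mod_cast hk
  have hkn' : (k:ℝ) ≤ n := by exact_mod_cast hkn
  set m : ℝ := (n:ℝ) / (2 * k) with hm
  have hm0 : 0 < m := by
    have : (0:ℝ) < n := by linarith
    positivity
  have hnk : (n:ℝ) / k = 2 * m := by rw [hm]; field_simp
  have hm2 : 1/2 ≤ m := by rw [hm, div_le_div_iff₀ (by norm_num) (by positivity)]; linarith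
  have hsuff : ∀ c > 0, ∀ C : ℝ, ∀ P : ℝ → Prop, (∀ ε, 0 < ε → ε < 1/2 → ∃ κ > 0, ∃ φ : ℝ → ℝ,
      (∀ t, 0 < t → ContDiffAt ℝ 2 φ t) ∧
      (∀ t, 0 < t → HasDerivAt φ (κ * (2 * t) ^ (-m)) t) ∧
      (φ (ε ^ 2 / 2) = 0) ∧ (c ≤ φ (1/2)) ∧ (∀ t, ε ^ 2 / 2 ≤ t → t ≤ ρm → φ t ≤ C) ∧
      (κ * (ε ^ 2) ^ (-m) = (Ceps n k 1 ε) / ε) ∧ (c ≤ Ceps n k 1 ε)) →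
      ∃ c1 > 0, ∃ C2 > 0, ∀ ε : ℝ, 0 < ε → ε < 1/2 →
      ∃ φ φ' : ℝ → ℝ, Prof m ε (Ceps n k 1 ε) c1 C2 ρm φ φ' := by
    intro c hc C _ h
    have hc1 : 0 < min c (4 ^ (-m)) := lt_min hc (by positivity)
    refine ⟨_, hc1, max C (C / min c (4 ^ (-m))), ?_, fun ε h1 h2 => ?_⟩
    · obtain ⟨κ, hκ, φ, a1, a2, a3, a4, a5, a6, a7⟩ := h (1/4) (by norm_num) (by norm_num)
      have := a5 (1/2) (by norm_num) hρ
      exact lt_max_of_lt_left (by linarith)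
    · obtain ⟨κ, hκ, φ, a1, a2, a3, a4, a5, a6, a7⟩ := h ε h1 h2
      exact ⟨φ, _, mk_prof m ε _ κ c C ρm φ hm0 h1 h2 hκ hc hρ a1 a2 a3 a4 a5 a6 a7⟩
  have h2t : ∀ t : ℝ, HasDerivAt (fun t : ℝ => 2 * t) 2 t := fun t => by
    simpa using (hasDerivAt_id t).const_mul (2:ℝ)
  have hsq : ∀ ε : ℝ, 0 < ε → ∀ p : ℝ, (ε ^ 2) ^ p = ε ^ (2 * p) := fun ε h p => by
    rw [← Real.rpow_natCast, ← Real.rpow_mul h.le]; norm_num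
  have hr2 : ∀ (p t : ℝ), 0 < t → HasDerivAt (fun t : ℝ => (2 * t) ^ p) (2 * p * (2 * t) ^ (p - 1)) t := fun p t ht =>
    (h2t t).rpow_const (p := p) (Or.inl (by positivity))
  have hc2 : ∀ (p t : ℝ), 0 < t → ContDiffAt ℝ 2 (fun t : ℝ => (2 * t) ^ p) t := fun p t ht =>
    (contDiffAt_const.mul contDiffAt_id).rpow_const_of_ne (by simp; positivity)
  rcases lt_trichotomy (2 * k) n with h | h | h
  · have hm1 : 1 < m := by
      rw [hm, lt_div_iff₀ (by positivity)]
      have : (2:ℝ) * k < n := by exact_mod_cast h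
      linarith
    have hp : (1/2:ℝ) ^ (2*m-2) < 1 := Real.rpow_lt_one (by norm_num) (by norm_num) (by linarith)
    refine hsuff (min (1 - (1/2:ℝ) ^ (2*m-2)) (2 * m - 2)) (lt_min (by linarith) (by linarith)) 1 (fun _ => True) fun ε h1 h2 => ?_
    have hCe : Ceps n k 1 ε = (2 * m - 2) * ε⁻¹ := by rw [Ceps, if_pos h, hnk]; ring
    refine ⟨(2*m-2) * ε ^ (2*m-2), mul_pos (by linarith) (by positivity), fun t => 1 - ε ^ (2*m-2) * (2*t) ^ (1-m), ?_, ?_, ?_, ?_, ?_, ?_, ?_⟩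
    · exact fun t ht => contDiffAt_const.sub (contDiffAt_const.mul (hc2 _ t ht))
    · intro t ht
      refine (((hr2 (1-m) t ht).const_mul (ε ^ (2*m-2))).const_sub 1).congr_deriv ?_
      rw [show (1 - m - 1) = -m by ring]; ring
    · show 1 - ε ^ (2*m-2) * (2*(ε^2/2)) ^ (1-m) = 0
      rw [show 2*(ε^2/2) = ε^2 by ring, hsq ε h1, ← Real.rpow_add h1]
      ring_nf; simp
    · refine (min_le_left _ _).trans ?_
      show _ ≤ 1 - ε ^ (2*m-2) * (2*(1/2)) ^ (1-m)
      norm_num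
      have := Real.rpow_le_rpow h1.le h2.le (show 0 ≤ 2*m-2 by linarith)
      norm_num at this
      linarith
    · intro t ht _
      have : 0 < t := lt_of_lt_of_le (by positivity) ht
      have : 0 ≤ ε ^ (2*m-2) * (2*t) ^ (1-m) := by positivity
      show 1 - ε ^ (2*m-2) * (2*t) ^ (1-m) ≤ 1
      linarith
    · rw [hsq ε h1, hCe, mul_assoc, ← Real.rpow_add h1, show 2*m-2+2*(-m) = -2 by ring, Real.rpow_neg h1.le]
      norm_num; field_simp
    · refine (min_le_right _ _).trans ?_
      rw [hCe]
      have : 1 ≤ ε⁻¹ := (one_le_inv₀ h1).2 (by linarith)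
      nlinarith
  · have hm1 : m = 1 := by
      rw [hm, ← h]; push_cast; field_simp
    refine hsuff 1 one_pos ((log (2 * ρm) / 2 + log 2) / log 2 + 1) (fun _ => True) fun ε h1 h2 => ?_
    have hl : log ε < 0 := Real.log_neg h1 (by linarith)
    have hl2 : log 2 ≤ - log ε := by
      rw [← Real.log_inv]
      refine Real.log_le_log (by norm_num) ?_
      rw [le_inv_comm₀ (by norm_num) h1]; linarith
    have hlog2 : 0 < log 2 := Real.log_pos (by norm_num)
    have hCe : Ceps n k 1 ε = ε⁻¹ * (- log ε)⁻¹ := by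
      rw [Ceps, if_neg (by omega), if_pos h, abs_of_neg hl]; ring
    refine ⟨(-log ε)⁻¹, inv_pos.2 (by linarith), fun t => (log (2 * t) * (1/2) - log ε) * (-log ε)⁻¹, ?_, ?_, ?_, ?_, ?_, ?_, ?_⟩
    · intro t ht
      exact ((((contDiffAt_const.mul contDiffAt_id).log (by simp; positivity)).mul contDiffAt_const).sub contDiffAt_const).mul contDiffAt_const
    · intro t ht
      refine (((((h2t t).log (by positivity)).mul_const (1/2)).sub_const (log ε)).mul_const ((-log ε)⁻¹)).congr_deriv ?_
      rw [hm1, Real.rpow_neg_one]; ring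
    · show (log (2 * (ε^2/2)) * (1/2) - log ε) * (-log ε)⁻¹ = 0
      rw [show 2*(ε^2/2) = ε^2 by ring, Real.log_pow]; push_cast; ring
    · show 1 ≤ (log (2 * (1/2)) * (1/2) - log ε) * (-log ε)⁻¹
      norm_num
      rw [mul_inv_cancel₀ hl.ne]
    · intro t ht ht'
      have ht0 : 0 < t := lt_of_lt_of_le (by positivity) ht
      show (log (2 * t) * (1/2) - log ε) * (-log ε)⁻¹ ≤ _
      have h3 : log (2 * t) ≤ log (2 * ρm) := Real.log_le_log (by positivity) (by linarith)
      have h4 : 0 ≤ log (2 * ρm) := Real.log_nonneg (by linarith)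
      have h5 : (log (2 * t) * (1/2) - log ε) * (-log ε)⁻¹ = (log (2 * t) * (1/2)) * (-log ε)⁻¹ + 1 := by
        have : log ε ≠ 0 := hl.ne
        field_simp; ring
      rw [h5]
      gcongr
      calc log (2 * t) * (1/2) * (-log ε)⁻¹ ≤ (log (2 * ρm) / 2 + log 2) * (-log ε)⁻¹ := by
            have : 0 < (-log ε)⁻¹ := inv_pos.2 (by linarith)
            refine mul_le_mul_of_nonneg_right (by linarith) this.le
        _ ≤ (log (2 * ρm) / 2 + log 2) * (log 2)⁻¹ := by
            refine mul_le_mul_of_nonneg_left ?_ (by linarith)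
            exact inv_anti₀ hlog2 hl2
        _ = (log (2 * ρm) / 2 + log 2) / log 2 := (div_eq_mul_inv _ _).symm
    · rw [hCe, hm1, Real.rpow_neg_one]; field_simp
    · rw [hCe, ← mul_inv]
      refine (one_le_inv₀ (mul_pos h1 (by linarith))).2 ?_
      have := Real.one_sub_inv_le_log_of_pos h1
      have h3 : ε * (1 - ε⁻¹) ≤ ε * log ε := by gcongr
      rw [mul_sub, mul_inv_cancel₀ h1.ne'] at h3
      linarith
  · have hm1 : m < 1 := by
      rw [hm, div_lt_iff₀ (by positivity)]
      have : (n:ℝ) < 2 * k := by exact_mod_cast h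
      linarith
    have hp : (1/2:ℝ) ^ (2-2*m) < 1 := Real.rpow_lt_one (by norm_num) (by norm_num) (by linarith)
    refine hsuff (min (1 - (1/2:ℝ) ^ (2-2*m)) (2 - 2 * m)) (lt_min (by linarith) (by linarith)) ((2*ρm) ^ (1-m)) (fun _ => True) fun ε h1 h2 => ?_
    have hCe : Ceps n k 1 ε = (2 - 2 * m) * ε ^ (1 - 2 * m) := by
      rw [Ceps, if_neg (by omega), if_neg (by omega), hnk]; ring
    refine ⟨2 - 2 * m, by linarith, fun t => (2*t) ^ (1-m) - ε ^ (2 - 2 * m), ?_, ?_, ?_, ?_, ?_, ?_, ?_⟩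
    · exact fun t ht => (hc2 _ t ht).sub contDiffAt_const
    · intro t ht
      refine ((hr2 (1-m) t ht).sub_const _).congr_deriv ?_
      rw [show (1 - m - 1) = -m by ring]; ring
    · show (2*(ε^2/2)) ^ (1-m) - ε ^ (2 - 2 * m) = 0
      rw [show 2*(ε^2/2) = ε^2 by ring, hsq ε h1]
      ring_nf
    · refine (min_le_left _ _).trans ?_
      show _ ≤ (2*(1/2)) ^ (1-m) - ε ^ (2 - 2 * m)
      norm_num
      have := Real.rpow_le_rpow h1.le h2.le (show 0 ≤ 2-2*m by linarith)
      norm_num at this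
      linarith
    · intro t ht ht'
      have ht0 : 0 < t := lt_of_lt_of_le (by positivity) ht
      show (2*t) ^ (1-m) - ε ^ (2 - 2 * m) ≤ _
      have h3 := Real.rpow_le_rpow (show 0 ≤ 2 * t by linarith) (show 2 * t ≤ 2 * ρm by linarith) (show 0 ≤ 1 - m by linarith)
      have : 0 < ε ^ (2 - 2 * m) := by positivity
      linarith
    · rw [hsq ε h1, hCe, mul_div_assoc, ← Real.rpow_sub_one h1.ne']
      ring_nf
    · refine (min_le_right _ _).trans ?_
      rw [hCe]
      have : 1 ≤ ε ^ (1 - 2 * m) := Real.one_le_rpow_of_pos_of_le_one_of_nonpos h1 (by linarith) (by linarith)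
      nlinarith

end Part8

section Part9

lemma esymm_update {n : ℕ} (a : Fin n → ℝ) (i : Fin n) (j : ℕ) :
    esymmVec n j (Function.update a i 0) = es (Finset.univ.erase i) a j := by
  have hc : ∀ j, es (Finset.univ.erase i) (Function.update a i 0) j = es (Finset.univ.erase i) a j := by
    intro j
    unfold es
    refine Finset.sum_congr rfl fun t ht => Finset.prod_congr rfl fun l hl => ?_
    rw [Finset.mem_powersetCard] at ht
    exact Function.update_of_ne (Finset.ne_of_mem_erase (ht.1 hl)) _ _
  have : esymmVec n j (Function.update a i 0) = es Finset.univ (Function.update a i 0) j := rfl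
  rw [this]
  cases j with
  | zero => simp [es_zero]
  | succ j => rw [es_erase _ _ i (Finset.mem_univ i), hc]; simp

lemma hk_facts {n k : ℕ} (hn : 3 ≤ n) (hk : 1 ≤ k) (hkn : k ≤ n) (a : Fin n → ℝ) (ha : ∀ i, 0 < a i)
    (h1 : es Finset.univ a k = 1) (hk1' : k = 1 → (⨆ i, a i) < 1 / 2) :
    (∀ i, es (Finset.univ.erase i) a (k-1) * a i ≤ hkfun n k a) ∧ 0 < hkfun n k a ∧ 2 * hkfun n k a < k := by
  have : Nonempty (Fin n) := ⟨⟨0, by omega⟩⟩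
  have e : hkfun n k a = ⨆ i : Fin n, es (Finset.univ.erase i) a (k-1) * a i := by
    unfold hkfun; congr 1; funext i; rw [esymm_update]
  have hle : ∀ i, es (Finset.univ.erase i) a (k-1) * a i ≤ hkfun n k a := fun i => by
    rw [e]; exact le_ciSup (f := fun i => es (Finset.univ.erase i) a (k-1) * a i) (Set.finite_range _).bddAbove i
  have hcard : ∀ i : Fin n, (Finset.univ.erase i).card = n - 1 := fun i => by
    rw [Finset.card_erase_of_mem (Finset.mem_univ i)]; simp
  have hpos : ∀ i, 0 < es (Finset.univ.erase i) a (k-1) * a i := fun i =>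
    mul_pos (es_pos _ _ (fun j _ => ha j) _ (by rw [hcard]; omega)) (ha i)
  refine ⟨hle, (hpos this.some).trans_le (hle _), ?_⟩
  obtain ⟨i, hi⟩ := exists_eq_ciSup_of_finite (f := fun i => es (Finset.univ.erase i) a (k-1) * a i)
  rw [e, ← hi]
  obtain ⟨j, rfl⟩ : ∃ j, k = j + 1 := ⟨k - 1, by omega⟩
  have h2 := es_erase Finset.univ a i (Finset.mem_univ i) j
  simp only [Nat.add_sub_cancel] at *
  rcases j.eq_zero_or_pos with rfl | hj
  · simp only [es_zero, one_mul] at *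
    have h3 := hk1' (by norm_num)
    have h4 : a i ≤ ⨆ i, a i := le_ciSup (Set.finite_range _).bddAbove i
    push_cast; linarith
  · have h3 : 0 ≤ es (Finset.univ.erase i) a (j+1) ∧ (j + 1 < n → 0 < es (Finset.univ.erase i) a (j+1)) := by
      constructor
      · unfold es; exact Finset.sum_nonneg fun t _ => Finset.prod_nonneg fun l _ => (ha l).le
      · intro h; exact es_pos _ _ (fun j _ => ha j) _ (by rw [hcard]; omega)
    rw [h1] at h2
    have h5 : es (Finset.univ.erase i) a j * a i = 1 - es (Finset.univ.erase i) a (j+1) := by linarith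
    rw [h5]
    by_cases hj1 : j = 1
    · subst hj1
      have := h3.2 (by omega)
      push_cast; linarith
    · have : (2:ℝ) ≤ j := by exact_mod_cast (by omega : 2 ≤ j)
      push_cast; linarith [h3.1]

lemma sub_gam {n k : ℕ} (hk : 1 ≤ k) (hkn : k ≤ n) (a : Fin n → ℝ) (ha : ∀ i, 0 < a i)
    (h1 : es Finset.univ a k = 1) (h : ℝ) (hh : ∀ i, es (Finset.univ.erase i) a (k-1) * a i ≤ h)
    (g d : ℝ) (hg : 0 < g) (hd : d ≤ 0) (x : Euc n) (hp : 0 < g + d * (2 * h * Qf a 0 x)) :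
    let N := g • Matrix.diagonal a + d • Matrix.vecMulVec (fun i => a i * (x i - (0 : Euc n) i)) (fun i => a i * (x i - (0 : Euc n) i))
    Gam n k N ∧ g ^ (k-1) * (g + d * (2 * h * Qf a 0 x)) ≤ matSk n k N := by
  intro N
  set z : Fin n → ℝ := fun i => a i * (x i - (0 : Euc n) i) with hz
  have hN : N = Matrix.diagonal (fun i => g * a i) + Matrix.vecMulVec (d • z) z := by
    ext i j
    simp [N, hz, Matrix.vecMulVec_apply, Matrix.diagonal_apply, mul_assoc]
  have hS : ∀ j, 1 ≤ j → j ≤ k → matSk n j N = g ^ (j-1) * (g * es Finset.univ a j + d * ∑ i, es (Finset.univ.erase i) a (j-1) * z i ^ 2) := by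
    intro j hj hjk
    rw [hN, matSk_rank1 n j hj, matSk_diagonal n j (by omega), Fk_diagonal n j hj (by omega), es_smul]
    have : g ^ j = g ^ (j-1) * g := by rw [← pow_succ]; congr 1; omega
    rw [this, mul_add, mul_assoc]
    congr 1
    rw [dotProduct, Finset.mul_sum, Finset.mul_sum]
    refine Finset.sum_congr rfl fun i _ => ?_
    rw [Matrix.mulVec_diagonal, es_smul]
    simp; ring
  have hsum : ∑ i, es (Finset.univ.erase i) a (k-1) * z i ^ 2 ≤ 2 * h * Qf a 0 x := by
    rw [Qf, show 2 * h * (1/2 * ∑ i, a i * (x i - (0 : Euc n) i) ^ 2) = h * ∑ i, a i * (x i - (0 : Euc n) i) ^ 2 by ring, Finset.mul_sum]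
    refine Finset.sum_le_sum fun i _ => ?_
    have : 0 ≤ a i * (x i - (0 : Euc n) i) ^ 2 := mul_nonneg (ha i).le (sq_nonneg _)
    calc es (Finset.univ.erase i) a (k-1) * z i ^ 2 = (es (Finset.univ.erase i) a (k-1) * a i) * (a i * (x i - (0 : Euc n) i) ^ 2) := by
          rw [hz]; ring
      _ ≤ _ := mul_le_mul_of_nonneg_right (hh i) this
  have hp2 : 0 < g + d * ∑ i, es (Finset.univ.erase i) a (k-1) * z i ^ 2 := by
    nlinarith [mul_le_mul_of_nonpos_left hsum hd]
  constructor
  · intro j hj hjk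
    rw [hS j hj hjk]
    have hej : 0 < es Finset.univ a j := es_pos _ _ (fun i _ => ha i) _ (by simp; omega)
    refine mul_pos (by positivity) ?_
    have h3 : ∑ i, es (Finset.univ.erase i) a (j-1) * z i ^ 2 ≤ (∑ i, es (Finset.univ.erase i) a (k-1) * z i ^ 2) * es Finset.univ a j := by
      rw [Finset.sum_mul]
      refine Finset.sum_le_sum fun i _ => ?_
      have := es_ratio Finset.univ a (fun i _ => ha i) i (Finset.mem_univ i) (j-1) (k-1) (by omega) (by simp; omega)
      rw [show k - 1 + 1 = k by omega, show j - 1 + 1 = j by omega, h1, mul_one] at this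
      nlinarith [sq_nonneg (z i), mul_le_mul_of_nonneg_right this (sq_nonneg (z i))]
    have h4 := mul_le_mul_of_nonpos_left h3 hd
    nlinarith [mul_pos hp2 hej]
  · rw [hS k hk le_rfl, h1]
    refine mul_le_mul_of_nonneg_left ?_ (by positivity)
    have := mul_le_mul_of_nonpos_left hsum hd
    linarith

structure OutP (n k : ℕ) (a : Fin n → ℝ) (R₀ N C : ℝ) (Φ g : ℝ → ℝ) : Prop where
  cd : ∀ t, 0 < t → ContDiffAt ℝ 2 Φ t
  d1 : ∀ t, 0 < t → HasDerivAt Φ (g t) t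
  zero : Φ R₀ = 0
  two : N ≤ Φ (2 * R₀)
  lo : ∀ R, 3 * R₀ < R → R ≤ Φ R
  hi : ∀ R, 3 * R₀ < R → Φ R ≤ R + C
  g1 : ∀ t, 0 < t → 1 ≤ g t
  gR : ∀ R, 3 * R₀ < R → (g R - 1) * R ≤ C
  gam : ∀ x : Euc n, 0 < Qf a 0 x → Gam n k (hessMat n (fun y => Φ (Qf a 0 y)) x) ∧
    1 ≤ SkHess n k (fun y => Φ (Qf a 0 y)) x

lemma out_exists {n k : ℕ} (hn : 3 ≤ n) (hk : 1 ≤ k) (hkn : k ≤ n) (a : Fin n → ℝ) (ha : ∀ i, 0 < a i)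
    (h1 : es Finset.univ a k = 1) (hk1' : k = 1 → (⨆ i, a i) < 1 / 2) (R₀ N : ℝ) (hR : 1 ≤ R₀) (hN : 2 * R₀ ≤ N) :
    ∃ α₀ > 0, ∀ α, α₀ ≤ α → ∃ C > 0, OutP n k a R₀ N C (fun s => ∫ t in R₀..s, genInt n k a α t) (genInt n k a α) := by
  obtain ⟨f1, f2, f3⟩ := hk_facts hn hk hkn a ha h1 hk1'
  set h := hkfun n k a with hh
  have hk0 : (0:ℝ) < k := by exact_mod_cast hk
  set q : ℝ := (k:ℝ) / (2 * h) with hq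
  have hq1 : 1 < q := by rw [hq, lt_div_iff₀ (by positivity)]; linarith
  have hge : genExp n k a = -q := by rw [genExp, ← hh, hq]; ring
  have hR0 : 0 < R₀ := by linarith
  have hN0 : 0 < N := by linarith
  refine ⟨(N / R₀) ^ k * (2 * R₀) ^ q, by positivity, fun α hα => ?_⟩
  have hα0 : 0 < α := lt_of_lt_of_le (by positivity) hα
  have hG : ∀ t, 0 < t → 1 < 1 + α * t ^ (-q) := fun t ht => by
    have : 0 < α * t ^ (-q) := by positivity
    linarith
  set g : ℝ → ℝ := genInt n k a α with hg
  have hgt : ∀ t, g t = (1 + α * t ^ (-q)) ^ ((1:ℝ) / k) := fun t => by rw [hg, genInt, hge]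
  have hgeq : g = fun t => (1 + α * t ^ (-q)) ^ ((1:ℝ) / k) := funext hgt
  have hg1 : ∀ t, 0 < t → 1 ≤ g t := fun t ht => by
    rw [hgt]; exact Real.one_le_rpow (hG t ht).le (by positivity)
  have hgle : ∀ t, 0 < t → g t ≤ 1 + α * t ^ (-q) := fun t ht => by
    rw [hgt]
    calc (1 + α * t ^ (-q)) ^ ((1:ℝ) / k) ≤ (1 + α * t ^ (-q)) ^ (1:ℝ) := by
          refine Real.rpow_le_rpow_of_exponent_le (hG t ht).le ?_
          rw [div_le_one hk0]; exact_mod_cast hk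
      _ = _ := Real.rpow_one _
  have hgk : ∀ t, 0 < t → g t ^ k = 1 + α * t ^ (-q) := fun t ht => by
    rw [hgt, ← Real.rpow_natCast, ← Real.rpow_mul (by linarith [hG t ht])]
    rw [one_div, inv_mul_cancel₀ hk0.ne', Real.rpow_one]
  have hcd : ∀ t, 0 < t → ContDiffAt ℝ 1 g t := fun t ht => by
    rw [hgeq]
    refine ContDiffAt.rpow_const_of_ne ?_ (by linarith [hG t ht])
    exact contDiffAt_const.add (contDiffAt_const.mul (contDiffAt_id.rpow_const_of_ne ht.ne'))
  set d : ℝ → ℝ := fun t => - (g t * (α * t ^ (-q)) / (2 * h * t * (1 + α * t ^ (-q)))) with hd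
  have hgd : ∀ t, 0 < t → HasDerivAt g (d t) t := fun t ht => by
    have e1 : HasDerivAt (fun t : ℝ => 1 + α * t ^ (-q)) (α * (-q * t ^ (-q - 1))) t :=
      ((Real.hasDerivAt_rpow_const (Or.inl ht.ne')).const_mul α).const_add 1
    have e2 := e1.rpow_const (p := (1:ℝ)/k) (Or.inl (by linarith [hG t ht]))
    rw [hgeq]
    refine e2.congr_deriv ?_
    rw [hd]
    simp only [hgt]
    have := hG t ht
    rw [Real.rpow_sub_one (show 1 + α * t ^ (-q) ≠ 0 by linarith), Real.rpow_sub_one ht.ne', hq]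
    have h3 : 1 + α * t ^ (-((k:ℝ) / (2 * h))) ≠ 0 := by rw [← hq]; linarith
    field_simp
  have hgc : ContinuousOn g (Set.Ioi 0) := fun t ht => (hcd t ht).continuousAt.continuousWithinAt
  set Φ : ℝ → ℝ := fun s => ∫ t in R₀..s, g t with hΦ
  have hii : ∀ s t, 0 < s → 0 < t → IntervalIntegrable g volume s t := fun s t hs ht => by
    refine ContinuousOn.intervalIntegrable (hgc.mono fun r hr => ?_)
    exact lt_of_lt_of_le (lt_min hs ht) hr.1
  have d1 : ∀ t, 0 < t → HasDerivAt Φ (g t) t := fun t ht =>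
    intervalIntegral.integral_hasDerivAt_right (hii R₀ t hR0 ht)
      (hgc.stronglyMeasurableAtFilter isOpen_Ioi t ht) (hcd t ht).continuousAt
  have cd : ∀ t, 0 < t → ContDiffAt ℝ 2 Φ t := fun t ht => by
    have : ContDiffOn ℝ (1 + 1) Φ (Set.Ioi 0) := by
      rw [contDiffOn_succ_iff_deriv_of_isOpen isOpen_Ioi]
      refine ⟨fun s hs => (d1 s hs).differentiableAt.differentiableWithinAt, by simp, ?_⟩
      have h4 : ContDiffOn ℝ 1 g (Set.Ioi 0) := fun s hs => (hcd s hs).contDiffWithinAt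
      exact h4.congr fun s hs => (d1 s hs).deriv
    have h5 := this.contDiffAt (isOpen_Ioi.mem_nhds ht)
    norm_num at h5
    exact h5
  have hmono : ∀ s t, 0 < s → s ≤ t → t - s ≤ Φ t - Φ s := fun s t hs hst => by
    have := Convex.mul_sub_le_image_sub_of_le_deriv (D := Set.Ioi (0:ℝ)) (convex_Ioi 0) (f := Φ)
      (fun r hr => (d1 r hr).continuousAt.continuousWithinAt)
      (fun r hr => (d1 r (interior_subset hr)).differentiableAt.differentiableWithinAt)
      (C := 1) (fun r hr => by rw [(d1 r (interior_subset hr)).deriv]; exact hg1 r (interior_subset hr)) s hs t (hs.trans_le hst) hst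
    linarith
  have h0 : Φ R₀ = 0 := by simp [hΦ]
  have htwo : N ≤ Φ (2 * R₀) := by
    have hgl : ∀ r, 0 < r → r ≤ 2 * R₀ → N / R₀ ≤ g r := fun r hr hr2 => by
      have e1 : (N / R₀) ^ k ≤ g r ^ k := by
        rw [hgk r hr]
        have e2 : (2 * R₀) ^ (-q) ≤ r ^ (-q) := Real.rpow_le_rpow_of_nonpos hr hr2 (by linarith)
        have e3 : (N / R₀) ^ k ≤ α * (2 * R₀) ^ (-q) := by
          rw [Real.rpow_neg (by positivity), ← div_eq_mul_inv, le_div_iff₀ (by positivity)]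
          exact hα
        have e4 := mul_le_mul_of_nonneg_left e2 hα0.le
        linarith
      exact le_of_pow_le_pow_left₀ (by omega) (by linarith [hg1 r hr]) e1
    have := Convex.mul_sub_le_image_sub_of_le_deriv (D := Set.Icc R₀ (2 * R₀)) (convex_Icc _ _) (f := Φ)
      (fun r hr => (d1 r (hR0.trans_le hr.1)).continuousAt.continuousWithinAt)
      (fun r hr => (d1 r (hR0.trans_le (interior_subset hr).1)).differentiableAt.differentiableWithinAt)
      (C := N / R₀) (fun r hr => by
        have hr' := interior_subset hr
        rw [(d1 r (hR0.trans_le hr'.1)).deriv]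
        exact hgl r (hR0.trans_le hr'.1) hr'.2) R₀ ⟨le_rfl, by linarith⟩ (2 * R₀) ⟨by linarith, le_rfl⟩ (by linarith)
    rw [h0, sub_zero, show 2 * R₀ - R₀ = R₀ by ring, div_mul_cancel₀ _ hR0.ne'] at this
    exact this
  refine ⟨max α (α * R₀ ^ (1 - q) / (q - 1)), lt_max_of_lt_left hα0, cd, d1, h0, htwo, ?_, ?_, hg1, ?_, ?_⟩
  · intro R hR'
    have := hmono (2 * R₀) R (by linarith) (by linarith)
    linarith
  · intro R hR'
    set Ψ : ℝ → ℝ := fun t => t - α * t ^ (1 - q) / (q - 1) - Φ t with hΨ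
    have hΨd : ∀ t, 0 < t → HasDerivAt Ψ (1 + α * t ^ (-q) - g t) t := fun t ht => by
      have e1 := (((Real.hasDerivAt_rpow_const (p := 1 - q) (Or.inl ht.ne')).const_mul α).div_const (q - 1))
      refine (((hasDerivAt_id t).sub e1).sub (d1 t ht)).congr_deriv ?_
      rw [show 1 - q - 1 = -q by ring]
      have : q - 1 ≠ 0 := by linarith
      field_simp; ring
    have hm : MonotoneOn Ψ (Set.Ioi 0) := by
      refine monotoneOn_of_deriv_nonneg (convex_Ioi 0) (fun t ht => (hΨd t ht).continuousAt.continuousWithinAt)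
        (fun t ht => (hΨd t (interior_subset ht)).differentiableAt.differentiableWithinAt) fun t ht => ?_
      have ht' : 0 < t := interior_subset ht
      rw [(hΨd t ht').deriv]; linarith [hgle t ht']
    have hm' := hm (show R₀ ∈ Set.Ioi 0 from hR0) (show R ∈ Set.Ioi 0 from by simp; linarith) (by linarith)
    simp only [hΨ, h0] at hm'
    have e5 : 0 ≤ α * R ^ (1 - q) / (q - 1) := by
      have : 0 < q - 1 := by linarith
      have : 0 < R := by linarith
      positivity
    have := le_max_right α (α * R₀ ^ (1 - q) / (q - 1))
    linarith
  · intro R hR'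
    refine le_trans ?_ (le_max_left _ _)
    have hRp : 0 < R := by linarith
    have e1 := hgle R hRp
    have e2 : R ^ (-q) * R ≤ 1 := by
      rw [← Real.rpow_add_one hRp.ne']
      exact Real.rpow_le_one_of_one_le_of_nonpos (by linarith) (by linarith)
    nlinarith [mul_le_mul_of_nonneg_left e2 hα0.le]
  · intro x hx
    have e := hess_comp a 0 x (cd _ hx) ((isOpen_Ioi.eventually_mem hx).mono fun t ht => d1 t ht) (hgd _ hx)
    have hGs := hG _ hx
    have hgs := hg1 _ hx
    set s := Qf a 0 x with hs
    have e1 : g s + d s * (2 * h * s) = g s / (1 + α * s ^ (-q)) := by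
      simp only [hd]
      have h3 : 1 + α * s ^ (-q) ≠ 0 := by linarith
      field_simp; ring
    have hdn : d s ≤ 0 := by
      have : 0 < 1 + α * s ^ (-q) := by linarith
      have : 0 < g s := by linarith
      simp only [hd, neg_nonpos]; positivity
    have e2 := sub_gam hk hkn a ha h1 h f1 (g s) (d s) (by linarith) hdn x (by rw [← hs, e1]; exact div_pos (by linarith) (by linarith))
    rw [← hs, e1] at e2
    rw [SkHess, e]
    refine ⟨e2.1, le_trans (le_of_eq ?_) e2.2⟩
    rw [← mul_div_assoc, ← pow_succ, show k - 1 + 1 = k by omega, hgk s hx, div_self (by linarith)]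

end Part9

section Part10

noncomputable abbrev rho {n : ℕ} (x₀ : Euc n) : Euc n → ℝ := Qf (fun _ => 1) x₀

def Rg {n : ℕ} (f1 : Euc n → ℝ) (b1 : ℝ) (f2 : Euc n → ℝ) (b2 : ℝ) : Set (Euc n) := {x | b1 ≤ f1 x ∧ f2 x ≤ b2}
def RgO {n : ℕ} (f1 : Euc n → ℝ) (b1 : ℝ) (f2 : Euc n → ℝ) (b2 : ℝ) : Set (Euc n) := {x | b1 < f1 x ∧ f2 x < b2}

structure Setup (n k : ℕ) (a : Fin n → ℝ) (l Λ R₀ N Co : ℝ) (Φ g : ℝ → ℝ) (x₀ : Euc n) (ε R : ℝ) (u : Euc n → ℝ) : Prop where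
  hn : 3 ≤ n
  hk : 1 ≤ k
  hkn : k ≤ n
  hl : 0 < l
  hla : ∀ i, l ≤ a i
  haL : ∀ i, a i ≤ Λ
  hS : es Finset.univ a k = 1
  hR0 : 1 ≤ R₀
  hR0L : 4 * Λ ≤ R₀
  O : OutP n k a R₀ N Co Φ g
  hCo : 0 < Co
  hx0 : ‖x₀‖ < 1 / 2
  he0 : 0 < ε
  he2 : ε < 1 / 2
  hR : 3 * R₀ < R
  hu : ∀ x ∈ Rg (rho x₀) (ε ^ 2 / 2) (Qf a 0) R, ContDiffAt ℝ (⊤ : ℕ∞) u x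
  hG : ∀ x ∈ RgO (rho x₀) (ε ^ 2 / 2) (Qf a 0) R, Gam n k (hessMat n u x)
  hE : ∀ x ∈ RgO (rho x₀) (ε ^ 2 / 2) (Qf a 0) R, SkHess n k u x = 1
  hin : ∀ x, rho x₀ x = ε ^ 2 / 2 → u x = 0
  hout : ∀ x, Qf a 0 x = R → u x = Φ R

lemma Qf_cont {n : ℕ} (a : Fin n → ℝ) (c : Euc n) : Continuous (Qf a c) := (Qf_contDiff a c (m := 0)).continuous

lemma Qf_proper {n : ℕ} (a : Fin n → ℝ) (l : ℝ) (hl : 0 < l) (hla : ∀ i, l ≤ a i) (c : Euc n) (b : ℝ) :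
    Bornology.IsBounded {x | Qf a c x ≤ b} := by
  refine (Metric.isBounded_closedBall (x := c) (r := √(2 * b / l))).subset fun x hx => ?_
  rw [Metric.mem_closedBall, dist_eq_norm]
  refine Real.le_sqrt_of_sq_le ?_
  rw [le_div_iff₀ hl, nsq_eq]
  have h1 : Qf a c x ≤ b := hx
  have : l * ∑ i, (x - c) i ^ 2 ≤ ∑ i, a i * (x i - c i) ^ 2 := by
    rw [Finset.mul_sum]
    exact Finset.sum_le_sum fun i _ => mul_le_mul_of_nonneg_right (hla i) (sq_nonneg _)
  unfold Qf at h1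
  linarith

lemma Rg_compact {n : ℕ} {f1 f2 : Euc n → ℝ} (h1 : Continuous f1) (h2 : Continuous f2) (b1 b2 : ℝ)
    (hb : Bornology.IsBounded {x | f2 x ≤ b2}) : IsCompact (Rg f1 b1 f2 b2) := by
  refine Metric.isCompact_of_isClosed_isBounded ?_ (hb.subset fun x hx => hx.2)
  exact (isClosed_le continuous_const h1).inter (isClosed_le h2 continuous_const)

lemma RgO_open {n : ℕ} {f1 f2 : Euc n → ℝ} (h1 : Continuous f1) (h2 : Continuous f2) (b1 b2 : ℝ) : IsOpen (RgO f1 b1 f2 b2) :=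
  (isOpen_lt continuous_const h1).inter (isOpen_lt h2 continuous_const)

lemma RgO_sub {n : ℕ} {f1 f2 : Euc n → ℝ} {b1 b2 : ℝ} : RgO f1 b1 f2 b2 ⊆ Rg f1 b1 f2 b2 := fun _ hx => ⟨hx.1.le, hx.2.le⟩

lemma Rg_bdry {n : ℕ} {f1 f2 : Euc n → ℝ} {b1 b2 : ℝ} {x : Euc n} (hx : x ∈ Rg f1 b1 f2 b2) (h : x ∉ RgO f1 b1 f2 b2) :
    f1 x = b1 ∨ f2 x = b2 := by
  by_contra hc
  push Not at hc
  exact h ⟨lt_of_le_of_ne hx.1 (Ne.symm hc.1), lt_of_le_of_ne hx.2 hc.2⟩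

lemma two_le_top : (2 : WithTop ℕ∞) ≤ ((⊤ : ℕ∞) : WithTop ℕ∞) := (WithTop.coe_le_coe.2 le_top : ((2 : ℕ∞) : WithTop ℕ∞) ≤ _)

namespace Setup
variable {n k : ℕ} {a : Fin n → ℝ} {l Λ R₀ N Co : ℝ} {Φ g : ℝ → ℝ} {x₀ : Euc n} {ε R : ℝ} {u : Euc n → ℝ}

lemma a0 (S : Setup n k a l Λ R₀ N Co Φ g x₀ ε R u) (i : Fin n) : 0 < a i := S.hl.trans_le (S.hla i)

lemma L0 (S : Setup n k a l Λ R₀ N Co Φ g x₀ ε R u) : 0 < Λ := by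
  have := S.hn
  exact (S.a0 ⟨0, by omega⟩).trans_le (S.haL _)

lemma u2 (S : Setup n k a l Λ R₀ N Co Φ g x₀ ε R u) {x : Euc n} (hx : x ∈ Rg (rho x₀) (ε ^ 2 / 2) (Qf a 0) R) : ContDiffAt ℝ 2 u x :=
  (S.hu x hx).of_le two_le_top

lemma s_low (S : Setup n k a l Λ R₀ N Co Φ g x₀ ε R u) (x : Euc n) : l * ‖x‖ ^ 2 ≤ 2 * Qf a 0 x := by
  rw [Qf_a]; linarith [Am_lower a l S.hla x]

lemma s_up (S : Setup n k a l Λ R₀ N Co Φ g x₀ ε R u) (x : Euc n) : 2 * Qf a 0 x ≤ Λ * ‖x‖ ^ 2 := by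
  rw [Qf_a]; linarith [Am_upper a Λ S.haL x]

lemma s_nn (S : Setup n k a l Λ R₀ N Co Φ g x₀ ε R u) (x : Euc n) : 0 ≤ Qf a 0 x := by
  have := S.s_low x
  have := S.hl
  have : 0 ≤ l * ‖x‖ ^ 2 := by positivity
  linarith

lemma small (S : Setup n k a l Λ R₀ N Co Φ g x₀ ε R u) {x : Euc n} (hx : ‖x‖ ≤ 2) : Qf a 0 x < R₀ := by
  have h1 := S.s_up x
  have h2 := S.L0
  have h3 := S.hR0L
  have h4 : ‖x‖ ^ 2 ≤ 4 := by nlinarith [norm_nonneg x]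
  nlinarith

lemma rho_le (S : Setup n k a l Λ R₀ N Co Φ g x₀ ε R u) {x : Euc n} {r : ℝ} (hr : 0 ≤ r) (h : rho x₀ x ≤ r ^ 2 / 2) : ‖x‖ ≤ r + 1/2 := by
  rw [rho, Qf_one] at h
  have h1 : ‖x - x₀‖ ≤ r := abs_le_of_sq_le_sq' (by linarith) hr |>.2
  have h2 := norm_add_le (x - x₀) x₀
  rw [sub_add_cancel] at h2
  linarith [S.hx0]

/-- at `s = t ≥ R₀` we are away from the ball -/
lemma away (S : Setup n k a l Λ R₀ N Co Φ g x₀ ε R u) {x : Euc n} (h : R₀ ≤ Qf a 0 x) : 1/2 < rho x₀ x := by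
  by_contra hc
  push Not at hc
  have := S.rho_le (r := 1) (by norm_num) (by linarith : rho x₀ x ≤ 1^2/2)
  linarith [S.small (x := x) (by linarith)]

lemma e2lt (S : Setup n k a l Λ R₀ N Co Φ g x₀ ε R u) : ε ^ 2 < 1/4 := by nlinarith [S.he0, S.he2]

/-- linear maximum principle on sub-rings -/
lemma mp (S : Setup n k a l Λ R₀ N Co Φ g x₀ ε R u) {f1 f2 : Euc n → ℝ} (b1 b2 : ℝ) (h1 : Continuous f1) (h2 : Continuous f2)
    (hb : Bornology.IsBounded {x | f2 x ≤ b2}) (hK : Rg f1 b1 f2 b2 ⊆ Rg (rho x₀) (ε ^ 2 / 2) (Qf a 0) R)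
    (hD : RgO f1 b1 f2 b2 ⊆ RgO (rho x₀) (ε ^ 2 / 2) (Qf a 0) R)
    (f : Euc n → ℝ) (hf : ∀ x ∈ Rg f1 b1 f2 b2, ContDiffAt ℝ 2 f x)
    (hb1 : ∀ x ∈ Rg f1 b1 f2 b2, f1 x = b1 → f x ≤ 0) (hb2 : ∀ x ∈ Rg f1 b1 f2 b2, f2 x = b2 → f x ≤ 0)
    (h : ∀ x ∈ RgO f1 b1 f2 b2, 0 ≤ (Fk n k (hessMat n u x) * hessMat n f x).trace) :
    ∀ x ∈ Rg f1 b1 f2 b2, f x ≤ 0 :=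
  mp_lin S.hk S.hkn _ _ (Rg_compact h1 h2 b1 b2 hb) (RgO_open h1 h2 b1 b2) RgO_sub u (fun x hx => S.u2 (hK (RgO_sub hx)))
    (fun x hx => S.hG x (hD hx)) (fun x hx => S.hE x (hD hx)) f (fun x hx => (hf x hx).continuousAt.continuousWithinAt)
    (fun x hx => hf x (RgO_sub hx)) (fun x hx hx' => (Rg_bdry hx hx').elim (hb1 x hx) (hb2 x hx)) h

lemma cmp_le (S : Setup n k a l Λ R₀ N Co Φ g x₀ ε R u) {f1 f2 : Euc n → ℝ} (b1 b2 : ℝ) (h1 : Continuous f1) (h2 : Continuous f2)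
    (hb : Bornology.IsBounded {x | f2 x ≤ b2}) (hK : Rg f1 b1 f2 b2 ⊆ Rg (rho x₀) (ε ^ 2 / 2) (Qf a 0) R)
    (hD : RgO f1 b1 f2 b2 ⊆ RgO (rho x₀) (ε ^ 2 / 2) (Qf a 0) R)
    (f : Euc n → ℝ) (hf : ∀ x ∈ Rg f1 b1 f2 b2, ContDiffAt ℝ 2 f x)
    (hb1 : ∀ x ∈ Rg f1 b1 f2 b2, f1 x = b1 → u x ≤ f x) (hb2 : ∀ x ∈ Rg f1 b1 f2 b2, f2 x = b2 → u x ≤ f x)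
    (h : ∀ x ∈ RgO f1 b1 f2 b2, SkHess n k f x ≤ 1) :
    ∀ x ∈ Rg f1 b1 f2 b2, u x ≤ f x :=
  mp_cmp S.hk S.hkn _ _ (Rg_compact h1 h2 b1 b2 hb) (RgO_open h1 h2 b1 b2) RgO_sub u f (fun x hx => S.u2 (hK (RgO_sub hx)))
    (fun x hx => hf x (RgO_sub hx)) (fun x hx => (S.u2 (hK hx)).continuousAt.continuousWithinAt)
    (fun x hx => (hf x hx).continuousAt.continuousWithinAt) (fun x hx => S.hG x (hD hx))
    (fun x hx => by rw [S.hE x (hD hx)]; exact h x hx) (fun x hx hx' => (Rg_bdry hx hx').elim (hb1 x hx) (hb2 x hx))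

lemma cmp_ge (S : Setup n k a l Λ R₀ N Co Φ g x₀ ε R u) {f1 f2 : Euc n → ℝ} (b1 b2 : ℝ) (h1 : Continuous f1) (h2 : Continuous f2)
    (hb : Bornology.IsBounded {x | f2 x ≤ b2}) (hK : Rg f1 b1 f2 b2 ⊆ Rg (rho x₀) (ε ^ 2 / 2) (Qf a 0) R)
    (hD : RgO f1 b1 f2 b2 ⊆ RgO (rho x₀) (ε ^ 2 / 2) (Qf a 0) R)
    (f : Euc n → ℝ) (hf : ∀ x ∈ Rg f1 b1 f2 b2, ContDiffAt ℝ 2 f x)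
    (hb1 : ∀ x ∈ Rg f1 b1 f2 b2, f1 x = b1 → f x ≤ u x) (hb2 : ∀ x ∈ Rg f1 b1 f2 b2, f2 x = b2 → f x ≤ u x)
    (hg : ∀ x ∈ RgO f1 b1 f2 b2, Gam n k (hessMat n f x)) (h : ∀ x ∈ RgO f1 b1 f2 b2, 1 ≤ SkHess n k f x) :
    ∀ x ∈ Rg f1 b1 f2 b2, f x ≤ u x :=
  mp_cmp S.hk S.hkn _ _ (Rg_compact h1 h2 b1 b2 hb) (RgO_open h1 h2 b1 b2) RgO_sub f u
    (fun x hx => hf x (RgO_sub hx)) (fun x hx => S.u2 (hK (RgO_sub hx)))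
    (fun x hx => (hf x hx).continuousAt.continuousWithinAt) (fun x hx => (S.u2 (hK hx)).continuousAt.continuousWithinAt)
    hg (fun x hx => by rw [S.hE x (hD hx)]; exact h x hx) (fun x hx hx' => (Rg_bdry hx hx').elim (hb1 x hx) (hb2 x hx))

lemma bddA (S : Setup n k a l Λ R₀ N Co Φ g x₀ ε R u) (b : ℝ) : Bornology.IsBounded {x | Qf a 0 x ≤ b} :=
  Qf_proper a l S.hl S.hla 0 b

lemma bddB (_S : Setup n k a l Λ R₀ N Co Φ g x₀ ε R u) (b : ℝ) : Bornology.IsBounded {x | rho x₀ x ≤ b} :=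
  Qf_proper _ 1 one_pos (fun _ => le_rfl) x₀ b

lemma hess_s (c : ℝ) (x : Euc n) : hessMat n (fun y => Qf a 0 y + c) x = Matrix.diagonal a := by
  rw [hess_add (Qf_contDiff a 0).contDiffAt contDiffAt_const, hess_const, add_zero]
  exact hess_Qf a 0 x

lemma s_cd (c : ℝ) (x : Euc n) : ContDiffAt ℝ 2 (fun y => Qf a 0 y + c) x :=
  (Qf_contDiff a 0).contDiffAt.add contDiffAt_const

lemma sk_s (S : Setup n k a l Λ R₀ N Co Φ g x₀ ε R u) (c : ℝ) (x : Euc n) : SkHess n k (fun y => Qf a 0 y + c) x = 1 := by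
  rw [SkHess, hess_s, matSk_diagonal n k S.hkn, S.hS]

lemma u_ge (S : Setup n k a l Λ R₀ N Co Φ g x₀ ε R u) :
    ∀ x ∈ Rg (rho x₀) (ε ^ 2 / 2) (Qf a 0) R, Qf a 0 x + (-(Λ/2)) ≤ u x := by
  refine S.cmp_ge _ _ (Qf_cont _ _) (Qf_cont _ _) (S.bddA R) subset_rfl subset_rfl (fun y => Qf a 0 y + (-(Λ/2)))
    (fun x _ => s_cd _ x) ?_ ?_ ?_ ?_
  · intro x _ hx
    rw [S.hin x hx]
    have h1 := S.rho_le S.he0.le hx.le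
    have h2 := S.s_up x
    have h3 : ‖x‖ ^ 2 ≤ 1 := by nlinarith [norm_nonneg x, S.he2]
    nlinarith [S.L0]
  · intro x _ hx
    rw [S.hout x hx, hx]
    linarith [S.O.lo R S.hR, S.L0]
  · intro x _ j hj hjk
    rw [hess_s, matSk_diagonal n j (hjk.trans S.hkn)]
    exact es_pos _ _ (fun i _ => S.a0 i) _ (by simp; exact hjk.trans S.hkn)
  · intro x _
    rw [S.sk_s]

lemma u_le (S : Setup n k a l Λ R₀ N Co Φ g x₀ ε R u) :
    ∀ x ∈ Rg (rho x₀) (ε ^ 2 / 2) (Qf a 0) R, u x ≤ Qf a 0 x + Co := by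
  refine S.cmp_le _ _ (Qf_cont _ _) (Qf_cont _ _) (S.bddA R) subset_rfl subset_rfl (fun y => Qf a 0 y + Co)
    (fun x _ => s_cd _ x) ?_ ?_ ?_
  · intro x _ hx
    rw [S.hin x hx]
    linarith [S.s_nn x, S.hCo]
  · intro x _ hx
    rw [S.hout x hx, hx]
    exact S.O.hi R S.hR
  · intro x _
    rw [S.sk_s]

lemma outSub (S : Setup n k a l Λ R₀ N Co Φ g x₀ ε R u) {t : ℝ} (ht : R₀ ≤ t) :
    Rg (Qf a 0) t (Qf a 0) R ⊆ Rg (rho x₀) (ε ^ 2 / 2) (Qf a 0) R := fun x hx =>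
  ⟨by linarith [S.away (ht.trans hx.1), S.e2lt], hx.2⟩

lemma outSubO (S : Setup n k a l Λ R₀ N Co Φ g x₀ ε R u) {t : ℝ} (ht : R₀ ≤ t) :
    RgO (Qf a 0) t (Qf a 0) R ⊆ RgO (rho x₀) (ε ^ 2 / 2) (Qf a 0) R := fun x hx =>
  ⟨by linarith [S.away (ht.trans hx.1.le), S.e2lt], hx.2⟩

lemma u_bar (S : Setup n k a l Λ R₀ N Co Φ g x₀ ε R u) :
    ∀ x ∈ Rg (Qf a 0) R₀ (Qf a 0) R, Φ (Qf a 0 x) ≤ u x := by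
  have hR0 := S.hR0
  have hp : ∀ x : Euc n, R₀ ≤ Qf a 0 x → 0 < Qf a 0 x := fun x hx => by linarith
  refine S.cmp_ge _ _ (Qf_cont _ _) (Qf_cont _ _) (S.bddA R) (S.outSub le_rfl) (S.outSubO le_rfl) (fun y => Φ (Qf a 0 y))
    (fun x hx => (S.O.cd _ (hp x hx.1)).comp x (Qf_contDiff a 0).contDiffAt) ?_ ?_ ?_ ?_
  · intro x hx hx'
    simp only [hx', S.O.zero]
    have := S.u_ge x (S.outSub le_rfl hx)
    linarith [S.hR0L, S.L0]
  · intro x hx hx'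
    rw [S.hout x hx', hx']
  · intro x hx
    exact (S.O.gam x (hp x hx.1.le)).1
  · intro x hx
    exact (S.O.gam x (hp x hx.1.le)).2

end Setup

end Part10

section Part11

lemma dir_tendsto {n : ℕ} (x v : Euc n) : Tendsto (fun t : ℝ => x + t • v) (𝓝[>] 0) (𝓝 x) := by
  have : Continuous (fun t : ℝ => x + t • v) := by fun_prop
  have h := this.tendsto 0
  simp only [zero_smul, add_zero] at h
  exact h.mono_left nhdsWithin_le_nhds

lemma dir_lt {n : ℕ} {f : Euc n → ℝ} {x : Euc n} (hf : ContinuousAt f x) {c : ℝ} (h : f x < c) (v : Euc n) :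
    ∀ᶠ t in 𝓝[>] (0:ℝ), f (x + t • v) < c :=
  (dir_tendsto x v).eventually (hf.eventually_lt continuousAt_const h)

lemma dir_gt {n : ℕ} {f : Euc n → ℝ} {x : Euc n} (hf : ContinuousAt f x) {c : ℝ} (h : c < f x) (v : Euc n) :
    ∀ᶠ t in 𝓝[>] (0:ℝ), c < f (x + t • v) :=
  (dir_tendsto x v).eventually (continuousAt_const.eventually_lt hf h)

lemma dir_inc {n : ℕ} {f : Euc n → ℝ} {f' : Euc n →L[ℝ] ℝ} {x : Euc n} (hf : HasFDerivAt f f' x) (v : Euc n) (h : 0 < f' v) :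
    ∀ᶠ t in 𝓝[>] (0:ℝ), f x < f (x + t • v) := by
  have hline : HasDerivAt (fun t : ℝ => x + t • v) v 0 := by
    simpa using ((hasDerivAt_id (0:ℝ)).smul_const v).const_add x
  have h0 : x + (0:ℝ) • v = x := by simp
  have hf' : HasFDerivAt f f' (x + (0:ℝ) • v) := by rw [h0]; exact hf
  have hd : HasDerivAt (fun t : ℝ => f (x + t • v)) (f' v) 0 := hf'.comp_hasDerivAt (0:ℝ) hline
  have h2 := (hasDerivAt_iff_tendsto_slope.1 hd).eventually (eventually_gt_nhds h)
  have h3 : ∀ᶠ t in 𝓝[>] (0:ℝ), 0 < slope (fun t : ℝ => f (x + t • v)) 0 t :=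
    h2.filter_mono (nhdsWithin_mono _ fun t ht => ne_of_gt ht)
  filter_upwards [h3, self_mem_nhdsWithin] with t ht ht0
  rw [slope_def_field] at ht
  simp only [zero_smul, add_zero, sub_zero] at ht
  have := (div_pos_iff_of_pos_right (show (0:ℝ) < t from ht0)).1 ht
  linarith

lemma dir_dec {n : ℕ} {f : Euc n → ℝ} {f' : Euc n →L[ℝ] ℝ} {x : Euc n} (hf : HasFDerivAt f f' x) (v : Euc n) (h : f' v < 0) :
    ∀ᶠ t in 𝓝[>] (0:ℝ), f (x + t • v) < f x := by
  have := dir_inc hf.neg v (by simpa using h)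
  filter_upwards [this] with t ht
  simp only [Pi.neg_apply] at ht
  linarith

lemma es_const {ι : Type*} [DecidableEq ι] (s : Finset ι) (c : ℝ) (j : ℕ) : es s (fun _ => c) j = (s.card.choose j) * c ^ j := by
  unfold es
  rw [Finset.sum_congr rfl (g := fun _ => c ^ j)]
  · simp
  · intro t ht
    rw [Finset.prod_const, (Finset.mem_powersetCard.1 ht).2]

lemma matSk_radial (n k : ℕ) (hk : 1 ≤ k) (hkn : k ≤ n) (p ρ : ℝ) (hρ : ρ ≠ 0) (y : Fin n → ℝ) (hy : y ⬝ᵥ y = 2 * ρ) :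
    matSk n k (p • Matrix.diagonal (fun _ => (1:ℝ)) + (-(((n:ℝ)/(2*k))/ρ) * p) • Matrix.vecMulVec y y) = 0 := by
  have e : p • Matrix.diagonal (fun _ : Fin n => (1:ℝ)) = Matrix.diagonal (fun _ => p) := by
    ext i j; by_cases h : i = j <;> simp [h]
  rw [e, ← Matrix.smul_vecMulVec, matSk_rank1 n k hk, matSk_diagonal n k hkn, Fk_diagonal n k hk hkn, es_const]
  have e2 : (fun i : Fin n => es (Finset.univ.erase i) (fun _ => p) (k-1)) = fun _ => ((n-1).choose (k-1) : ℝ) * p ^ (k-1) := by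
    funext i; rw [es_const]; simp
  rw [e2, Matrix.mulVec_smul, dotProduct_smul]
  have e3 : (Matrix.diagonal (fun _ : Fin n => ((n-1).choose (k-1) : ℝ) * p ^ (k-1))).mulVec y = (((n-1).choose (k-1) : ℝ) * p ^ (k-1)) • y := by
    funext i; simp [Matrix.mulVec_diagonal]
  rw [e3, dotProduct_smul, hy]
  obtain ⟨k', rfl⟩ : ∃ k', k = k' + 1 := ⟨k - 1, by omega⟩
  obtain ⟨n', rfl⟩ : ∃ n', n = n' + 1 := ⟨n - 1, by omega⟩
  have h := Nat.add_one_mul_choose_eq n' k'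
  have h' : ((n':ℝ) + 1) * (n'.choose k') = ((n'+1).choose (k'+1)) * ((k':ℝ)+1) := by exact_mod_cast h
  simp only [Finset.card_univ, Fintype.card_fin, add_tsub_cancel_right, smul_eq_mul]
  push_cast
  have : (k':ℝ) + 1 ≠ 0 := by positivity
  field_simp
  rw [pow_succ]
  linear_combination (-p * p^k') * h'

/-- the linearized operator -/
noncomputable def Lo (n k : ℕ) (u f : Euc n → ℝ) (x : Euc n) : ℝ := (Fk n k (hessMat n u x) * hessMat n f x).trace

lemma Lo_add {n k : ℕ} {u f g : Euc n → ℝ} {x : Euc n} (hf : ContDiffAt ℝ 2 f x) (hg : ContDiffAt ℝ 2 g x) :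
    Lo n k u (fun y => f y + g y) x = Lo n k u f x + Lo n k u g x := by
  rw [Lo, hess_add hf hg, Matrix.mul_add, Matrix.trace_add]; rfl

lemma Lo_sub {n k : ℕ} {u f g : Euc n → ℝ} {x : Euc n} (hf : ContDiffAt ℝ 2 f x) (hg : ContDiffAt ℝ 2 g x) :
    Lo n k u (fun y => f y - g y) x = Lo n k u f x - Lo n k u g x := by
  rw [Lo, hess_sub hf hg, Matrix.mul_sub, Matrix.trace_sub]; rfl

lemma Lo_smul {n k : ℕ} {u f : Euc n → ℝ} {x : Euc n} (c : ℝ) (hf : ContDiffAt ℝ 2 f x) :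
    Lo n k u (fun y => c * f y) x = c * Lo n k u f x := by
  rw [Lo, hess_smul c hf, Matrix.mul_smul, Matrix.trace_smul]; rfl

lemma Lo_const {n k : ℕ} {u : Euc n → ℝ} {x : Euc n} (c : ℝ) : Lo n k u (fun _ => c) x = 0 := by
  rw [Lo, hess_const]; simp

lemma Lo_lin {n k : ℕ} {u : Euc n → ℝ} {x : Euc n} (c : ℝ) (l : Euc n →L[ℝ] ℝ) : Lo n k u (fun y => l y + c) x = 0 := by
  rw [Lo, hess_zero_of_linear]; simp

namespace Setup
variable {n k : ℕ} {a : Fin n → ℝ} {l Λ R₀ N Co : ℝ} {Φ g : ℝ → ℝ} {x₀ : Euc n} {ε R : ℝ} {u : Euc n → ℝ}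
variable {e c1 C2 ρm : ℝ} {φ φ' : ℝ → ℝ}

lemma Lo_u (S : Setup n k a l Λ R₀ N Co Φ g x₀ ε R u) {x : Euc n} (hx : x ∈ RgO (rho x₀) (ε ^ 2 / 2) (Qf a 0) R) :
    Lo n k u u x = k := by
  have h := S.hE x hx
  rw [SkHess] at h
  rw [Lo, Fk_trace_mul S.hk S.hkn _ (hess_symm u x (S.u2 (RgO_sub hx))), h, mul_one]

lemma tr1 (S : Setup n k a l Λ R₀ N Co Φ g x₀ ε R u) {x : Euc n} (hx : x ∈ RgO (rho x₀) (ε ^ 2 / 2) (Qf a 0) R) :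
    1 ≤ (Fk n k (hessMat n u x)).trace :=
  Fk_trace_ge S.hk S.hkn _ (hess_symm u x (S.u2 (RgO_sub hx))) (S.hG x hx) (S.hE x hx)

lemma Lo_vec (S : Setup n k a l Λ R₀ N Co Φ g x₀ ε R u) {x : Euc n} (hx : x ∈ RgO (rho x₀) (ε ^ 2 / 2) (Qf a 0) R) (b : Euc n)
    (T : Euc n →L[ℝ] Euc n) (c : ℝ)
    (hT : ∀ i j, (T (ebasis n j)) i + (T (ebasis n i)) j = if i = j then 2 * c else 0) :
    Lo n k u (fun y => fderiv ℝ u y (b + T y)) x = 2 * c * k := by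
  refine L_killing S.hk S.hkn u x (S.hu x (RgO_sub hx)) ?_ b T c hT
  filter_upwards [(RgO_open (Qf_cont _ _) (Qf_cont _ _) _ _).mem_nhds hx] with y hy
  exact S.hE y hy

lemma rho_pos {x : Euc n} (he : 0 < ε) (h : ε ^ 2 / 2 ≤ rho x₀ x) : 0 < rho x₀ x := by
  have : 0 < ε ^ 2 / 2 := by positivity
  linarith

lemma phi_hess (P : Prof ((n:ℝ)/(2*k)) ε e c1 C2 ρm φ φ') {x : Euc n} (h : 0 < rho x₀ x) :
    hessMat n (fun y => φ (rho x₀ y)) x = φ' (rho x₀ x) • Matrix.diagonal (fun _ => (1:ℝ)) +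
      (-(((n:ℝ)/(2*k))/rho x₀ x) * φ' (rho x₀ x)) • Matrix.vecMulVec (fun i => (x - x₀) i) (fun i => (x - x₀) i) := by
  have := hess_comp (fun _ => (1:ℝ)) x₀ x (P.cd _ h)
    (by filter_upwards [eventually_gt_nhds h] with t ht; exact P.d1 t ht) (P.d2 _ h)
  rw [this]
  simp

lemma phi_cd (P : Prof ((n:ℝ)/(2*k)) ε e c1 C2 ρm φ φ') {x : Euc n} (h : 0 < rho x₀ x) :
    ContDiffAt ℝ 2 (fun y => φ (rho x₀ y)) x := (P.cd _ h).comp x (Qf_contDiff _ x₀).contDiffAt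

lemma yy (x : Euc n) : (fun i => (x - x₀) i) ⬝ᵥ (fun i => (x - x₀) i) = 2 * rho x₀ x := by
  rw [dot_inner, real_inner_self_eq_norm_sq, rho, Qf_one]; ring

lemma sk_phi (S : Setup n k a l Λ R₀ N Co Φ g x₀ ε R u) (P : Prof ((n:ℝ)/(2*k)) ε e c1 C2 ρm φ φ') {x : Euc n} (h : 0 < rho x₀ x) :
    matSk n k (hessMat n (fun y => φ (rho x₀ y)) x) = 0 := by
  rw [phi_hess P h]
  exact matSk_radial n k S.hk S.hkn _ _ h.ne' _ (yy x)

lemma Lo_phi (S : Setup n k a l Λ R₀ N Co Φ g x₀ ε R u) (P : Prof ((n:ℝ)/(2*k)) ε e c1 C2 ρm φ φ') {x : Euc n}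
    (hx : x ∈ RgO (rho x₀) (ε ^ 2 / 2) (Qf a 0) R) : 0 ≤ Lo n k u (fun y => φ (rho x₀ y)) x := by
  have h := rho_pos S.he0 hx.1.le
  have hp := P.pos _ h
  have hU := Fk_upper S.hk S.hkn _ (hess_symm u x (S.u2 (RgO_sub hx))) (S.hG x hx) (fun i => (x - x₀) i)
  rw [yy] at hU
  rw [Lo, phi_hess P h, Matrix.mul_add, Matrix.trace_add, Matrix.mul_smul, Matrix.mul_smul, Matrix.trace_smul, Matrix.trace_smul, tr_vmv,
    Matrix.diagonal_one, Matrix.mul_one]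
  set t := (Fk n k (hessMat n u x)).trace
  set q := (fun i => (x - x₀) i) ⬝ᵥ (Fk n k (hessMat n u x)).mulVec (fun i => (x - x₀) i)
  set r := rho x₀ x
  have hk0 : (0:ℝ) < k := by exact_mod_cast S.hk
  have : (n:ℝ)/(2*k)/r * q ≤ t := by
    rw [div_div, div_mul_eq_mul_div, div_le_iff₀ (by positivity)]
    linarith
  simp only [smul_eq_mul]
  nlinarith

lemma Lo_rho (x : Euc n) (c : ℝ) : Lo n k u (fun y => rho x₀ y + c) x = (Fk n k (hessMat n u x)).trace := by
  rw [Lo, hess_add (Qf_contDiff _ _).contDiffAt contDiffAt_const, hess_const, add_zero]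
  have := hess_Qf (fun _ : Fin n => (1:ℝ)) x₀ x
  change (Fk n k (hessMat n u x) * hessMat n (Qf (fun _ : Fin n => (1:ℝ)) x₀) x).trace = _
  rw [this, Matrix.diagonal_one, Matrix.mul_one]

/-- the lower barrier -/
noncomputable def wb (k : ℕ) (x₀ : Euc n) (ε : ℝ) (φ : ℝ → ℝ) : Euc n → ℝ := fun y => (k:ℝ) * (φ (rho x₀ y) + (rho x₀ y + (-(ε^2/2))))

lemma wb_cd (P : Prof ((n:ℝ)/(2*k)) ε e c1 C2 ρm φ φ') {x : Euc n} (h : 0 < rho x₀ x) : ContDiffAt ℝ 2 (wb k x₀ ε φ) x :=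
  contDiffAt_const.mul ((phi_cd P h).add ((Qf_contDiff _ _).contDiffAt.add contDiffAt_const))

lemma Lo_wb (S : Setup n k a l Λ R₀ N Co Φ g x₀ ε R u) (P : Prof ((n:ℝ)/(2*k)) ε e c1 C2 ρm φ φ') {x : Euc n}
    (hx : x ∈ RgO (rho x₀) (ε ^ 2 / 2) (Qf a 0) R) : (k:ℝ) ≤ Lo n k u (wb k x₀ ε φ) x := by
  have h := rho_pos S.he0 hx.1.le
  have c2 : ContDiffAt ℝ 2 (fun y => rho x₀ y + (-(ε^2/2))) x := (Qf_contDiff _ _).contDiffAt.add contDiffAt_const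
  have : Lo n k u (wb k x₀ ε φ) x = (k:ℝ) * (Lo n k u (fun y => φ (rho x₀ y)) x + (Fk n k (hessMat n u x)).trace) := by
    unfold wb
    rw [Lo_smul _ ((phi_cd P h).add c2), Lo_add (phi_cd P h) c2, Lo_rho]
  rw [this]
  have h1 := S.Lo_phi P hx
  have h2 := S.tr1 hx
  have hk0 : (0:ℝ) < k := by exact_mod_cast S.hk
  nlinarith

lemma wb_fd (P : Prof ((n:ℝ)/(2*k)) ε e c1 C2 ρm φ φ') {x : Euc n} (h : 0 < rho x₀ x) :
    HasFDerivAt (wb k x₀ ε φ) (((k:ℝ) * (φ' (rho x₀ x) + 1)) • Qd (fun _ => 1) x₀ x) x := by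
  have h1 := comp_fderiv (fun _ => (1:ℝ)) x₀ x (P.d1 _ h)
  have h2 := (Qf_hasFDerivAt (fun _ => (1:ℝ)) x₀ x).add_const (-(ε^2/2))
  refine ((h1.add h2).const_mul (k:ℝ)).congr_fderiv ?_
  ext v; simp; ring

lemma rho_rm (S : Setup n k a l Λ R₀ N Co Φ g x₀ ε R u) {x : Euc n} (h : Qf a 0 x ≤ 2 * R₀) : rho x₀ x ≤ 4 * R₀ / l + 1 := by
  have h1 := S.s_low x
  have h2 : ‖x‖ ^ 2 ≤ 4 * R₀ / l := by rw [le_div_iff₀ S.hl]; linarith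
  have h3 := norm_sub_le x x₀
  have h4 := S.hx0
  rw [rho, Qf_one]
  nlinarith [norm_nonneg x, norm_nonneg (x - x₀), norm_nonneg x₀, sq_nonneg (‖x‖ - 1/2)]

lemma inSub (S : Setup n k a l Λ R₀ N Co Φ g x₀ ε R u) : Rg (rho x₀) (ε ^ 2 / 2) (Qf a 0) (2 * R₀) ⊆ Rg (rho x₀) (ε ^ 2 / 2) (Qf a 0) R :=
  fun _ hx => ⟨hx.1, by linarith [hx.2, S.hR, S.hR0]⟩
lemma inSubO (S : Setup n k a l Λ R₀ N Co Φ g x₀ ε R u) : RgO (rho x₀) (ε ^ 2 / 2) (Qf a 0) (2 * R₀) ⊆ RgO (rho x₀) (ε ^ 2 / 2) (Qf a 0) R :=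
  fun _ hx => ⟨hx.1, by linarith [hx.2, S.hR, S.hR0]⟩

lemma w2_le (S : Setup n k a l Λ R₀ N Co Φ g x₀ ε R u) (P : Prof ((n:ℝ)/(2*k)) ε e c1 C2 (4 * R₀ / l + 1) φ φ')
    (hN : 2 * k * (C2 + (4 * R₀ / l + 1)) ≤ N) :
    ∀ x ∈ Rg (rho x₀) (ε ^ 2 / 2) (Qf a 0) (2 * R₀), 2 * wb k x₀ ε φ x ≤ u x := by
  have key : ∀ x ∈ Rg (rho x₀) (ε ^ 2 / 2) (Qf a 0) (2 * R₀), 2 * wb k x₀ ε φ x - u x ≤ 0 := by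
    have cw : ∀ x ∈ Rg (rho x₀) (ε ^ 2 / 2) (Qf a 0) (2 * R₀), ContDiffAt ℝ 2 (fun x => 2 * wb k x₀ ε φ x) x :=
      fun x hx => contDiffAt_const.mul (wb_cd P (rho_pos S.he0 hx.1))
    refine S.mp _ _ (Qf_cont _ _) (Qf_cont _ _) (S.bddA _) S.inSub S.inSubO (fun x => 2 * wb k x₀ ε φ x - u x)
      (fun x hx => (cw x hx).sub (S.u2 (S.inSub hx))) ?_ ?_ ?_
    · intro x hx h
      have h' : rho x₀ x = ε ^ 2 / 2 := h
      simp only [wb]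
      rw [S.hin x h, h', P.z]
      simp
    · intro x hx h
      have h1 := S.u_bar x ⟨by linarith [S.hR0], by linarith [S.hR, S.hR0]⟩
      rw [h] at h1
      have h2 := S.O.two
      have h3 := S.rho_rm h.le
      have h4 := P.up _ hx.1 h3
      have hk0 : (0:ℝ) < k := by exact_mod_cast S.hk
      have : wb k x₀ ε φ x ≤ k * (C2 + (4 * R₀ / l + 1)) := by
        unfold wb
        refine mul_le_mul_of_nonneg_left ?_ hk0.le
        nlinarith [sq_nonneg ε]
      linarith
    · intro x hx
      have hx' := S.inSubO hx
      have h1 := S.Lo_wb P hx'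
      have h2 := S.Lo_u hx'
      have h3 : Lo n k u (fun x => 2 * wb k x₀ ε φ x - u x) x = 2 * Lo n k u (wb k x₀ ε φ) x - k := by
        rw [Lo_sub (cw x (RgO_sub hx)) (S.u2 (RgO_sub hx')), h2, Lo_smul 2 (wb_cd P (rho_pos S.he0 hx.1.le))]
      change 0 ≤ Lo n k u (fun x => 2 * wb k x₀ ε φ x - u x) x
      rw [h3]
      have hk0 : (0:ℝ) < k := by exact_mod_cast S.hk
      linarith
  intro x hx
  linarith [key x hx]

lemma rSub (S : Setup n k a l Λ R₀ N Co Φ g x₀ ε R u) {t : ℝ} (ht : t ≤ 1/2) : Rg (rho x₀) (ε ^ 2 / 2) (rho x₀) t ⊆ Rg (rho x₀) (ε ^ 2 / 2) (Qf a 0) R :=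
  fun x hx => ⟨hx.1, by
    have := S.rho_le (x := x) (r := 1) (by norm_num) (by linarith [hx.2])
    linarith [S.small (x := x) (by linarith), S.hR, S.hR0]⟩
lemma rSubO (S : Setup n k a l Λ R₀ N Co Φ g x₀ ε R u) {t : ℝ} (ht : t ≤ 1/2) : RgO (rho x₀) (ε ^ 2 / 2) (rho x₀) t ⊆ RgO (rho x₀) (ε ^ 2 / 2) (Qf a 0) R :=
  fun x hx => ⟨hx.1, by
    have := S.rho_le (x := x) (r := 1) (by norm_num) (by linarith [hx.2])
    linarith [S.small (x := x) (by linarith), S.hR, S.hR0]⟩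

lemma u_phi (S : Setup n k a l Λ R₀ N Co Φ g x₀ ε R u) (P : Prof ((n:ℝ)/(2*k)) ε e c1 C2 ρm φ φ') (hc1 : 0 < c1) :
    ∀ x ∈ Rg (rho x₀) (ε ^ 2 / 2) (rho x₀) (1/2), u x ≤ (R₀ + Co) / c1 * φ (rho x₀ x) := by
  have hM : 0 < (R₀ + Co) / c1 := by have := S.hR0; have := S.hCo; positivity
  refine S.cmp_le _ _ (Qf_cont _ _) (Qf_cont _ _) (S.bddB _) (S.rSub le_rfl) (S.rSubO le_rfl) (fun x => (R₀ + Co) / c1 * φ (rho x₀ x))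
    (fun x hx => contDiffAt_const.mul (phi_cd P (rho_pos S.he0 hx.1))) ?_ ?_ ?_
  · intro x hx h
    have h' : rho x₀ x = ε ^ 2 / 2 := h
    rw [S.hin x h, h', P.z, mul_zero]
  · intro x hx h
    have h1 := S.u_le x (S.rSub le_rfl hx)
    have h2 := S.rho_le (x := x) (r := 1) (by norm_num) (by linarith)
    have h3 := S.small (x := x) (by linarith)
    have h4 := P.half
    have h' : rho x₀ x = 1 / 2 := h
    rw [h']
    have h5 : (R₀ + Co) / c1 * c1 ≤ (R₀ + Co) / c1 * φ (1/2) := mul_le_mul_of_nonneg_left h4 hM.le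
    rw [div_mul_cancel₀ _ hc1.ne'] at h5
    linarith
  · intro x hx
    have hp := rho_pos S.he0 hx.1.le
    rw [SkHess, hess_smul _ (phi_cd P hp), matSk_smul S.hkn _ _ (hess_symm _ _ (phi_cd P hp)), S.sk_phi P hp]
    simp

lemma grad_in (S : Setup n k a l Λ R₀ N Co Φ g x₀ ε R u) (P : Prof ((n:ℝ)/(2*k)) ε e c1 C2 (4 * R₀ / l + 1) φ φ') (hc1 : 0 < c1)
    (hN : 2 * k * (C2 + (4 * R₀ / l + 1)) ≤ N) {p : Euc n} (hp : rho x₀ p = ε ^ 2 / 2) :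
    ∃ b, 2 * k * (e / ε) ≤ b ∧ b ≤ (R₀ + Co) / c1 * (e / ε) ∧ ∀ v, fderiv ℝ u p v = b * inner ℝ (p - x₀) v := by
  have hpos := rho_pos (x := p) S.he0 hp.ge
  have hnp := S.rho_le S.he0.le hp.le
  have hsm := S.small (x := p) (by linarith [S.he2])
  have hmem : p ∈ Rg (rho x₀) (ε ^ 2 / 2) (Qf a 0) R := ⟨hp.ge, by linarith [S.hR, S.hR0]⟩
  have hfu : HasFDerivAt u (fderiv ℝ u p) p := ((S.u2 hmem).differentiableAt (by norm_num)).hasFDerivAt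
  have hk0 : (0:ℝ) < k := by exact_mod_cast S.hk
  have he := S.e2lt
  have hyy : inner ℝ (p - x₀) (p - x₀) = ε ^ 2 := by
    rw [real_inner_self_eq_norm_sq]
    rw [rho, Qf_one] at hp; linarith
  refine lin_mult (fun v => fderiv ℝ u p v) (fun v => inner ℝ (p - x₀) v) (by intro x y c; simp) (by intro x y c; simp [inner_add_right, inner_smul_right])
    (p - x₀) (by rw [hyy]; have := S.he0; positivity) _ _ ?_
  intro v hv
  have hinc : ∀ᶠ t in 𝓝[>] (0:ℝ), rho x₀ p < rho x₀ (p + t • v) :=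
    dir_inc (Qf_hasFDerivAt _ x₀ p) v (by rw [Qd_one]; exact hv)
  have hlt : ∀ᶠ t in 𝓝[>] (0:ℝ), rho x₀ (p + t • v) < 1/2 := dir_lt (Qf_cont _ _).continuousAt (by rw [← rho]; linarith) v
  have hlt2 : ∀ᶠ t in 𝓝[>] (0:ℝ), Qf a 0 (p + t • v) < 2 * R₀ := dir_lt (Qf_cont _ _).continuousAt (by linarith [S.hR0]) v
  constructor
  · have := sq1 ((wb_fd P hpos).const_mul 2) hfu (by simp only [wb]; rw [S.hin p hp, hp, P.z]; simp) v
      (by filter_upwards [hinc, hlt2] with t h1 h2; exact S.w2_le P hN _ ⟨by linarith, h2.le⟩)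
    simp only [FunLike.coe_smul, Pi.smul_apply, smul_eq_mul, Qd_one] at this
    rw [hp, P.dz] at this
    nlinarith [mul_pos hk0 hv]
  · have h1 := comp_fderiv (fun _ => (1:ℝ)) x₀ p (P.d1 _ hpos)
    have := sq1 hfu (h1.const_mul ((R₀ + Co) / c1)) (by rw [S.hin p hp, ← rho, hp, P.z]; simp) v
      (by filter_upwards [hinc, hlt] with t h1 h2; exact S.u_phi P hc1 _ ⟨by linarith, h2.le⟩)
    simp only [FunLike.coe_smul, Pi.smul_apply, smul_eq_mul, Qd_one] at this
    rw [← rho, hp, P.dz] at this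
    linarith

lemma u_le' (S : Setup n k a l Λ R₀ N Co Φ g x₀ ε R u) :
    ∀ x ∈ Rg (rho x₀) (ε ^ 2 / 2) (Qf a 0) R, u x ≤ Qf a 0 x + (Φ R - R) := by
  refine S.cmp_le _ _ (Qf_cont _ _) (Qf_cont _ _) (S.bddA R) subset_rfl subset_rfl (fun y => Qf a 0 y + (Φ R - R))
    (fun x _ => s_cd _ x) ?_ ?_ ?_
  · intro x _ hx
    rw [S.hin x hx]
    linarith [S.s_nn x, S.O.lo R S.hR]
  · intro x _ hx
    rw [S.hout x hx, hx]
    linarith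
  · intro x _
    rw [S.sk_s]

lemma grad_out (S : Setup n k a l Λ R₀ N Co Φ g x₀ ε R u) {p : Euc n} (hp : Qf a 0 p = R) :
    ∃ θ, 1 ≤ θ ∧ θ ≤ g R ∧ ∀ v, fderiv ℝ u p v = θ * inner ℝ (Am a p) v := by
  have hR0 := S.hR0
  have hRR := S.hR
  have hmem : p ∈ Rg (rho x₀) (ε ^ 2 / 2) (Qf a 0) R := S.outSub le_rfl ⟨by linarith, hp.le⟩
  have hfu : HasFDerivAt u (fderiv ℝ u p) p := ((S.u2 hmem).differentiableAt (by norm_num)).hasFDerivAt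
  have hpp : 0 < inner ℝ (Am a p) p := by
    rw [Qf_a] at hp; linarith
  have := lin_mult (fun v => -fderiv ℝ u p v) (fun v => -inner ℝ (Am a p) v) (by intro x y c; simp; ring) (by intro x y c; simp [inner_add_right, inner_smul_right]; ring)
    (-p) (by simpa using hpp) 1 (g R) ?_
  · obtain ⟨b, h1, h2, h3⟩ := this
    exact ⟨b, h1, h2, fun v => by have := h3 v; linarith⟩
  intro v hv
  have hdec : ∀ᶠ t in 𝓝[>] (0:ℝ), Qf a 0 (p + t • v) < Qf a 0 p :=
    dir_dec (Qf_hasFDerivAt a 0 p) v (by rw [Qd_a]; linarith)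
  have hgt : ∀ᶠ t in 𝓝[>] (0:ℝ), R₀ < Qf a 0 (p + t • v) := dir_gt (Qf_cont _ _).continuousAt (by linarith) v
  have hd := comp_fderiv a 0 p (S.O.d1 (Qf a 0 p) (by linarith))
  have h1 := sq1 hd hfu (by rw [S.hout p hp, hp]) v
      (by filter_upwards [hdec, hgt] with t h1 h2; exact S.u_bar _ ⟨h2.le, by linarith⟩)
  have h2 := sq1 hfu ((Qf_hasFDerivAt a 0 p).add_const (Φ R - R)) (by rw [S.hout p hp, hp]; ring) v
      (by filter_upwards [hdec, hgt] with t h1 h2; exact S.u_le' _ (S.outSub le_rfl ⟨h2.le, by linarith⟩))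
  simp only [FunLike.coe_smul, Pi.smul_apply, smul_eq_mul, Qd_a, hp] at h1 h2
  constructor <;> linarith

end Setup

end Part11

section Part12

lemma bdry_mult {n : ℕ} {f h : Euc n → ℝ} {f' h' : Euc n →L[ℝ] ℝ} {p : Euc n} (ν v0 : Euc n) (hv0 : 0 < inner ℝ ν v0)
    (hf : HasFDerivAt f f' p) (hh : HasFDerivAt h h' p) (hfp : f p = 0) (hhp : h p = 0)
    (hev : ∀ v, 0 < inner ℝ ν v → ∀ᶠ t in 𝓝[>] (0:ℝ), |f (p + t • v)| ≤ h (p + t • v)) (β : ℝ)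
    (hβ : ∀ v, 0 < inner ℝ ν v → h' v ≤ β * inner ℝ ν v) :
    ∃ c, |c| ≤ β ∧ ∀ v, f' v = c * inner ℝ ν v := by
  obtain ⟨c, h1, h2, h3⟩ := lin_mult (fun v => f' v) (fun v => inner ℝ ν v) (by intro x y c; simp)
    (by intro x y c; simp [inner_add_right, inner_smul_right]) v0 hv0 (-β) β (by
      intro v hv
      have a1 := sq1 hf hh (by rw [hfp, hhp]) v (by filter_upwards [hev v hv] with t ht; exact (le_abs_self _).trans ht)
      have a2 := sq1 hf.neg hh (by simp [hfp, hhp]) v (by filter_upwards [hev v hv] with t ht; exact (neg_le_abs _).trans ht)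
      simp only [FunLike.coe_neg, Pi.neg_apply] at a2
      have := hβ v hv
      constructor <;> linarith)
  exact ⟨c, abs_le.2 ⟨h1, h2⟩, h3⟩

lemma sk_lim {n k : ℕ} {u : Euc n → ℝ} {p v : Euc n} (hu : ContDiffAt ℝ 2 u p)
    (h : ∀ᶠ t in 𝓝[>] (0:ℝ), SkHess n k u (p + t • v) = 1) : SkHess n k u p = 1 := by
  have h1 : Tendsto (fun t : ℝ => SkHess n k u (p + t • v)) (𝓝[>] 0) (𝓝 (SkHess n k u p)) :=
    (sk_cont k u p hu).tendsto.comp (dir_tendsto p v)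
  have h2 : Tendsto (fun t : ℝ => SkHess n k u (p + t • v)) (𝓝[>] 0) (𝓝 1) :=
    tendsto_const_nhds.congr' (by filter_upwards [h] with t ht; exact ht.symm)
  exact tendsto_nhds_unique h1 h2

namespace Setup
variable {n k : ℕ} {a : Fin n → ℝ} {l Λ R₀ N Co : ℝ} {Φ g : ℝ → ℝ} {x₀ : Euc n} {ε R : ℝ} {u : Euc n → ℝ}
variable {e c1 C2 ρm : ℝ} {φ φ' : ℝ → ℝ}

lemma out_norm (S : Setup n k a l Λ R₀ N Co Φ g x₀ ε R u) {p : Euc n} (hp : Qf a 0 p ≤ R) : ‖p‖ ≤ R * (1/2 + 1/l) := by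
  have h1 := S.s_low p
  have hl := S.hl
  have h2 : ‖p‖ ^ 2 ≤ 2 * R / l := by rw [le_div_iff₀ hl]; linarith
  have h3 : 1 ≤ R := by linarith [S.hR, S.hR0]
  have : R * (1/2 + 1/l) = R/2 + (2 * R / l)/2 := by field_simp
  rw [this]
  nlinarith [sq_nonneg (‖p‖ - 1)]

lemma theta_bd (S : Setup n k a l Λ R₀ N Co Φ g x₀ ε R u) {θ : ℝ} (h1 : θ ≤ g R) {p : Euc n} (hp : Qf a 0 p ≤ R) :
    (θ - 1) * (Λ * ‖p‖) ≤ Co * Λ * (1/2 + 1/l) := by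
  have h2 := S.O.gR R S.hR
  have h3 := S.out_norm hp
  have h4 := S.L0
  have hl := S.hl
  have h5 : 1 ≤ R := by linarith [S.hR, S.hR0]
  have hg := S.O.g1 R (by linarith)
  calc (θ - 1) * (Λ * ‖p‖) ≤ (g R - 1) * (Λ * ‖p‖) := mul_le_mul_of_nonneg_right (by linarith) (by positivity)
    _ ≤ (g R - 1) * (Λ * (R * (1/2 + 1/l))) := by
        refine mul_le_mul_of_nonneg_left ?_ (by linarith)
        exact mul_le_mul_of_nonneg_left h3 h4.le
    _ = ((g R - 1) * R) * (Λ * (1/2 + 1/l)) := by ring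
    _ ≤ Co * (Λ * (1/2 + 1/l)) := mul_le_mul_of_nonneg_right h2 (by positivity)
    _ = _ := by ring

lemma Am_n (S : Setup n k a l Λ R₀ N Co Φ g x₀ ε R u) (x : Euc n) : ‖Am a x‖ ≤ Λ * ‖x‖ :=
  Am_norm a Λ (fun i => (S.a0 i).le) S.haL S.L0.le x

lemma e_pos (_S : Setup n k a l Λ R₀ N Co Φ g x₀ ε R u) (P : Prof ((n:ℝ)/(2*k)) ε e c1 C2 ρm φ φ') (hc1 : 0 < c1) : 0 < e :=
  hc1.trans_le P.e1

lemma grad_bd (S : Setup n k a l Λ R₀ N Co Φ g x₀ ε R u) (P : Prof ((n:ℝ)/(2*k)) ε e c1 C2 (4 * R₀ / l + 1) φ φ') (hc1 : 0 < c1)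
    (hN : 2 * k * (C2 + (4 * R₀ / l + 1)) ≤ N) (v : Euc n) (hv : ‖v‖ ≤ 1) :
    ∀ x ∈ Rg (rho x₀) (ε ^ 2 / 2) (Qf a 0) R, 
      fderiv ℝ u x v - inner ℝ (Am a v) x ≤ (R₀ + Co) / c1 * e + Λ + Co * Λ * (1/2 + 1/l) := by
  set G := (R₀ + Co) / c1 * e + Λ + Co * Λ * (1/2 + 1/l) with hG
  have hL := S.L0
  have hl := S.hl
  have hCo := S.hCo
  have hR0 := S.hR0
  have he := S.e_pos P hc1
  have hM : 0 < (R₀ + Co) / c1 := by positivity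
  have cd1 : ∀ x ∈ Rg (rho x₀) (ε ^ 2 / 2) (Qf a 0) R, ContDiffAt ℝ 2 (fun y => fderiv ℝ u y (v + (0 : Euc n →L[ℝ] Euc n) y)) x :=
    fun x hx => vec_contDiffAt u x (S.hu x hx) v 0
  have cd2 : ∀ x, ContDiffAt ℝ 2 (fun y => innerSL ℝ (Am a v) y + G) x :=
    fun x => (innerSL ℝ (Am a v)).contDiff.contDiffAt.add contDiffAt_const
  have hAv : ‖Am a v‖ ≤ Λ := (S.Am_n v).trans (by nlinarith)
  have key : ∀ x ∈ Rg (rho x₀) (ε ^ 2 / 2) (Qf a 0) R,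
      fderiv ℝ u x (v + (0 : Euc n →L[ℝ] Euc n) x) - (innerSL ℝ (Am a v) x + G) ≤ 0 := by
    refine S.mp _ _ (Qf_cont _ _) (Qf_cont _ _) (S.bddA _) subset_rfl subset_rfl 
      (fun x => fderiv ℝ u x (v + (0 : Euc n →L[ℝ] Euc n) x) - (innerSL ℝ (Am a v) x + G))
      (fun x hx => (cd1 x hx).sub (cd2 x)) ?_ ?_ ?_
    · intro x hx h
      obtain ⟨b, h1, h2, h3⟩ := S.grad_in P hc1 hN h
      have hk0 : (0:ℝ) < k := by exact_mod_cast S.hk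
      have he0 := S.he0
      have hb : 0 ≤ b := le_trans (by positivity) h1
      have hxn : ‖x‖ ≤ 1 := by linarith [S.rho_le S.he0.le (le_of_eq h), S.he2]
      have hy : ‖x - x₀‖ ≤ ε := by
        have h' : rho x₀ x = ε^2/2 := h
        rw [rho, Qf_one] at h'
        exact abs_le_of_sq_le_sq' (by linarith) he0.le |>.2
      have e1 : inner ℝ (x - x₀) v ≤ ε := (real_inner_le_norm _ _).trans (by nlinarith [norm_nonneg v, norm_nonneg (x - x₀)])
      have e2 : -Λ ≤ inner ℝ (Am a v) x := by
        have := neg_le_of_abs_le (abs_real_inner_le_norm (Am a v) x)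
        nlinarith [norm_nonneg x, norm_nonneg (Am a v)]
      have e3 : b * inner ℝ (x - x₀) v ≤ (R₀ + Co) / c1 * e := by
        calc b * inner ℝ (x - x₀) v ≤ b * ε := mul_le_mul_of_nonneg_left e1 hb
          _ ≤ ((R₀ + Co) / c1 * (e / ε)) * ε := mul_le_mul_of_nonneg_right h2 he0.le
          _ = _ := by field_simp
      simp only [FunLike.coe_zero, Pi.zero_apply, add_zero, innerSL_apply_apply]
      rw [h3]
      have : 0 < Co * Λ * (1/2 + 1/l) := by positivity
      linarith
    · intro x hx h
      obtain ⟨θ, h1, h2, h3⟩ := S.grad_out h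
      simp only [FunLike.coe_zero, Pi.zero_apply, add_zero, innerSL_apply_apply]
      rw [h3, Am_symm a v x, real_inner_comm (Am a x) v]
      have e1 : inner ℝ (Am a x) v ≤ Λ * ‖x‖ := (real_inner_le_norm _ _).trans (by 
        have := S.Am_n x
        nlinarith [norm_nonneg (Am a x), norm_nonneg v])
      have e2 := S.theta_bd h2 h.le
      have e3 : (θ - 1) * inner ℝ (Am a x) v ≤ (θ - 1) * (Λ * ‖x‖) := mul_le_mul_of_nonneg_left e1 (by linarith)
      have : 0 < (R₀ + Co) / c1 * e := by positivity
      linarith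
    · intro x hx
      change 0 ≤ Lo n k u (fun x => fderiv ℝ u x (v + (0 : Euc n →L[ℝ] Euc n) x) - (innerSL ℝ (Am a v) x + G)) x
      rw [Lo_sub (cd1 x (RgO_sub hx)) (cd2 x), Lo_lin, S.Lo_vec hx v 0 0 (by simp)]
      simp
  intro x hx
  have := key x hx
  simp only [FunLike.coe_zero, Pi.zero_apply, add_zero, innerSL_apply_apply] at this
  linarith

/-- gradient near the inner boundary -/
lemma grad_near (S : Setup n k a l Λ R₀ N Co Φ g x₀ ε R u) (P : Prof ((n:ℝ)/(2*k)) ε e c1 C2 (4 * R₀ / l + 1) φ φ') (hc1 : 0 < c1)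
    (hN : 2 * k * (C2 + (4 * R₀ / l + 1)) ≤ N) {x : Euc n} (hx : x ∈ Rg (rho x₀) (ε ^ 2 / 2) (rho x₀) (1/2)) (v : Euc n) :
      |fderiv ℝ u x v| ≤ ((R₀ + Co) / c1 + (3 * Λ + Co * Λ * (1/2 + 1/l)) / c1) * e * ‖v‖ := by
  have hL := S.L0
  have hl := S.hl
  have hCo := S.hCo
  have hR0 := S.hR0
  have hx1 : ‖x‖ ≤ 2 := by linarith [S.rho_le (x := x) (r := 1) (by norm_num) (by linarith [hx.2])]
  have h1 : ∀ v : Euc n, ‖v‖ ≤ 1 → fderiv ℝ u x v ≤ ((R₀ + Co) / c1 + (3 * Λ + Co * Λ * (1/2 + 1/l)) / c1) * e := by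
    intro v hv
    have h1 := S.grad_bd P hc1 hN v hv x (S.rSub le_rfl hx)
    have hAv : ‖Am a v‖ ≤ Λ := (S.Am_n v).trans (by nlinarith)
    have h2 : inner ℝ (Am a v) x ≤ 2 * Λ := (real_inner_le_norm _ _).trans (by nlinarith [norm_nonneg x, norm_nonneg (Am a v)])
    have h3 : 3 * Λ + Co * Λ * (1/2 + 1/l) ≤ (3 * Λ + Co * Λ * (1/2 + 1/l)) / c1 * e := by
      rw [div_mul_eq_mul_div, le_div_iff₀ hc1]
      exact mul_le_mul_of_nonneg_left P.e1 (by positivity)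
    linarith
  set D := ((R₀ + Co) / c1 + (3 * Λ + Co * Λ * (1/2 + 1/l)) / c1) * e
  rcases eq_or_ne v 0 with rfl | hv
  · simp
  have hv' : 0 < ‖v‖ := norm_pos_iff.2 hv
  have h2 := h1 (‖v‖⁻¹ • v) (by rw [norm_smul, norm_inv, norm_norm, inv_mul_cancel₀ hv'.ne'])
  have h3 := h1 (-(‖v‖⁻¹ • v)) (by rw [norm_neg, norm_smul, norm_inv, norm_norm, inv_mul_cancel₀ hv'.ne'])
  rw [map_neg, map_smul, smul_eq_mul, ← mul_neg] at h3
  rw [map_smul, smul_eq_mul] at h2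
  rw [inv_mul_le_iff₀ hv'] at h2 h3
  rw [abs_le]; constructor <;> linarith

lemma inner_key (S : Setup n k a l Λ R₀ N Co Φ g x₀ ε R u) (P : Prof ((n:ℝ)/(2*k)) ε e c1 C2 (4 * R₀ / l + 1) φ φ') (hc1 : 0 < c1)
    (hN : 2 * k * (C2 + (4 * R₀ / l + 1)) ≤ N) {p : Euc n} (hp : rho x₀ p = ε ^ 2 / 2) (η : Euc n) (hη : inner ℝ (p - x₀) η = 0)
    {b : ℝ} (hb0 : 0 ≤ b) (hb : ∀ v, fderiv ℝ u p v = b * inner ℝ (p - x₀) v) :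
    ∃ c, |c| ≤ 4 * ((R₀ + Co) / c1 + (3 * Λ + Co * Λ * (1/2 + 1/l)) / c1) / c1 * ‖η‖ * b / ε ∧
      ∀ v, fderiv ℝ (fderiv ℝ u) p v η = b * inner ℝ η v + c * inner ℝ (p - x₀) v := by
  have hL := S.L0
  have hl := S.hl
  have hCo := S.hCo
  have hR0 := S.hR0
  have he0 := S.he0
  have hk0 : (0:ℝ) < k := by exact_mod_cast S.hk
  have hk1 : (1:ℝ) ≤ k := by exact_mod_cast S.hk
  have heps := S.e2lt
  have he := S.e_pos P hc1
  set D := (R₀ + Co) / c1 + (3 * Λ + Co * Λ * (1/2 + 1/l)) / c1 with hD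
  have hD0 : 0 < D := by positivity
  set M := Mop η (p - x₀) with hM
  set C' := 4 * D * ‖η‖ * ε / c1 with hC'
  have hC'0 : 0 ≤ C' := by positivity
  have hynorm : ∀ x, rho x₀ x = ε^2/2 → ‖x - x₀‖ ^ 2 = ε ^ 2 := by
    intro x hx; rw [rho, Qf_one] at hx; linarith
  have hpn := hynorm p hp
  have hpn1 : ‖p - x₀‖ = ε := (sq_eq_sq₀ (norm_nonneg _) he0.le).1 hpn
  have hsub : Rg (rho x₀) (ε ^ 2 / 2) (rho x₀) (2 * ε ^ 2) ⊆ Rg (rho x₀) (ε ^ 2 / 2) (Qf a 0) R := S.rSub (by linarith)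
  have hsubO : RgO (rho x₀) (ε ^ 2 / 2) (rho x₀) (2 * ε ^ 2) ⊆ RgO (rho x₀) (ε ^ 2 / 2) (Qf a 0) R := S.rSubO (by linarith)
  have hMy : ∀ x, -(M x₀) + M x = M (x - x₀) := by intro x; rw [map_sub]; abel
  have hMin : ∀ y, inner ℝ y (M y) = 0 := by
    intro y; rw [hM, Mop_apply, inner_sub_right, inner_smul_right, inner_smul_right, real_inner_comm y, real_inner_comm y]; ring
  set f : Euc n → ℝ := fun x => fderiv ℝ u x (-(M x₀) + M x) with hf
  set h : Euc n → ℝ := fun x => u x - wb k x₀ ε φ x with hh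
  have fcd : ∀ x ∈ Rg (rho x₀) (ε ^ 2 / 2) (rho x₀) (2 * ε ^ 2), ContDiffAt ℝ 2 f x :=
    fun x hx => vec_contDiffAt u x (S.hu x (hsub hx)) _ _
  have hcd : ∀ x ∈ Rg (rho x₀) (ε ^ 2 / 2) (rho x₀) (2 * ε ^ 2), ContDiffAt ℝ 2 h x :=
    fun x hx => (S.u2 (hsub hx)).sub (wb_cd P (rho_pos he0 hx.1))
  have fz : ∀ x, rho x₀ x = ε^2/2 → f x = 0 := by
    intro x hx
    obtain ⟨b', -, -, h3⟩ := S.grad_in P hc1 hN hx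
    simp only [hf]
    rw [h3, hMy, hMin, mul_zero]
  have hz : ∀ x, rho x₀ x = ε^2/2 → h x = 0 := by
    intro x hx
    simp only [hh, wb]
    rw [S.hin x hx, hx, P.z]; simp
  have hbd : ∀ x ∈ Rg (rho x₀) (ε ^ 2 / 2) (rho x₀) (2 * ε ^ 2), rho x₀ x = 2 * ε ^ 2 → |f x| ≤ C' * h x := by
    intro x hx hx2
    have h1 := S.grad_near P hc1 hN (x := x) ⟨hx.1, by linarith⟩ (-(M x₀) + M x)
    have h2 : ‖-(M x₀) + M x‖ ≤ 4 * ‖η‖ * ε ^ 2 := by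
      rw [hMy]
      have := Mop_norm η (p - x₀) (x - x₀)
      rw [hpn1] at this
      have hy : ‖x - x₀‖ ≤ 2 * ε := by
        rw [rho, Qf_one] at hx2
        exact abs_le_of_sq_le_sq' (by linarith) (by linarith) |>.2
      refine this.trans ?_
      calc 2 * ‖η‖ * ε * ‖x - x₀‖ ≤ 2 * ‖η‖ * ε * (2 * ε) := mul_le_mul_of_nonneg_left hy (by positivity)
        _ = _ := by ring
    have h3 : c1 * (e * ε) ≤ h x := by
      have hs := S.w2_le P hN x ⟨hx.1, by
        have := S.rho_le (x := x) (r := 1) (by norm_num) (by linarith [hx.2])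
        linarith [S.small (x := x) (by linarith)]⟩
      have hw : c1 * (e * ε) ≤ wb k x₀ ε φ x := by
        unfold wb
        rw [hx2]
        have := P.two
        have h0 : 0 ≤ c1 * (e * ε) := by positivity
        nlinarith [sq_nonneg ε]
      simp only [hh]; linarith
    calc |f x| ≤ D * e * ‖-(M x₀) + M x‖ := h1
      _ ≤ D * e * (4 * ‖η‖ * ε ^ 2) := mul_le_mul_of_nonneg_left h2 (by positivity)
      _ = C' * (c1 * (e * ε)) := by rw [hC']; field_simp
      _ ≤ C' * h x := mul_le_mul_of_nonneg_left h3 hC'0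
  have Lh : ∀ x ∈ RgO (rho x₀) (ε ^ 2 / 2) (rho x₀) (2 * ε ^ 2), Lo n k u h x ≤ 0 := by
    intro x hx
    rw [hh, Lo_sub (S.u2 (hsub (RgO_sub hx))) (wb_cd P (rho_pos he0 hx.1.le)), S.Lo_u (hsubO hx)]
    linarith [S.Lo_wb P (hsubO hx)]
  have Lf : ∀ x ∈ RgO (rho x₀) (ε ^ 2 / 2) (rho x₀) (2 * ε ^ 2), Lo n k u f x = 0 := by
    intro x hx
    have := S.Lo_vec (hsubO hx) (-(M x₀)) M 0 (Mop_anti _ _)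
    rw [hf, this]; simp
  have main : ∀ σ : ℝ, |σ| = 1 → ∀ x ∈ Rg (rho x₀) (ε ^ 2 / 2) (rho x₀) (2 * ε ^ 2), σ * f x - C' * h x ≤ 0 := by
    intro σ hσ
    refine S.mp _ _ (Qf_cont _ _) (Qf_cont _ _) (S.bddB _) hsub hsubO (fun x => σ * f x - C' * h x)
      (fun x hx => (contDiffAt_const.mul (fcd x hx)).sub (contDiffAt_const.mul (hcd x hx))) ?_ ?_ ?_
    · intro x hx hx'
      rw [fz x hx', hz x hx']; simp
    · intro x hx hx'
      have := hbd x hx hx'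
      have h2 : σ * f x ≤ |f x| := (le_abs_self _).trans (by rw [abs_mul, hσ, one_mul])
      linarith
    · intro x hx
      have hx' := RgO_sub hx
      change 0 ≤ Lo n k u (fun x => σ * f x - C' * h x) x
      rw [Lo_sub (contDiffAt_const.mul (fcd x hx')) (contDiffAt_const.mul (hcd x hx')), Lo_smul _ (fcd x hx'), Lo_smul _ (hcd x hx'), Lf x hx]
      have := Lh x hx
      nlinarith
  have mabs : ∀ x ∈ Rg (rho x₀) (ε ^ 2 / 2) (rho x₀) (2 * ε ^ 2), |f x| ≤ C' * h x := by
    intro x hx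
    have h1 := main 1 (by simp) x hx
    have h2 := main (-1) (by simp) x hx
    rw [abs_le]; constructor <;> linarith
  have hpmem : p ∈ Rg (rho x₀) (ε ^ 2 / 2) (rho x₀) (2 * ε ^ 2) := ⟨hp.ge, by rw [hp]; nlinarith⟩
  have hu2 := S.u2 (hsub hpmem)
  have hfu : HasFDerivAt u (fderiv ℝ u p) p := (hu2.differentiableAt (by norm_num)).hasFDerivAt
  obtain ⟨L, hL1, hL2⟩ := vec_hasFDerivAt u p hu2 (-(M x₀)) M
  have hhd := (hfu.sub (wb_fd P (rho_pos he0 hp.ge))).const_mul C'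
  have hinn : inner ℝ (p - x₀) (p - x₀) = ε ^ 2 := by rw [real_inner_self_eq_norm_sq, hpn]
  obtain ⟨c, hc, hc2⟩ := bdry_mult (f := f) (h := fun x => C' * h x) (p - x₀) (p - x₀) (by rw [hinn]; positivity) hL1 hhd (fz p hp) (by rw [hz p hp, mul_zero])
    (by
      intro v hv
      have hinc : ∀ᶠ t in 𝓝[>] (0:ℝ), rho x₀ p < rho x₀ (p + t • v) :=
        dir_inc (Qf_hasFDerivAt _ x₀ p) v (by rw [Qd_one]; exact hv)
      have hlt : ∀ᶠ t in 𝓝[>] (0:ℝ), rho x₀ (p + t • v) < 2 * ε ^ 2 := 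
        dir_lt (Qf_cont _ _).continuousAt (by rw [← rho, hp]; nlinarith) v
      filter_upwards [hinc, hlt] with t h1 h2
      exact mabs _ ⟨by linarith, h2.le⟩) (C' * b)
    (by
      intro v hv
      simp only [FunLike.coe_smul, FunLike.coe_sub, Pi.sub_apply, Pi.smul_apply, smul_eq_mul, Qd_one]
      rw [hb, mul_assoc C' b]
      refine mul_le_mul_of_nonneg_left ?_ hC'0
      have : 0 ≤ k * (φ' (rho x₀ p) + 1) * inner ℝ (p - x₀) v := by
        have := P.pos _ (rho_pos he0 hp.ge); positivity
      linarith)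
  refine ⟨c / ε ^ 2, ?_, ?_⟩
  · rw [abs_div, abs_of_pos (show 0 < ε ^ 2 by positivity), div_le_iff₀ (by positivity)]
    refine hc.trans (le_of_eq ?_)
    rw [hC']; field_simp
  · intro v
    have h1 := hL2 v
    rw [hc2, hMy, hb, hM, Mop_apply, Mop_apply, hinn, real_inner_comm (p - x₀) η, hη, zero_smul, sub_zero, map_smul, inner_sub_right, inner_smul_right, inner_smul_right, hη, hinn] at h1
    simp only [smul_eq_mul, mul_zero, zero_sub] at h1
    have : ε ≠ 0 := he0.ne'
    field_simp
    linear_combination -h1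

end Setup

end Part12

section Part13

lemma hess_fin {n k : ℕ} (hk : 1 ≤ k) (hkn : k ≤ n) (a : Fin n → ℝ) (ha : ∀ i, 0 < a i) (Λ : ℝ) (haL : ∀ i, a i ≤ Λ) (hΛ : 0 ≤ Λ) (m σ₀ : ℝ) :
    ∃ C : ℝ, 0 < C ∧ ∀ (u : Euc n → ℝ) (p ν : Euc n) (b : ℝ), ‖ν‖ = 1 → ContDiffAt ℝ 2 u p → 0 < b →
      (∀ η, inner ℝ ν η = 0 → ∃ c, |c| ≤ m * ‖η‖ * b ∧ ∀ v, fderiv ℝ (fderiv ℝ u) p v η = b * inner ℝ (Am a η) v + c * inner ℝ ν v) →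
      SkHess n k u p = 1 → b⁻¹ ^ k ≤ σ₀ → ∀ i j, |hessMat n u p i j| ≤ C * b := by
  obtain ⟨C, hC0, hC⟩ := double_normal hk hkn a ha (Λ + m) σ₀
  refine ⟨C, hC0, fun u p ν b hν hu hb hη hS hσ i j => ?_⟩
  have hsym := hess_symm u p hu
  have hnn : inner ℝ ν ν = 1 := by rw [real_inner_self_eq_norm_sq, hν]; norm_num
  have hto : ∀ ξ : Fin n → ℝ, ξ ⬝ᵥ (fun i => ν i) = inner ℝ ν (WithLp.toLp 2 ξ) := fun ξ => by
    rw [← dot_inner, dotProduct_comm]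
  have key := hC (fun i => ν i) (b⁻¹ • hessMat n u p) (by rw [dot_inner, hnn]) (by rw [Matrix.IsSymm, Matrix.transpose_smul, hsym]) ?_ ?_ ?_ i j
  · rw [Matrix.smul_apply, smul_eq_mul, abs_mul, abs_of_pos (inv_pos.2 hb), inv_mul_le_iff₀ hb] at key
    linarith
  · intro ξ η h1 h2
    rw [hto] at h1 h2
    obtain ⟨c, -, hc⟩ := hη _ h2
    have := hess_qf u p (WithLp.toLp 2 ξ) (WithLp.toLp 2 η)
    rw [hc, h1, mul_zero, add_zero] at this
    rw [Matrix.smul_mulVec, dotProduct_smul]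
    change b⁻¹ * ((fun i => (WithLp.toLp 2 ξ : Euc n) i) ⬝ᵥ (hessMat n u p).mulVec (fun i => (WithLp.toLp 2 η : Euc n) i)) = _
    rw [this, inv_mul_cancel_left₀ hb.ne', Am_inner]
    simp only [dotProduct, Matrix.mulVec_diagonal]
    exact Finset.sum_congr rfl fun i _ => by ring
  · intro ξ h1 h2
    rw [hto] at h1
    obtain ⟨c, hc1, hc⟩ := hη _ h1
    have := hess_qf u p (WithLp.toLp 2 ξ) ν
    rw [(hu.isSymmSndFDerivAt (by simp)).eq, hc, hnn, mul_one] at this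
    have hξ : ‖(WithLp.toLp 2 ξ : Euc n)‖ = 1 := by
      have h3 : ‖(WithLp.toLp 2 ξ : Euc n)‖ ^ 2 = 1 := by
        rw [← real_inner_self_eq_norm_sq, ← dot_inner]; exact h2
      exact (sq_eq_sq₀ (norm_nonneg _) zero_le_one).1 (by rw [h3]; norm_num)
    rw [hξ, mul_one] at hc1
    rw [Matrix.smul_mulVec, dotProduct_smul]
    change |b⁻¹ * ((fun i => (WithLp.toLp 2 ξ : Euc n) i) ⬝ᵥ (hessMat n u p).mulVec (fun i => ν i))| ≤ _
    rw [this, abs_mul, abs_of_pos (inv_pos.2 hb), inv_mul_le_iff₀ hb]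
    have h4 : |inner ℝ (Am a (WithLp.toLp 2 ξ)) ν| ≤ Λ := by
      refine (abs_real_inner_le_norm _ _).trans ?_
      rw [hν, mul_one]
      refine (Am_norm a Λ (fun i => (ha i).le) haL hΛ _).trans ?_
      rw [hξ, mul_one]
    refine (abs_add_le _ _).trans ?_
    rw [abs_mul, abs_of_pos hb]
    nlinarith
  · have h5 : matSk n k (hessMat n u p) = 1 := hS
    rw [matSk_smul hkn _ _ hsym, h5, mul_one, abs_of_pos (by positivity)]
    exact hσ

lemma Am_one {n : ℕ} (x : Euc n) : Am (fun _ => (1:ℝ)) x = x := by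
  ext i; rw [Am_apply]; simp

lemma inner_hess (n k : ℕ) (hk : 1 ≤ k) (hkn : k ≤ n) (l Λ R₀ Co c1 : ℝ) (hl : 0 < l) (hΛ : 0 < Λ) (hR : 0 < R₀) (hCo : 0 < Co) (hc1 : 0 < c1) :
    ∃ C > 0, ∀ (a : Fin n → ℝ) (N : ℝ) (Φ g : ℝ → ℝ) (x₀ : Euc n) (ε R : ℝ) (u : Euc n → ℝ) (e C2 : ℝ) (φ φ' : ℝ → ℝ),
      Setup n k a l Λ R₀ N Co Φ g x₀ ε R u → Prof ((n:ℝ)/(2*k)) ε e c1 C2 (4 * R₀ / l + 1) φ φ' →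
      2 * k * (C2 + (4 * R₀ / l + 1)) ≤ N → ∀ p, rho x₀ p = ε ^ 2 / 2 → ∀ i j, |hessMat n u p i j| ≤ C * (e / ε) := by
  obtain ⟨C, hC0, hC⟩ := hess_fin hk hkn (fun _ => 1) (fun _ => one_pos) 1 (fun _ => le_rfl) zero_le_one
    (4 * ((R₀ + Co) / c1 + (3 * Λ + Co * Λ * (1/2 + 1/l)) / c1) / c1) (c1⁻¹ ^ k)
  refine ⟨C * ((R₀ + Co) / c1), by positivity, ?_⟩
  intro a N Φ g x₀ ε R u e C2 φ φ' S P hN p hp i j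
  obtain ⟨b, hb1, hb2, hb3⟩ := S.grad_in P hc1 hN hp
  have hk1 : (1:ℝ) ≤ k := by exact_mod_cast hk
  have he0 := S.he0
  have he := S.e_pos P hc1
  have hb0 : c1 ≤ b := by
    have h1 : e ≤ e / ε := by rw [le_div_iff₀ he0]; nlinarith [S.he2]
    have h2 := P.e1
    nlinarith
  have hb : 0 < b := hc1.trans_le hb0
  have hnp := S.rho_le S.he0.le hp.le
  have hsm := S.small (x := p) (by linarith [S.he2])
  have hmem : p ∈ Rg (rho x₀) (ε ^ 2 / 2) (Qf a 0) R := ⟨hp.ge, by linarith [S.hR, S.hR0]⟩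
  have hpn : ‖p - x₀‖ = ε := by
    have h' := hp
    rw [rho, Qf_one] at h'
    exact (sq_eq_sq₀ (norm_nonneg _) he0.le).1 (by linarith)
  have hinn : inner ℝ (p - x₀) (p - x₀) = ε ^ 2 := by rw [real_inner_self_eq_norm_sq, hpn]
  have := hC u p (ε⁻¹ • (p - x₀)) b (by rw [norm_smul, hpn, norm_inv, Real.norm_of_nonneg he0.le, inv_mul_cancel₀ he0.ne'])
    (S.u2 hmem) hb ?_ ?_ ?_ i j
  · calc |hessMat n u p i j| ≤ C * b := this
      _ ≤ C * ((R₀ + Co) / c1 * (e / ε)) := mul_le_mul_of_nonneg_left hb2 hC0.le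
      _ = _ := by ring
  · intro η hη
    rw [inner_smul_left] at hη
    have hη' : inner ℝ (p - x₀) η = 0 := (mul_eq_zero.1 hη).resolve_left (by simpa using he0.ne')
    obtain ⟨c, hc, hc'⟩ := S.inner_key P hc1 hN hp η hη' hb.le hb3
    refine ⟨c * ε, ?_, fun v => ?_⟩
    · rw [abs_mul, abs_of_pos he0]
      rwa [← le_div_iff₀ he0]
    · rw [hc', Am_one, inner_smul_left]
      simp only [conj_trivial]
      field_simp
  · refine sk_lim (v := p - x₀) (S.u2 hmem) ?_
    have hinc : ∀ᶠ t in 𝓝[>] (0:ℝ), rho x₀ p < rho x₀ (p + t • (p - x₀)) :=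
      dir_inc (Qf_hasFDerivAt _ x₀ p) _ (by rw [Qd_one, hinn]; positivity)
    have hlt : ∀ᶠ t in 𝓝[>] (0:ℝ), Qf a 0 (p + t • (p - x₀)) < R :=
      dir_lt (Qf_cont _ _).continuousAt (by linarith [S.hR, S.hR0]) _
    filter_upwards [hinc, hlt] with t h1 h2
    exact S.hE _ ⟨by linarith, h2⟩
  · exact pow_le_pow_left₀ (by positivity) (inv_anti₀ hc1 hb0) k

end Part13

section Part14

lemma rot_field {n : ℕ} (a : Fin n → ℝ) (l Λ : ℝ) (hl : 0 < l) (hla : ∀ i, l ≤ a i) (haL : ∀ i, a i ≤ Λ) (hΛ : 0 < Λ) (p τ : Euc n) (hp : 0 < ‖p‖) :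
    ∃ (M : Euc n →L[ℝ] Euc n) (μ : ℝ), (∃ v w, M = Mop v w) ∧ |μ| * (l * ‖p‖) ≤ Λ * ‖τ‖ ∧
      (∀ z, ‖M z‖ * (l * ‖p‖) ≤ 4 * Λ * ‖τ‖ * ‖z‖) ∧ ∀ z, inner ℝ (Am a p) (M z) = -inner ℝ (Am a τ) z + μ * inner ℝ (Am a p) z := by
  have ha0 : ∀ i, 0 ≤ a i := fun i => hl.le.trans (hla i)
  have hτ := Am_norm a Λ ha0 haL hΛ.le τ
  set P := Am a p with hP
  have h1 : l * ‖p‖ ≤ ‖P‖ := by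
    have h2 := (Am_lower a l hla p).trans (real_inner_le_norm _ _)
    rw [pow_two, ← mul_assoc] at h2
    exact le_of_mul_le_mul_right h2 hp
  have hP0 : 0 < ‖P‖ := lt_of_lt_of_le (by positivity) h1
  set μ := inner ℝ (Am a τ) P / ‖P‖ ^ 2 with hμ
  have hμ1 : |μ| * ‖P‖ ≤ ‖Am a τ‖ := by
    rw [hμ, abs_div, abs_of_pos (show 0 < ‖P‖ ^ 2 by positivity), div_mul_eq_mul_div, div_le_iff₀ (by positivity)]
    have := abs_real_inner_le_norm (Am a τ) P
    nlinarith
  set q := Am a τ - μ • P with hq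
  have hqn : ‖q‖ ≤ 2 * (Λ * ‖τ‖) := by
    have := norm_sub_le (Am a τ) (μ • P)
    rw [norm_smul, Real.norm_eq_abs] at this
    linarith
  have hPP : inner ℝ P P = ‖P‖ ^ 2 := real_inner_self_eq_norm_sq P
  have hqP : inner ℝ P q = 0 := by
    rw [hq, inner_sub_right, inner_smul_right, hPP, hμ, div_mul_cancel₀ _ (by positivity), real_inner_comm]; ring
  refine ⟨Mop ((‖P‖ ^ 2)⁻¹ • q) P, μ, ⟨_, _, rfl⟩, ?_, ?_, ?_⟩
  · calc |μ| * (l * ‖p‖) ≤ |μ| * ‖P‖ := mul_le_mul_of_nonneg_left h1 (abs_nonneg _)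
      _ ≤ _ := hμ1.trans hτ
  · intro z
    have h3 := Mop_norm ((‖P‖ ^ 2)⁻¹ • q) P z
    rw [norm_smul, norm_inv, norm_pow, norm_norm] at h3
    calc _ ≤ ‖Mop ((‖P‖ ^ 2)⁻¹ • q) P z‖ * ‖P‖ := mul_le_mul_of_nonneg_left h1 (norm_nonneg _)
      _ ≤ (2 * ((‖P‖ ^ 2)⁻¹ * ‖q‖) * ‖P‖ * ‖z‖) * ‖P‖ := mul_le_mul_of_nonneg_right h3 hP0.le
      _ = 2 * ‖q‖ * ‖z‖ := by field_simp
      _ ≤ 2 * (2 * (Λ * ‖τ‖)) * ‖z‖ := by gcongr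
      _ = _ := by ring
  · intro z
    rw [Mop_apply, inner_sub_right, inner_smul_right, inner_smul_right, inner_smul_right, hqP, inner_smul_left, hPP, hq, inner_sub_left, inner_smul_left]
    simp only [conj_trivial]
    field_simp
    ring

noncomputable def cK1 (l Λ Co : ℝ) : ℝ := 2 * (1 + Co) * Λ * (4 / l + 1)
noncomputable def cK2 (l Λ R₀ Co c1 C2 : ℝ) : ℝ := (R₀ + Co) / c1 * C2 + cK1 l Λ Co + 2 + 2 * Co
noncomputable def cK4 (l Λ R₀ Co c1 C2 : ℝ) : ℝ := cK1 l Λ Co + (cK2 l Λ R₀ Co c1 C2 + 2 + 2 * Co)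
noncomputable def cK6 (l Λ : ℝ) : ℝ := 1 + 8 * Λ ^ 2 / l ^ 2
noncomputable def cK7 (l Λ R₀ Co c1 C2 : ℝ) : ℝ := 2 * cK4 l Λ R₀ Co c1 C2 * cK6 l Λ * (6 * Λ / l) + (1 + Co) * (Λ / l + 8 * Λ ^ 2 / l ^ 2)

namespace Setup
variable {n k : ℕ} {a : Fin n → ℝ} {l Λ R₀ N Co : ℝ} {Φ g : ℝ → ℝ} {x₀ : Euc n} {ε R : ℝ} {u : Euc n → ℝ}
variable {e c1 C2 ρm : ℝ} {φ φ' : ℝ → ℝ}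

lemma R1 (S : Setup n k a l Λ R₀ N Co Φ g x₀ ε R u) : 1 ≤ R := by linarith [S.hR, S.hR0]

lemma gle (S : Setup n k a l Λ R₀ N Co Φ g x₀ ε R u) : g R ≤ 1 + Co := by
  have h1 := S.O.gR R S.hR
  have h2 := S.R1
  have h3 := S.O.g1 R (by linarith)
  nlinarith

lemma lL (S : Setup n k a l Λ R₀ N Co Φ g x₀ ε R u) : l ≤ Λ := by
  have := S.hn
  exact (S.hla ⟨0, by omega⟩).trans (S.haL _)

lemma nn_bd (S : Setup n k a l Λ R₀ N Co Φ g x₀ ε R u) {p : Euc n} (hp : Qf a 0 p ≤ R) : ‖p‖ * (‖p‖ + 1) ≤ R * (4 / l + 1) := by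
  have h1 := S.s_low p
  have hl := S.hl
  have h2 : ‖p‖ ^ 2 ≤ 2 * R / l := by rw [le_div_iff₀ hl]; linarith
  have h3 := S.R1
  have : R * (4/l + 1) = 2 * (2 * R / l) + R := by ring
  rw [this]
  nlinarith [sq_nonneg (‖p‖ - 1)]

lemma th_bd (S : Setup n k a l Λ R₀ N Co Φ g x₀ ε R u) {p : Euc n} (hp : Qf a 0 p = R) {θ : ℝ} (h1 : 1 ≤ θ) (h2 : θ ≤ g R) (v : Euc n) (c : ℝ) (hc : 0 ≤ c)
    (hv : ‖v‖ ≤ c * (‖p‖ + 1)) : |θ * inner ℝ (Am a p) v| ≤ (1 + Co) * Λ * (4 / l + 1) * R * c := by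
  have hL := S.L0
  have hCo := S.hCo
  rw [abs_mul, abs_of_nonneg (by linarith)]
  have h3 : |inner ℝ (Am a p) v| ≤ (Λ * ‖p‖) * (c * (‖p‖ + 1)) :=
    (abs_real_inner_le_norm _ _).trans (mul_le_mul (S.Am_n p) hv (norm_nonneg _) (by positivity))
  have h4 := S.nn_bd hp.le
  calc _ ≤ (1 + Co) * ((Λ * ‖p‖) * (c * (‖p‖ + 1))) := mul_le_mul (h2.trans S.gle) h3 (abs_nonneg _) (by positivity)
    _ = (1 + Co) * Λ * c * (‖p‖ * (‖p‖ + 1)) := by ring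
    _ ≤ (1 + Co) * Λ * c * (R * (4 / l + 1)) := mul_le_mul_of_nonneg_left h4 (by positivity)
    _ = _ := by ring

lemma rot_bd (S : Setup n k a l Λ R₀ N Co Φ g x₀ ε R u) (P : Prof ((n:ℝ)/(2*k)) ε e c1 C2 (4 * R₀ / l + 1) φ φ') (hc1 : 0 < c1)
    (hN : 2 * k * (C2 + (4 * R₀ / l + 1)) ≤ N) (v w : Euc n) :
    ∀ x ∈ Rg (rho x₀) (ε ^ 2 / 2) (Qf a 0) R, fderiv ℝ u x (Mop v w (x - x₀)) ≤ cK1 l Λ Co * R * (‖v‖ * ‖w‖) := by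
  set G := cK1 l Λ Co * R * (‖v‖ * ‖w‖) with hG
  have hL := S.L0
  have hl := S.hl
  have hCo := S.hCo
  have hR := S.R1
  have hG0 : 0 ≤ G := by rw [hG, cK1]; positivity
  set M := Mop v w with hM
  have hMy : ∀ x, -(M x₀) + M x = M (x - x₀) := by intro x; rw [map_sub]; abel
  have hMin : ∀ y, inner ℝ y (M y) = 0 := by
    intro y; rw [hM, Mop_apply, inner_sub_right, inner_smul_right, inner_smul_right, real_inner_comm y, real_inner_comm y]; ring
  have cd1 : ∀ x ∈ Rg (rho x₀) (ε ^ 2 / 2) (Qf a 0) R, ContDiffAt ℝ 2 (fun y => fderiv ℝ u y (-(M x₀) + M y)) x :=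
    fun x hx => vec_contDiffAt u x (S.hu x hx) _ M
  have key : ∀ x ∈ Rg (rho x₀) (ε ^ 2 / 2) (Qf a 0) R, fderiv ℝ u x (-(M x₀) + M x) - G ≤ 0 := by
    refine S.mp _ _ (Qf_cont _ _) (Qf_cont _ _) (S.bddA _) subset_rfl subset_rfl
      (fun x => fderiv ℝ u x (-(M x₀) + M x) - G) (fun x hx => (cd1 x hx).sub contDiffAt_const) ?_ ?_ ?_
    · intro x hx h
      obtain ⟨b, h1, h2, h3⟩ := S.grad_in P hc1 hN h
      beta_reduce
      rw [h3, hMy, hMin]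
      linarith
    · intro x hx h
      obtain ⟨θ, h1, h2, h3⟩ := S.grad_out h
      beta_reduce
      rw [h3, hMy]
      have h4 : ‖M (x - x₀)‖ ≤ 2 * ‖v‖ * ‖w‖ * (‖x‖ + 1) := by
        refine (Mop_norm v w _).trans (mul_le_mul_of_nonneg_left ?_ (by positivity))
        linarith [norm_sub_le x x₀, S.hx0]
      have h5 := (le_abs_self _).trans (S.th_bd h h1 h2 _ _ (by positivity) h4)
      rw [hG, cK1]; linarith
    · intro x hx
      change 0 ≤ Lo n k u (fun x => fderiv ℝ u x (-(M x₀) + M x) - G) x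
      rw [Lo_sub (cd1 x (RgO_sub hx)) contDiffAt_const, Lo_const, S.Lo_vec hx _ M 0 (Mop_anti _ _)]
      simp
  intro x hx
  have := key x hx
  rw [hMy] at this
  linarith

lemma dil_bd (S : Setup n k a l Λ R₀ N Co Φ g x₀ ε R u) (P : Prof ((n:ℝ)/(2*k)) ε e c1 C2 (4 * R₀ / l + 1) φ φ') (hc1 : 0 < c1)
    (hC2 : 0 < C2) (hN : 2 * k * (C2 + (4 * R₀ / l + 1)) ≤ N) (σ : ℝ) (hσ : |σ| = 1) :
    ∀ x ∈ Rg (rho x₀) (ε ^ 2 / 2) (Qf a 0) R, σ * (fderiv ℝ u x (x - x₀) - 2 * u x) ≤ cK2 l Λ R₀ Co c1 C2 * R := by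
  set G := cK2 l Λ R₀ Co c1 C2 * R with hG
  have hL := S.L0
  have hl := S.hl
  have hCo := S.hCo
  have hR := S.R1
  have hR0 := S.hR0
  have he0 := S.he0
  have hk0 : (0:ℝ) < k := by exact_mod_cast S.hk
  have he := S.e_pos P hc1
  have hK1 : 0 < cK1 l Λ Co := by rw [cK1]; positivity
  set M := ContinuousLinearMap.id ℝ (Euc n) with hM
  have hMy : ∀ x, -x₀ + M x = x - x₀ := by intro x; simp [hM]; abel
  have cd1 : ∀ x ∈ Rg (rho x₀) (ε ^ 2 / 2) (Qf a 0) R, ContDiffAt ℝ 2 (fun y => fderiv ℝ u y (-x₀ + M y)) x :=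
    fun x hx => vec_contDiffAt u x (S.hu x hx) _ M
  have cd2 : ∀ x ∈ Rg (rho x₀) (ε ^ 2 / 2) (Qf a 0) R, ContDiffAt ℝ 2 (fun y => fderiv ℝ u y (-x₀ + M y) - 2 * u y) x :=
    fun x hx => (cd1 x hx).sub (contDiffAt_const.mul (S.u2 hx))
  have key : ∀ x ∈ Rg (rho x₀) (ε ^ 2 / 2) (Qf a 0) R, σ * (fderiv ℝ u x (-x₀ + M x) - 2 * u x) - G ≤ 0 := by
    have hs : ∀ t : ℝ, |t| ≤ G → σ * t - G ≤ 0 := by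
      intro t ht
      have : σ * t ≤ |t| := (le_abs_self _).trans (by rw [abs_mul, hσ, one_mul])
      linarith
    refine S.mp _ _ (Qf_cont _ _) (Qf_cont _ _) (S.bddA _) subset_rfl subset_rfl
      (fun x => σ * (fderiv ℝ u x (-x₀ + M x) - 2 * u x) - G) (fun x hx => (contDiffAt_const.mul (cd2 x hx)).sub contDiffAt_const) ?_ ?_ ?_
    · intro x hx h
      obtain ⟨b, h1, h2, h3⟩ := S.grad_in P hc1 hN h
      have hb : 0 ≤ b := le_trans (by positivity) h1
      refine hs _ ?_
      have h' : rho x₀ x = ε^2/2 := h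
      rw [rho, Qf_one] at h'
      rw [h3, hMy, real_inner_self_eq_norm_sq, S.hin x h, mul_zero, sub_zero, abs_of_nonneg (by positivity), show ‖x - x₀‖ ^ 2 = ε ^ 2 by linarith]
      have h4 : b * ε ^ 2 ≤ (R₀ + Co) / c1 * C2 := by
        calc b * ε ^ 2 ≤ ((R₀ + Co) / c1 * (e / ε)) * ε ^ 2 := mul_le_mul_of_nonneg_right h2 (by positivity)
          _ = (R₀ + Co) / c1 * (e * ε) := by field_simp
          _ ≤ _ := mul_le_mul_of_nonneg_left P.e2 (by positivity)
      have h5 : (R₀ + Co) / c1 * C2 ≤ cK2 l Λ R₀ Co c1 C2 := by rw [cK2]; linarith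
      have h6 : 0 < (R₀ + Co) / c1 * C2 := by positivity
      rw [hG]; nlinarith
    · intro x hx h
      obtain ⟨θ, h1, h2, h3⟩ := S.grad_out h
      refine hs _ ?_
      rw [h3, hMy, S.hout x h]
      have h4 : ‖x - x₀‖ ≤ 1 * (‖x‖ + 1) := by linarith [norm_sub_le x x₀, S.hx0]
      have h5 := abs_le.1 (S.th_bd h h1 h2 _ _ (by positivity) h4)
      have h6 := S.O.lo R S.hR
      have h7 := S.O.hi R S.hR
      have h8 : 0 < (R₀ + Co) / c1 * C2 * R := by positivity
      have h9 : Co ≤ Co * R := by nlinarith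
      have h10 : 0 ≤ (1 + Co) * Λ * (4 / l + 1) * R := by positivity
      rw [hG, cK2, cK1, abs_le]
      constructor <;> nlinarith
    · intro x hx
      have hx' := RgO_sub hx
      change 0 ≤ Lo n k u (fun x => σ * (fderiv ℝ u x (-x₀ + M x) - 2 * u x) - G) x
      rw [Lo_sub (contDiffAt_const.mul (cd2 x hx')) contDiffAt_const, Lo_const, Lo_smul _ (cd2 x hx'),
        Lo_sub (cd1 x hx') (contDiffAt_const.mul (S.u2 hx')), Lo_smul _ (S.u2 hx'), S.Lo_u hx, S.Lo_vec hx _ M 1 id_conf]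
      simp
  intro x hx
  have := key x hx
  rw [hMy] at this
  linarith

lemma grad_far (S : Setup n k a l Λ R₀ N Co Φ g x₀ ε R u) (P : Prof ((n:ℝ)/(2*k)) ε e c1 C2 (4 * R₀ / l + 1) φ φ') (hc1 : 0 < c1)
    (hC2 : 0 < C2) (hN : 2 * k * (C2 + (4 * R₀ / l + 1)) ≤ N) {x : Euc n} (hx : x ∈ Rg (rho x₀) (ε ^ 2 / 2) (Qf a 0) R) (v : Euc n) :
    |fderiv ℝ u x v| * ‖x - x₀‖ ≤ cK4 l Λ R₀ Co c1 C2 * R * ‖v‖ := by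
  have hL := S.L0
  have hl := S.hl
  have hCo := S.hCo
  have hR := S.R1
  have hR0 := S.hR0
  have hpos := rho_pos (x := x) S.he0 hx.1
  rw [rho, Qf_one] at hpos
  set y := x - x₀ with hy
  have hyn : 0 < ‖y‖ := by
    rcases (norm_nonneg y).eq_or_lt with h | h
    · rw [← h] at hpos; norm_num at hpos
    · exact h
  have h1 := S.dil_bd P hc1 hC2 hN 1 (by simp) x hx
  have h2 := S.dil_bd P hc1 hC2 hN (-1) (by simp) x hx
  rw [← hy] at h1 h2
  have u1 := S.u_le x hx
  have u2 := S.u_ge x hx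
  have h3 : |fderiv ℝ u x y| ≤ (cK2 l Λ R₀ Co c1 C2 + 2 + 2 * Co) * R := by
    have h9 : Co ≤ Co * R := by nlinarith
    have := hx.2
    have := S.s_nn x
    have := S.hR0L
    have := S.hR
    rw [abs_le]; constructor <;> linarith
  have h4 := S.rot_bd P hc1 hN v y x hx
  have h5 := S.rot_bd P hc1 hN (-v) y x hx
  have e1 : Mop v y y = ‖y‖ ^ 2 • v - inner ℝ v y • y := by rw [Mop_apply, real_inner_self_eq_norm_sq]
  have e2 : Mop (-v) y y = -(‖y‖ ^ 2 • v - inner ℝ v y • y) := by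
    rw [Mop_apply, real_inner_self_eq_norm_sq, inner_neg_left, smul_neg, neg_smul]; abel
  rw [← hy, e1, map_sub, map_smul, map_smul] at h4
  rw [← hy, e2, map_neg, map_sub, map_smul, map_smul, norm_neg] at h5
  simp only [smul_eq_mul] at h4 h5
  have h6 : |inner ℝ v y * fderiv ℝ u x y| ≤ (‖v‖ * ‖y‖) * ((cK2 l Λ R₀ Co c1 C2 + 2 + 2 * Co) * R) := by
    rw [abs_mul]
    exact mul_le_mul (abs_real_inner_le_norm _ _) h3 (abs_nonneg _) (by positivity)
  have h7 : ‖y‖ * (|fderiv ℝ u x v| * ‖y‖) ≤ ‖y‖ * (cK4 l Λ R₀ Co c1 C2 * R * ‖v‖) := by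
    have h8 := abs_le.1 h6
    have : |‖y‖ ^ 2 * fderiv ℝ u x v| ≤ ‖y‖ * (cK4 l Λ R₀ Co c1 C2 * R * ‖v‖) := by
      rw [cK4, abs_le]; constructor <;> nlinarith
    rw [abs_mul, abs_of_nonneg (by positivity)] at this
    linarith
  exact le_of_mul_le_mul_left h7 hyn

lemma grad_far' (S : Setup n k a l Λ R₀ N Co Φ g x₀ ε R u) (P : Prof ((n:ℝ)/(2*k)) ε e c1 C2 (4 * R₀ / l + 1) φ φ') (hc1 : 0 < c1)
    (hC2 : 0 < C2) (hN : 2 * k * (C2 + (4 * R₀ / l + 1)) ≤ N) {x : Euc n} (hx1 : R / 3 ≤ Qf a 0 x) (hx2 : Qf a 0 x ≤ R) (v : Euc n) 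
    {p : Euc n} (hp : Qf a 0 p = R) :
    |fderiv ℝ u x v| * ‖p‖ ≤ cK4 l Λ R₀ Co c1 C2 * R * (6 * Λ / l) * ‖v‖ := by
  have hL := S.L0
  have hl := S.hl
  have hR := S.R1
  have hlL := S.lL
  have hxm : R₀ ≤ Qf a 0 x := by linarith [S.hR]
  have h1 := S.grad_far P hc1 hC2 hN (S.outSub le_rfl ⟨hxm, hx2⟩) v
  have hx2 : 2 < ‖x‖ := by
    by_contra hc
    push Not at hc
    linarith [S.small hc]
  have h2 : ‖x‖ / 2 ≤ ‖x - x₀‖ := by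
    have := norm_sub_norm_le x x₀
    linarith [S.hx0]
  have h3 : l / (3 * Λ) * ‖p‖ ≤ ‖x‖ := by
    refine abs_le_of_sq_le_sq' ?_ (norm_nonneg x) |>.2
    have h4 := S.s_low p
    have h5 := S.s_up x
    have h6 : l / (3 * Λ) ≤ 1 := by rw [div_le_one (by positivity)]; linarith
    have h7 : (l / (3 * Λ)) ^ 2 ≤ l / (3 * Λ) := by
      have : 0 < l / (3 * Λ) := by positivity
      nlinarith
    calc (l / (3 * Λ) * ‖p‖) ^ 2 = (l / (3 * Λ)) ^ 2 * ‖p‖ ^ 2 := by ring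
      _ ≤ l / (3 * Λ) * ‖p‖ ^ 2 := mul_le_mul_of_nonneg_right h7 (by positivity)
      _ = (l * ‖p‖ ^ 2) / (3 * Λ) := by ring
      _ ≤ ‖x‖ ^ 2 := by rw [div_le_iff₀ (by positivity)]; linarith
  have h4 : ‖p‖ ≤ (6 * Λ / l) * ‖x - x₀‖ := by
    rw [div_mul_eq_mul_div, le_div_iff₀ hl]
    rw [div_mul_eq_mul_div, div_le_iff₀ (by positivity)] at h3
    nlinarith
  calc |fderiv ℝ u x v| * ‖p‖ ≤ |fderiv ℝ u x v| * ((6 * Λ / l) * ‖x - x₀‖) := mul_le_mul_of_nonneg_left h4 (abs_nonneg _)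
    _ = (6 * Λ / l) * (|fderiv ℝ u x v| * ‖x - x₀‖) := by ring
    _ ≤ (6 * Λ / l) * (cK4 l Λ R₀ Co c1 C2 * R * ‖v‖) := mul_le_mul_of_nonneg_left h1 (by positivity)
    _ = _ := by ring

end Setup

end Part14

section Part15

namespace Setup
variable {n k : ℕ} {a : Fin n → ℝ} {l Λ R₀ N Co : ℝ} {Φ g : ℝ → ℝ} {x₀ : Euc n} {ε R : ℝ} {u : Euc n → ℝ}
variable {e c1 C2 ρm : ℝ} {φ φ' : ℝ → ℝ}

set_option maxHeartbeats 2000000 in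
lemma outer_key (S : Setup n k a l Λ R₀ N Co Φ g x₀ ε R u) (P : Prof ((n:ℝ)/(2*k)) ε e c1 C2 (4 * R₀ / l + 1) φ φ') (hc1 : 0 < c1)
    (hC2 : 0 < C2) (hN : 2 * k * (C2 + (4 * R₀ / l + 1)) ≤ N) {p : Euc n} (hp : Qf a 0 p = R) (τ : Euc n) (hτ : inner ℝ (Am a p) τ = 0)
    {θ : ℝ} (hθ1 : 1 ≤ θ) (hθ : ∀ v, fderiv ℝ u p v = θ * inner ℝ (Am a p) v) :
    ∃ c, |c| * ‖p‖ ≤ (cK7 l Λ R₀ Co c1 C2 + Λ / l) * ‖τ‖ * θ ∧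
      ∀ v, fderiv ℝ (fderiv ℝ u) p v τ = θ * inner ℝ (Am a τ) v + c * inner ℝ (Am a p) v := by
  have hL := S.L0
  have hl := S.hl
  have hCo := S.hCo
  have hR0 := S.hR0
  have hRR := S.hR
  have hR1 := S.R1
  have hlL := S.lL
  have ha0 : ∀ i, 0 ≤ a i := fun i => (S.a0 i).le
  have hpp : inner ℝ (Am a p) p = 2 * R := by have := hp; rw [Qf_a] at this; linarith
  have hpn : 0 < ‖p‖ := by
    rcases (norm_nonneg p).eq_or_lt with h | h
    · have := S.s_up p; rw [← h, hp] at this; norm_num at this; linarith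
    · exact h
  have hK4 : 0 ≤ cK4 l Λ R₀ Co c1 C2 := by rw [cK4, cK2, cK1]; positivity
  have hK6 : 0 ≤ cK6 l Λ := by rw [cK6]; positivity
  have hK7 : 0 ≤ cK7 l Λ R₀ Co c1 C2 := by rw [cK7]; positivity
  obtain ⟨M, μ, ⟨v1, v2, hM⟩, hμ, hMn, hMi⟩ := rot_field a l Λ hl S.hla S.haL hL p τ hpn
  have hμ' : |μ| * ‖p‖ ≤ Λ / l * ‖τ‖ := by
    rw [div_mul_eq_mul_div, le_div_iff₀ hl]; linarith
  have hMn' : ∀ z, ‖M z‖ * ‖p‖ ≤ 4 * Λ / l * ‖τ‖ * ‖z‖ := by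
    intro z
    have := hMn z
    rw [div_mul_eq_mul_div, div_mul_eq_mul_div, le_div_iff₀ hl]; linarith
  set b := τ - M p with hb
  have hT : ∀ x, b + M x = τ + M (x - p) := by intro x; rw [map_sub, hb]; abel
  set ell : Euc n → ℝ := fun x => innerSL ℝ (-(Am a p)) x + 2 * R with hell
  have ell_eq : ∀ x, ell x = 2 * R - inner ℝ (Am a p) x := by
    intro x; simp only [hell, innerSL_apply_apply, inner_neg_left]; ring
  set f : Euc n → ℝ := fun x => fderiv ℝ u x (b + M x) with hf
  set K := cK7 l Λ R₀ Co c1 C2 * ‖τ‖ / ‖p‖ with hK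
  have hK0 : 0 ≤ K := by positivity
  have hsub : Rg (Qf a 0) (R / 3) (Qf a 0) R ⊆ Rg (rho x₀) (ε ^ 2 / 2) (Qf a 0) R := S.outSub (by linarith)
  have hsubO : RgO (Qf a 0) (R / 3) (Qf a 0) R ⊆ RgO (rho x₀) (ε ^ 2 / 2) (Qf a 0) R := S.outSubO (by linarith)
  have fcd : ∀ x ∈ Rg (Qf a 0) (R / 3) (Qf a 0) R, ContDiffAt ℝ 2 f x :=
    fun x hx => vec_contDiffAt u x (S.hu x (hsub hx)) _ _
  have ecd : ∀ x, ContDiffAt ℝ 2 ell x := fun x =>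
    (innerSL ℝ (-(Am a p))).contDiff.contDiffAt.add contDiffAt_const
  have hred : ∀ x, |f x| * ‖p‖ ≤ cK7 l Λ R₀ Co c1 C2 * ‖τ‖ * ell x → |f x| ≤ K * ell x := by
    intro x h
    rw [hK, div_mul_eq_mul_div, le_div_iff₀ hpn]; exact h
  have bd1 : ∀ x, Qf a 0 x = R / 3 → |f x| ≤ K * ell x := by
    intro x hx
    refine hred x ?_
    have hxx : inner ℝ (Am a x) x = 2 * R / 3 := by have := hx; rw [Qf_a] at this; linarith
    have h1 := S.grad_far' P hc1 hC2 hN (x := x) hx.ge (by linarith) (b + M x) hp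
    have hxn : ‖x‖ ≤ Λ / l * ‖p‖ := by
      refine abs_le_of_sq_le_sq' ?_ (by positivity) |>.2
      have h4 := S.s_low x
      have h5 := S.s_up p
      have h6 : 1 ≤ Λ / l := by rw [one_le_div hl]; exact hlL
      calc ‖x‖ ^ 2 ≤ Λ / l * ‖p‖ ^ 2 := by
            rw [div_mul_eq_mul_div, le_div_iff₀ hl]; linarith
        _ ≤ (Λ / l) ^ 2 * ‖p‖ ^ 2 := mul_le_mul_of_nonneg_right (by nlinarith) (by positivity)
        _ = _ := by ring
    have hxp : ‖x - p‖ ≤ 2 * (Λ / l) * ‖p‖ := by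
      have h6 : 1 ≤ Λ / l := by rw [one_le_div hl]; exact hlL
      have := norm_sub_le x p
      nlinarith
    have hTn : ‖b + M x‖ ≤ cK6 l Λ * ‖τ‖ := by
      rw [hT]
      refine (norm_add_le _ _).trans ?_
      have h7 : ‖M (x - p)‖ ≤ 8 * Λ ^ 2 / l ^ 2 * ‖τ‖ := by
        refine le_of_mul_le_mul_right ((hMn' (x - p)).trans ?_) hpn
        calc 4 * Λ / l * ‖τ‖ * ‖x - p‖ ≤ 4 * Λ / l * ‖τ‖ * (2 * (Λ / l) * ‖p‖) := mul_le_mul_of_nonneg_left hxp (by positivity)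
          _ = _ := by field_simp; ring
      rw [cK6]; linarith
    have hle : R / 2 ≤ ell x := by
      rw [ell_eq]
      have := Am_cs a ha0 p ((3/2 : ℝ) • x)
      rw [map_smul, inner_smul_left, inner_smul_right, inner_smul_right, hpp, hxx] at this
      simp only [conj_trivial] at this
      linarith
    calc |f x| * ‖p‖ ≤ cK4 l Λ R₀ Co c1 C2 * R * (6 * Λ / l) * ‖b + M x‖ := h1
      _ ≤ cK4 l Λ R₀ Co c1 C2 * R * (6 * Λ / l) * (cK6 l Λ * ‖τ‖) := mul_le_mul_of_nonneg_left hTn (by positivity)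
      _ = (2 * cK4 l Λ R₀ Co c1 C2 * cK6 l Λ * (6 * Λ / l)) * ‖τ‖ * (R / 2) := by ring
      _ ≤ cK7 l Λ R₀ Co c1 C2 * ‖τ‖ * (R / 2) := by
          refine mul_le_mul_of_nonneg_right (mul_le_mul_of_nonneg_right ?_ (norm_nonneg _)) (by positivity)
          rw [cK7]
          have : 0 ≤ (1 + Co) * (Λ / l + 8 * Λ ^ 2 / l ^ 2) := by positivity
          linarith
      _ ≤ _ := mul_le_mul_of_nonneg_left hle (by positivity)
  have bd2 : ∀ x, Qf a 0 x = R → |f x| ≤ K * ell x := by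
    intro x hx
    refine hred x ?_
    obtain ⟨θ', t1, t2, t3⟩ := S.grad_out hx
    have hxx : inner ℝ (Am a x) x = 2 * R := by have := hx; rw [Qf_a] at this; linarith
    set z := x - p with hz
    have hxz : x = p + z := by rw [hz]; abel
    have hpz : inner ℝ (Am a z) p = inner ℝ (Am a p) z := by rw [Am_symm, real_inner_comm]
    have hτz : inner ℝ (Am a z) τ = inner ℝ (Am a τ) z := by rw [Am_symm, real_inner_comm]
    have hzz : ell x = inner ℝ (Am a z) z / 2 := by
      rw [ell_eq]
      rw [hxz, map_add, inner_add_left, inner_add_right, inner_add_right, hpz, hpp] at hxx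
      rw [hxz, inner_add_right, hpp]
      linarith
    have hz2 : ell x = - inner ℝ (Am a p) z := by
      rw [ell_eq, hxz, inner_add_right, hpp]; ring
    have hlow := Am_lower a l S.hla z
    have hell0 : 0 ≤ ell x := by rw [hzz]; have : 0 ≤ l * ‖z‖^2 := by positivity
                                 linarith
    have hzl : ‖z‖ ^ 2 ≤ 2 / l * ell x := by
      rw [div_mul_eq_mul_div, le_div_iff₀ hl]; linarith
    have e1 : f x = θ' * (μ * inner ℝ (Am a p) z + inner ℝ (Am a z) (M z)) := by
      simp only [hf]
      rw [t3, hT, ← hz]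
      congr 1
      rw [hxz, map_add, inner_add_left, inner_add_right, inner_add_right, hτ, hMi, hτz]
      ring
    have e2 : |μ * inner ℝ (Am a p) z| * ‖p‖ ≤ (Λ / l) * ‖τ‖ * ell x := by
      rw [abs_mul, show |inner ℝ (Am a p) z| = ell x by rw [← abs_neg, ← hz2, abs_of_nonneg hell0]]
      nlinarith
    have e3 : |inner ℝ (Am a z) (M z)| * ‖p‖ ≤ (8 * Λ ^ 2 / l ^ 2) * ‖τ‖ * ell x := by
      calc |inner ℝ (Am a z) (M z)| * ‖p‖ ≤ (Λ * ‖z‖ * ‖M z‖) * ‖p‖ := by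
            refine mul_le_mul_of_nonneg_right ?_ hpn.le
            exact (abs_real_inner_le_norm _ _).trans (mul_le_mul_of_nonneg_right (S.Am_n z) (norm_nonneg _))
        _ = Λ * ‖z‖ * (‖M z‖ * ‖p‖) := by ring
        _ ≤ Λ * ‖z‖ * (4 * Λ / l * ‖τ‖ * ‖z‖) := mul_le_mul_of_nonneg_left (hMn' z) (by positivity)
        _ = 4 * Λ ^ 2 / l * ‖τ‖ * ‖z‖ ^ 2 := by ring
        _ ≤ 4 * Λ ^ 2 / l * ‖τ‖ * (2 / l * ell x) := mul_le_mul_of_nonneg_left hzl (by positivity)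
        _ = _ := by field_simp; ring
    have e4 : |μ * inner ℝ (Am a p) z + inner ℝ (Am a z) (M z)| * ‖p‖ ≤ (Λ / l + 8 * Λ ^ 2 / l ^ 2) * ‖τ‖ * ell x := by
      have := mul_le_mul_of_nonneg_right (abs_add_le (μ * inner ℝ (Am a p) z) (inner ℝ (Am a z) (M z))) hpn.le
      linarith
    rw [e1, abs_mul, abs_of_nonneg (by linarith), mul_assoc]
    calc _ ≤ (1 + Co) * ((Λ / l + 8 * Λ ^ 2 / l ^ 2) * ‖τ‖ * ell x) :=
          mul_le_mul (t2.trans S.gle) e4 (by positivity) (by positivity)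
      _ = ((1 + Co) * (Λ / l + 8 * Λ ^ 2 / l ^ 2)) * (‖τ‖ * ell x) := by ring
      _ ≤ cK7 l Λ R₀ Co c1 C2 * (‖τ‖ * ell x) := by
          refine mul_le_mul_of_nonneg_right ?_ (by positivity)
          rw [cK7]
          have : 0 ≤ 2 * cK4 l Λ R₀ Co c1 C2 * cK6 l Λ * (6 * Λ / l) := by positivity
          linarith
      _ = _ := by ring
  have main : ∀ σ : ℝ, |σ| = 1 → ∀ x ∈ Rg (Qf a 0) (R / 3) (Qf a 0) R, σ * f x - K * ell x ≤ 0 := by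
    intro σ hσ
    have hle : ∀ x, |f x| ≤ K * ell x → σ * f x - K * ell x ≤ 0 := by
      intro x h
      have h2 : σ * f x ≤ |f x| := (le_abs_self _).trans (by rw [abs_mul, hσ, one_mul])
      linarith
    refine S.mp _ _ (Qf_cont _ _) (Qf_cont _ _) (S.bddA _) hsub hsubO (fun x => σ * f x - K * ell x)
      (fun x hx => (contDiffAt_const.mul (fcd x hx)).sub (contDiffAt_const.mul (ecd x))) ?_ ?_ ?_
    · intro x hx hx'
      exact hle x (bd1 x hx')
    · intro x hx hx'
      exact hle x (bd2 x hx')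
    · intro x hx
      have hx' := RgO_sub hx
      change 0 ≤ Lo n k u (fun x => σ * f x - K * ell x) x
      rw [Lo_sub (contDiffAt_const.mul (fcd x hx')) (contDiffAt_const.mul (ecd x)), Lo_smul _ (fcd x hx'), Lo_smul _ (ecd x)]
      have h1 : Lo n k u f x = 2 * 0 * k := S.Lo_vec (hsubO hx) b M 0 (by rw [hM]; exact Mop_anti _ _)
      have h2 : Lo n k u ell x = 0 := Lo_lin _ _
      rw [h1, h2]; simp
  have mabs : ∀ x ∈ Rg (Qf a 0) (R / 3) (Qf a 0) R, |f x| ≤ K * ell x := by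
    intro x hx
    have h1 := main 1 (by simp) x hx
    have h2 := main (-1) (by simp) x hx
    rw [abs_le]; constructor <;> linarith
  have hpmem : p ∈ Rg (Qf a 0) (R / 3) (Qf a 0) R := ⟨by linarith, hp.le⟩
  have hu2 := S.u2 (hsub hpmem)
  obtain ⟨L, hL1, hL2⟩ := vec_hasFDerivAt u p hu2 b M
  have hbp : b + M p = τ := by rw [hb]; abel
  have hed : HasFDerivAt ell (innerSL ℝ (-(Am a p))) p := (innerSL ℝ (-(Am a p))).hasFDerivAt.add_const _
  have hhd := hed.const_mul K
  obtain ⟨c, hc, hc2⟩ := bdry_mult (f := f) (h := fun x => K * ell x) (-(Am a p)) (-p) (by rw [inner_neg_neg, hpp]; linarith) hL1 hhd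
    (by simp only [hf]; rw [hbp, hθ, hτ, mul_zero]) (by rw [ell_eq, hpp]; ring)
    (by
      intro v hv
      rw [inner_neg_left] at hv
      have hdec : ∀ᶠ t in 𝓝[>] (0:ℝ), Qf a 0 (p + t • v) < Qf a 0 p :=
        dir_dec (Qf_hasFDerivAt a 0 p) v (by rw [Qd_a]; linarith)
      have hgt : ∀ᶠ t in 𝓝[>] (0:ℝ), R / 3 < Qf a 0 (p + t • v) := dir_gt (Qf_cont _ _).continuousAt (by linarith) v
      filter_upwards [hdec, hgt] with t h1 h2
      exact mabs _ ⟨h2.le, by linarith⟩) K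
    (by
      intro v hv
      simp only [FunLike.coe_smul, Pi.smul_apply, smul_eq_mul, innerSL_apply_apply]
      exact le_rfl)
  refine ⟨-(c + θ * μ), ?_, ?_⟩
  · rw [abs_neg]
    have h1 : |c| * ‖p‖ ≤ cK7 l Λ R₀ Co c1 C2 * ‖τ‖ := by
      rw [hK, le_div_iff₀ hpn] at hc; exact hc
    have h2 := mul_le_mul_of_nonneg_right (abs_add_le c (θ * μ)) hpn.le
    rw [abs_mul, abs_of_nonneg (by linarith : 0 ≤ θ)] at h2
    have h3 : θ * (|μ| * ‖p‖) ≤ θ * (Λ / l * ‖τ‖) := mul_le_mul_of_nonneg_left hμ' (by linarith)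
    have h4 : 0 ≤ cK7 l Λ R₀ Co c1 C2 * ‖τ‖ := by positivity
    nlinarith
  · intro v
    have h1 := hL2 v
    rw [hc2, hbp, hθ, hMi, inner_neg_left] at h1
    linear_combination -h1

end Setup

lemma outer_hess (n k : ℕ) (hk : 1 ≤ k) (hkn : k ≤ n) (a : Fin n → ℝ) (l Λ R₀ Co c1 C2 : ℝ) (hl : 0 < l) (hla : ∀ i, l ≤ a i) (haL : ∀ i, a i ≤ Λ)
    (hΛ : 0 < Λ) (hCo : 0 < Co) (hc1 : 0 < c1) (hC2 : 0 < C2) :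
    ∃ C > 0, ∀ (N : ℝ) (Φ g : ℝ → ℝ) (x₀ : Euc n) (ε R : ℝ) (u : Euc n → ℝ) (e : ℝ) (φ φ' : ℝ → ℝ),
      Setup n k a l Λ R₀ N Co Φ g x₀ ε R u → Prof ((n:ℝ)/(2*k)) ε e c1 C2 (4 * R₀ / l + 1) φ φ' →
      2 * k * (C2 + (4 * R₀ / l + 1)) ≤ N → ∀ p, Qf a 0 p = R → ∀ i j, |hessMat n u p i j| ≤ C := by
  obtain ⟨C, hC0, hC⟩ := hess_fin hk hkn a (fun i => hl.trans_le (hla i)) Λ haL hΛ.le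
    ((cK7 l Λ R₀ Co c1 C2 + Λ / l) * Λ) 1
  refine ⟨C * (1 + Co), by positivity, ?_⟩
  intro N Φ g x₀ ε R u e φ φ' S P hN p hp i j
  obtain ⟨θ, h1, h2, h3⟩ := S.grad_out hp
  have hR1 := S.R1
  have hmem : p ∈ Rg (rho x₀) (ε ^ 2 / 2) (Qf a 0) R := S.outSub le_rfl ⟨by linarith [S.hR, S.hR0], hp.le⟩
  have hpp : inner ℝ (Am a p) p = 2 * R := by have := hp; rw [Qf_a] at this; linarith
  have hA0 : 0 < ‖Am a p‖ := by
    rcases (norm_nonneg (Am a p)).eq_or_lt with h | h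
    · rw [norm_eq_zero.1 h.symm, inner_zero_left] at hpp; linarith
    · exact h
  have := hC u p (‖Am a p‖⁻¹ • Am a p) θ (by rw [norm_smul, norm_inv, norm_norm, inv_mul_cancel₀ hA0.ne'])
    (S.u2 hmem) (by linarith) ?_ ?_ ?_ i j
  · exact this.trans (mul_le_mul_of_nonneg_left (h2.trans S.gle) hC0.le)
  · intro η hη
    rw [inner_smul_left] at hη
    have hη' : inner ℝ (Am a p) η = 0 := (mul_eq_zero.1 hη).resolve_left (by simpa using norm_pos_iff.1 hA0)
    obtain ⟨c, hc, hc'⟩ := S.outer_key P hc1 hC2 hN hp η hη' h1 h3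
    refine ⟨c * ‖Am a p‖, ?_, fun v => ?_⟩
    · rw [abs_mul, abs_norm]
      calc |c| * ‖Am a p‖ ≤ |c| * (Λ * ‖p‖) := mul_le_mul_of_nonneg_left (S.Am_n p) (abs_nonneg _)
        _ = Λ * (|c| * ‖p‖) := by ring
        _ ≤ Λ * ((cK7 l Λ R₀ Co c1 C2 + Λ / l) * ‖η‖ * θ) := mul_le_mul_of_nonneg_left hc hΛ.le
        _ = _ := by ring
    · rw [hc', inner_smul_left]
      simp only [conj_trivial]
      field_simp
  · refine sk_lim (v := -p) (S.u2 hmem) ?_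
    have hdec : ∀ᶠ t in 𝓝[>] (0:ℝ), Qf a 0 (p + t • (-p)) < Qf a 0 p :=
      dir_dec (Qf_hasFDerivAt a 0 p) _ (by rw [Qd_a, inner_neg_right, hpp]; linarith)
    have hgt : ∀ᶠ t in 𝓝[>] (0:ℝ), R₀ < Qf a 0 (p + t • (-p)) := dir_gt (Qf_cont _ _).continuousAt (by linarith [S.hR, S.hR0]) _
    filter_upwards [hdec, hgt] with t h1 h2
    exact S.hE _ (S.outSubO le_rfl ⟨h2, by linarith⟩)
  · exact pow_le_one₀ (by positivity) (inv_le_one_of_one_le₀ h1)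

end Part15


lemma Ceps_lin (n k : ℕ) (C ε : ℝ) : Ceps n k C ε = C * Ceps n k 1 ε := by
  unfold Ceps
  split_ifs <;> ring

lemma Omega_eq {n : ℕ} (a : Fin n → ℝ) (x₀ : Euc n) (ε R : ℝ) (he : 0 < ε) :
    OmegaRe n a x₀ ε R = RgO (rho x₀) (ε ^ 2 / 2) (Qf a 0) R := by
  ext x
  rw [OmegaRe, ESet, closure_ball x₀ he.ne', RgO, rho]
  simp only [Set.mem_diff, Set.mem_setOf_eq, sub_zero, quadA_eq, Metric.mem_closedBall, dist_eq_norm, not_le, Qf_one]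
  constructor
  · rintro ⟨h1, h2⟩
    exact ⟨by nlinarith, h1⟩
  · rintro ⟨h1, h2⟩
    exact ⟨h2, lt_of_pow_lt_pow_left₀ 2 (norm_nonneg _) (by linarith)⟩

lemma sphere_iff {n : ℕ} (x₀ x : Euc n) (ε : ℝ) (he : 0 < ε) : x ∈ Metric.sphere x₀ ε ↔ rho x₀ x = ε ^ 2 / 2 := by
  rw [mem_sphere_iff_norm, rho, Qf_one]
  constructor
  · intro h; rw [h]
  · intro h
    exact (sq_eq_sq₀ (norm_nonneg _) he.le).1 (by linarith)

lemma Rg_closure {n : ℕ} (a : Fin n → ℝ) (Λ R₀ : ℝ) (haL : ∀ i, a i ≤ Λ) (hΛ : 0 < Λ) (hR0 : 1 ≤ R₀) (hR0L : 4 * Λ ≤ R₀)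
    (x₀ : Euc n) (hx0 : ‖x₀‖ < 1 / 2) (ε R : ℝ) (he : 0 < ε) (he2 : ε < 1 / 2) (hR : 3 * R₀ < R) :
    Rg (rho x₀) (ε ^ 2 / 2) (Qf a 0) R ⊆ closure (RgO (rho x₀) (ε ^ 2 / 2) (Qf a 0) R) := by
  intro x hx
  have hup : ∀ y : Euc n, 2 * Qf a 0 y ≤ Λ * ‖y‖ ^ 2 := by
    intro y; have := Am_upper a Λ haL y; rw [Qf_a]; linarith
  have key : ∀ v : Euc n, (∀ᶠ t in 𝓝[>] (0:ℝ), x + t • v ∈ RgO (rho x₀) (ε ^ 2 / 2) (Qf a 0) R) →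
      x ∈ closure (RgO (rho x₀) (ε ^ 2 / 2) (Qf a 0) R) := fun v hv =>
    mem_closure_of_tendsto (dir_tendsto x v) hv
  by_cases hxO : x ∈ RgO (rho x₀) (ε ^ 2 / 2) (Qf a 0) R
  · exact subset_closure hxO
  rcases Rg_bdry hx hxO with h | h
  · have h' := h
    rw [rho, Qf_one] at h'
    have hn : ‖x - x₀‖ = ε := (sq_eq_sq₀ (norm_nonneg _) he.le).1 (by linarith)
    have hxn : ‖x‖ ≤ 1 := by
      have := norm_add_le (x - x₀) x₀
      rw [sub_add_cancel] at this
      linarith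
    have hs : Qf a 0 x < R := by
      have := hup x
      have h2 : ‖x‖ ^ 2 ≤ 1 := by nlinarith [norm_nonneg x]
      nlinarith
    refine key (x - x₀) ?_
    have hinc : ∀ᶠ t in 𝓝[>] (0:ℝ), rho x₀ x < rho x₀ (x + t • (x - x₀)) :=
      dir_inc (Qf_hasFDerivAt _ x₀ x) _ (by rw [Qd_one, real_inner_self_eq_norm_sq, hn]; positivity)
    have hlt : ∀ᶠ t in 𝓝[>] (0:ℝ), Qf a 0 (x + t • (x - x₀)) < R :=
      dir_lt (Qf_cont _ _).continuousAt hs _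
    filter_upwards [hinc, hlt] with t h1 h2
    exact ⟨by linarith, h2⟩
  · have hxx : inner ℝ (Am a x) x = 2 * R := by have := h; rw [Qf_a] at this; linarith
    have hrho : ε ^ 2 / 2 < rho x₀ x := by
      rw [rho, Qf_one]
      have h1 := hup x
      have h2 : 2 < ‖x‖ := by
        by_contra hc
        push Not at hc
        have : ‖x‖ ^ 2 ≤ 4 := by nlinarith [norm_nonneg x]
        nlinarith
      have h3 : 1 < ‖x - x₀‖ := by
        have := norm_sub_norm_le x x₀
        linarith
      nlinarith
    refine key (-x) ?_
    have hdec : ∀ᶠ t in 𝓝[>] (0:ℝ), Qf a 0 (x + t • (-x)) < Qf a 0 x :=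
      dir_dec (Qf_hasFDerivAt a 0 x) _ (by rw [Qd_a, inner_neg_right, hxx]; linarith)
    have hgt : ∀ᶠ t in 𝓝[>] (0:ℝ), ε ^ 2 / 2 < rho x₀ (x + t • (-x)) := dir_gt (Qf_cont _ _).continuousAt hrho _
    filter_upwards [hdec, hgt] with t h1 h2
    exact ⟨h2, by linarith⟩

lemma mk_setup {n k : ℕ} (hn : 3 ≤ n) (hk : 1 ≤ k) (hkn : k ≤ n) {a : Fin n → ℝ} {l Λ R₀ N Co α : ℝ} (hl : 0 < l) (hla : ∀ i, l ≤ a i) (haL : ∀ i, a i ≤ Λ)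
    (hS : es Finset.univ a k = 1) (hR0 : 1 ≤ R₀) (hR0L : 4 * Λ ≤ R₀)
    (O : OutP n k a R₀ N Co (fun s => ∫ t in R₀..s, genInt n k a α t) (genInt n k a α)) (hCo : 0 < Co)
    {x₀ : Euc n} (hx0 : ‖x₀‖ < 1 / 2) {ε R : ℝ} (he : 0 < ε) (he2 : ε < 1 / 2) (hR : 3 * R₀ < R) {u : Euc n → ℝ}
    (hu : ApproxSol n k a x₀ ε R R₀ α u) :
    Setup n k a l Λ R₀ N Co (fun s => ∫ t in R₀..s, genInt n k a α t) (genInt n k a α) x₀ ε R u := by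
  obtain ⟨⟨U, hU, hsub, hcd⟩, hK, hE, hin, hout⟩ := hu
  rw [Omega_eq a x₀ ε R he] at hsub hK hE
  have hΛ : 0 < Λ := hl.trans_le ((hla ⟨0, by omega⟩).trans (haL _))
  refine ⟨hn, hk, hkn, hl, hla, haL, hS, hR0, hR0L, O, hCo, hx0, he, he2, hR, ?_, ?_, hE, ?_, ?_⟩
  · intro x hx
    exact hcd.contDiffAt (hU.mem_nhds (hsub (Rg_closure a Λ R₀ haL hΛ hR0 hR0L x₀ hx0 ε R he he2 hR hx)))
  · intro x hx j h1 h2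
    exact hK x hx j h1 h2
  · intro x hx
    exact hin x ((sphere_iff x₀ x ε he).2 hx)
  · intro x hx
    rw [hout x (by rw [quadA_eq, hx]), ubar, quadA_eq, hx]

/-- Lemma 2.6: boundary second-order estimates:
`|D²u^{ε,R}| ≤ C·C_ε·ε⁻¹` on `∂B_ε(x₀)` and `|D²u^{ε,R}| ≤ C` on `∂E_R(0)`. -/
theorem statement8 (n k : ℕ) (hn : 3 ≤ n) (hk1 : 1 ≤ k) (hkn : k ≤ n)
    (a : Fin n → ℝ) (hA : MemA n k (Matrix.diagonal a))
    (hk1' : k = 1 → (⨆ i, a i) < 1 / 2) :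
    ∃ Λ₀ : ℝ, 0 < Λ₀ ∧ ∀ R₀ : ℝ, Λ₀ ≤ R₀ →
      ∃ α₀ : ℝ, 0 < α₀ ∧ ∀ α : ℝ, α₀ ≤ α →
        ∃ C : ℝ, 0 < C ∧
        ∀ x₀ : Euc n, x₀ ∈ Metric.ball (0 : Euc n) (1 / 2) → x₀ ≠ 0 →
        ∀ ε : ℝ, 0 < ε → ε < 1 / 2 →
        ∀ R : ℝ, 3 * R₀ < R →
        ∀ u : Euc n → ℝ, ApproxSol n k a x₀ ε R R₀ α u →
          (∀ x ∈ Metric.sphere x₀ ε,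
            ‖iteratedFDeriv ℝ 2 u x‖ ≤ C * Ceps n k C ε * ε⁻¹) ∧
          (∀ x : Euc n, quadA n (Matrix.diagonal a) x = R →
            ‖iteratedFDeriv ℝ 2 u x‖ ≤ C) := by
  obtain ⟨-, hpd, hS⟩ := hA
  have ha : ∀ i, 0 < a i := fun i => by
    have := Matrix.posDef_diagonal_iff.1 hpd
    exact this i
  rw [matSk_diagonal n k hkn] at hS
  have hne : (Finset.univ : Finset (Fin n)).Nonempty := ⟨⟨0, by omega⟩, Finset.mem_univ _⟩
  obtain ⟨i0, -, hi0⟩ := Finset.exists_min_image Finset.univ a hne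
  obtain ⟨i1, -, hi1⟩ := Finset.exists_max_image Finset.univ a hne
  have hla : ∀ i, a i0 ≤ a i := fun i => hi0 i (Finset.mem_univ _)
  have haL : ∀ i, a i ≤ a i1 := fun i => hi1 i (Finset.mem_univ _)
  have hl := ha i0
  have hL := ha i1
  generalize a i0 = l at hla hl
  generalize a i1 = Λ at haL hL
  refine ⟨max 1 (4 * Λ), by positivity, fun R₀ hR₀ => ?_⟩
  have hR1 : 1 ≤ R₀ := (le_max_left _ _).trans hR₀
  have hR2 : 4 * Λ ≤ R₀ := (le_max_right _ _).trans hR₀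
  have hR0 : 0 < R₀ := by linarith
  obtain ⟨c1, hc1, C2, hC2, hprof⟩ := prof_exists n k hn hk1 hkn (4 * R₀ / l + 1) (by
    have : 0 < 4 * R₀ / l := by positivity
    linarith)
  obtain ⟨α₀, hα₀, hα⟩ := out_exists hn hk1 hkn a ha hS hk1' R₀ (max (2 * R₀) (2 * k * (C2 + (4 * R₀ / l + 1)))) hR1 (le_max_left _ _)
  refine ⟨α₀, hα₀, fun α hαα => ?_⟩
  obtain ⟨Co, hCo, O⟩ := hα α hαα
  obtain ⟨Ci, hCi, hin⟩ := inner_hess n k hk1 hkn l Λ R₀ Co c1 hl hL hR0 hCo hc1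
  obtain ⟨Ce, hCe, hou⟩ := outer_hess n k hk1 hkn a l Λ R₀ Co c1 C2 hl hla haL hL hCo hc1 hC2
  have hX : 0 ≤ (n:ℝ) ^ 2 * Ci := by positivity
  have hY : 0 ≤ (n:ℝ) ^ 2 * Ce := by positivity
  refine ⟨1 + n ^ 2 * Ci + n ^ 2 * Ce, by positivity, ?_⟩
  intro x₀ hx₀ _ ε he he2 R hR u hu
  rw [mem_ball_zero_iff] at hx₀
  have S := mk_setup hn hk1 hkn hl hla haL hS hR1 hR2 O hCo hx₀ he he2 hR hu
  obtain ⟨φ, φ', P⟩ := hprof ε he he2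
  constructor
  · intro x hx
    have h1 := hin _ _ _ _ _ _ _ _ _ _ _ _ S P (le_max_right _ _) x ((sphere_iff x₀ x ε he).1 hx)
    have hepos : 0 < Ceps n k 1 ε := hc1.trans_le P.e1
    have h2 := norm_iter_le u x _ (by positivity) h1
    rw [Ceps_lin]
    have h3 : 0 ≤ Ceps n k 1 ε / ε := by positivity
    calc ‖iteratedFDeriv ℝ 2 u x‖ ≤ (n ^ 2 * Ci) * (Ceps n k 1 ε / ε) := by linarith
      _ ≤ ((1 + n ^ 2 * Ci + n ^ 2 * Ce) * (1 + n ^ 2 * Ci + n ^ 2 * Ce)) * (Ceps n k 1 ε / ε) := by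
          refine mul_le_mul_of_nonneg_right ?_ h3
          nlinarith
      _ = _ := by rw [div_eq_mul_inv]; ring
  · intro x hx
    rw [quadA_eq] at hx
    have h1 := hou _ _ _ _ _ _ _ _ _ _ S P (le_max_right _ _) x hx
    have h2 := norm_iter_le u x _ hCe.le h1
    linarith
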